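/- arXiv:1612.02279 — 4 statements merged into one kernel-verified Lean document; each statement's English description precedes it below -/
import Mathlib

section
/- Let ν > 0, let (W, W') be an exchangeable pair of square-integrable real random variables, let G be a sub-σ-field containing σ(W), let λ > 0, and define R and S by the regression equations (1/λ)E[W'−W | G] = −W + R and (1/(2λ))E[(W'−W)² | G] = 2(W+ν) + S. Then for every continuously differentiable h : ℝ → ℝ with both h and h' Lipschitz-continuous, |E[h(W)] − E[h(Z_ν)]| ≤ ‖h'‖·(max(1, 2/ν)·E|S| + E|R|) + ((max(1, 2/ν)·‖h'‖ + ‖h''‖)/(6λ))·E|W'−W|³. -/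
open MeasureTheory ProbabilityTheory Real

/-- The minimum Lipschitz constant `‖g'‖ = sup_{x ≠ y} |g x - g y| / |x - y|` of `g : ℝ → ℝ`. -/
noncomputable def lipConst (g : ℝ → ℝ) : ℝ :=
  sSup {c | ∃ x y : ℝ, x ≠ y ∧ c = |g x - g y| / |x - y|}

/-- The expectation `E[h(Z_ν)]` of `h` under the centered Gamma distribution `Γ̄(ν)`, the law of
`Z_ν = 2 X_{ν/2,1} − ν` where `X_{ν/2,1} ∼ Γ(ν/2, 1)`. -/
noncomputable def centeredGammaExp (ν : ℝ) (h : ℝ → ℝ) : ℝ :=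
  ∫ x, h (2 * x - ν) ∂(gammaMeasure (ν / 2) 1)

section GammaStein
open Set Filter Topology

lemma gs_cmpL (b Y : ℝ) (φ φ' : ℝ → ℝ)
    (hd : ∀ u ∈ Ioc (0:ℝ) 1, HasDerivAt φ (φ' (Y*u)) (Y*u))
    (hk : ∀ u ∈ Ioo (0:ℝ) 1, (Y*u) * φ' (Y*u) + (b - Y*u) * φ (Y*u) ≤ 0)
    (hlim : Tendsto (fun u : ℝ => u^b * φ (Y*u)) (𝓝[>] 0) (𝓝 0)) : φ Y ≤ 0 := by
  set G : ℝ → ℝ := fun u => u^b * rexp (Y*(1-u)) * φ (Y*u) with hG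
  have hGd : ∀ u ∈ Ioc (0:ℝ) 1, HasDerivAt G
      (u^(b-1) * rexp (Y*(1-u)) * ((Y*u) * φ' (Y*u) + (b - Y*u) * φ (Y*u))) u := by
    intro u hu
    have h1 : HasDerivAt (fun u : ℝ => u^b) (b * u^(b-1)) u :=
      Real.hasDerivAt_rpow_const (Or.inl hu.1.ne')
    have h2 : HasDerivAt (fun u : ℝ => rexp (Y*(1-u))) (rexp (Y*(1-u)) * (-Y)) u := by
      have : HasDerivAt (fun u : ℝ => Y*(1-u)) (-Y) u := by
        simpa using ((hasDerivAt_id u).const_sub 1).const_mul Y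
      exact this.exp
    have h3 : HasDerivAt (fun u : ℝ => φ (Y*u)) (φ' (Y*u) * Y) u := by
      have : HasDerivAt (fun u : ℝ => Y*u) Y u := by
        simpa using (hasDerivAt_id u).const_mul Y
      exact (hd u hu).comp u this
    have h4 := (h1.mul h2).mul h3
    refine h4.congr_deriv ?_
    have : u^b = u^(b-1) * u := by
      rw [← Real.rpow_add_one hu.1.ne']; ring_nf
    simp only [Pi.mul_apply]
    rw [this]; ring
  have hanti : AntitoneOn G (Ioc 0 1) := by
    apply antitoneOn_of_deriv_nonpos (convex_Ioc 0 1)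
    · intro u hu; exact (hGd u hu).continuousAt.continuousWithinAt
    · intro u hu; rw [interior_Ioc] at hu
      exact (hGd u ⟨hu.1, hu.2.le⟩).differentiableAt.differentiableWithinAt
    · intro u hu; rw [interior_Ioc] at hu
      rw [(hGd u ⟨hu.1, hu.2.le⟩).deriv]
      apply mul_nonpos_of_nonneg_of_nonpos
      · have := Real.rpow_nonneg hu.1.le (b-1); positivity
      · exact hk u hu
  have hGlim : Tendsto G (𝓝[>] 0) (𝓝 0) := by
    have h5 : Tendsto (fun u : ℝ => rexp (Y*(1-u))) (𝓝[>] 0) (𝓝 (rexp (Y*(1-0)))) := by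
      have : Continuous (fun u : ℝ => rexp (Y*(1-u))) := by fun_prop
      exact (this.tendsto 0).mono_left nhdsWithin_le_nhds
    have := hlim.mul h5
    rw [zero_mul] at this
    refine this.congr (fun u => ?_)
    simp only [hG]; ring
  have h6 : G 1 ≤ 0 := by
    refine ge_of_tendsto hGlim ?_
    filter_upwards [Ioc_mem_nhdsGT (show (0:ℝ) < 1 by norm_num)] with u hu
    exact hanti hu (by simp) hu.2
  simpa [hG] using h6

lemma gs_cmpR (b Y : ℝ) (hY : 0 < Y) (φ φ' : ℝ → ℝ)
    (hd : ∀ s, Y ≤ s → HasDerivAt φ (φ' s) s)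
    (hk : ∀ s, Y < s → 0 ≤ s * φ' s + (b - s) * φ s)
    (hlim : Tendsto (fun s : ℝ => s^b * rexp (-s) * φ s) atTop (𝓝 0)) : φ Y ≤ 0 := by
  set G : ℝ → ℝ := fun u => u^b * rexp (-u) * φ u with hG
  have hGd : ∀ u ∈ Ici Y, HasDerivAt G
      (u^(b-1) * rexp (-u) * (u * φ' u + (b - u) * φ u)) u := by
    intro u hu
    have hu0 : 0 < u := lt_of_lt_of_le hY hu
    have h1 : HasDerivAt (fun u : ℝ => u^b) (b * u^(b-1)) u :=
      Real.hasDerivAt_rpow_const (Or.inl hu0.ne')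
    have h2 : HasDerivAt (fun u : ℝ => rexp (-u)) (rexp (-u) * (-1)) u :=
      (hasDerivAt_id u).neg.exp
    have h4 := (h1.mul h2).mul (hd u hu)
    refine h4.congr_deriv ?_
    have : u^b = u^(b-1) * u := by
      rw [← Real.rpow_add_one hu0.ne']; ring_nf
    simp only [Pi.mul_apply]
    rw [this]; ring
  have hmono : MonotoneOn G (Ici Y) := by
    apply monotoneOn_of_deriv_nonneg (convex_Ici Y)
    · intro u hu; exact (hGd u hu).continuousAt.continuousWithinAt
    · intro u hu; rw [interior_Ici] at hu
      exact (hGd u (Ioi_subset_Ici_self hu)).differentiableAt.differentiableWithinAt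
    · intro u hu; rw [interior_Ici] at hu
      rw [(hGd u (Ioi_subset_Ici_self hu)).deriv]
      have hu0 : 0 < u := lt_trans hY hu
      have := Real.rpow_nonneg hu0.le (b-1)
      have := hk u hu
      positivity
  have h6 : G Y ≤ 0 := by
    refine ge_of_tendsto hlim ?_
    filter_upwards [eventually_ge_atTop Y] with u hu
    exact hmono (by simp) hu hu
  have h7 : 0 < Y^b * rexp (-Y) := by positivity
  by_contra h8
  push Not at h8
  have : 0 < G Y := mul_pos h7 h8
  linarith

lemma gs_lim0 (b Y D : ℝ) (hb : 1 < b) (hY : Y ≠ 0) (φ : ℝ → ℝ)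
    (h : ∀ u ∈ Ioc (0:ℝ) 1, |(Y*u) * φ (Y*u)| ≤ D) :
    Tendsto (fun u : ℝ => u^b * φ (Y*u)) (𝓝[>] 0) (𝓝 0) := by
  have h1 : Tendsto (fun u : ℝ => u^(b-1) * (D/|Y|)) (𝓝[>] 0) (𝓝 0) := by
    have h2 : ContinuousAt (fun u : ℝ => u^(b-1)) 0 :=
      Real.continuousAt_rpow_const _ _ (Or.inr (by linarith))
    have h3 : Tendsto (fun u : ℝ => u^(b-1)) (𝓝[>] 0) (𝓝 0) := by
      have := h2.tendsto
      rw [Real.zero_rpow (by linarith)] at this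
      exact this.mono_left nhdsWithin_le_nhds
    simpa using h3.mul_const (D/|Y|)
  refine squeeze_zero_norm' ?_ h1
  filter_upwards [Ioc_mem_nhdsGT (show (0:ℝ) < 1 by norm_num)] with u hu
  have h4 := h u hu
  have h5 : u^b = u^(b-1) * u := by
    rw [← Real.rpow_add_one hu.1.ne']; ring_nf
  have h6 : 0 ≤ u^(b-1) := Real.rpow_nonneg hu.1.le _
  rw [h5, Real.norm_eq_abs, mul_assoc, abs_mul, abs_of_nonneg h6]
  apply mul_le_mul_of_nonneg_left _ h6
  rw [le_div_iff₀ (abs_pos.mpr hY), ← abs_mul]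
  calc |u * φ (Y*u) * Y| = |(Y*u) * φ (Y*u)| := by ring_nf
    _ ≤ D := h4

lemma gs_limInf (b D : ℝ) (φ : ℝ → ℝ)
    (h : ∀ s : ℝ, 1 ≤ s → |s * φ s| ≤ D * (1 + s)) :
    Tendsto (fun s : ℝ => s^b * rexp (-s) * φ s) atTop (𝓝 0) := by
  have h1 : Tendsto (fun s : ℝ => (2 * D) * (s^b * rexp (-1*s))) atTop (𝓝 0) := by
    simpa using (tendsto_rpow_mul_exp_neg_mul_atTop_nhds_zero b 1 one_pos).const_mul (2*D)
  refine squeeze_zero_norm' ?_ h1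
  filter_upwards [eventually_ge_atTop 1] with s hs
  have h4 := h s hs
  have hs0 : 0 < s := by linarith
  have h6 : 0 ≤ s^b * rexp (-s) := by positivity
  rw [Real.norm_eq_abs, abs_mul, abs_of_nonneg h6]
  rw [abs_mul, abs_of_pos hs0] at h4
  have hD : 0 ≤ D := by
    have : 0 ≤ s * |φ s| := by positivity
    by_contra hc
    push Not at hc
    nlinarith
  have h7 : |φ s| ≤ 2 * D := by
    by_contra hc
    push Not at hc
    nlinarith
  calc s^b * rexp (-s) * |φ s| ≤ s^b * rexp (-s) * (2*D) := mul_le_mul_of_nonneg_left h7 h6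
    _ = _ := by ring_nf

lemma gs_first (a K : ℝ) (ha : 0 < a) (f f' g : ℝ → ℝ)
    (hd : ∀ t, HasDerivAt f (f' t) t)
    (hode : ∀ t, t * f' t + (a - t) * f t = g t)
    (hg : ∀ x y, x ≤ y → g x - g y ≤ K * (y - x))
    (hlim : Tendsto (fun s : ℝ => s^a * rexp (-s) * f s) atTop (𝓝 0)) :
    ∀ t, f t ≤ K := by
  have hmono : ∀ x y, x ≤ y → g x + K*(x-a) ≤ g y + K*(y-a) := by
    intro x y hxy; have := hg x y hxy; linarith
  have hd' : ∀ t, HasDerivAt (fun t => f t - K) (f' t) t := fun t => (hd t).sub_const K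
  have hode' : ∀ t, t * f' t + (a - t) * (f t - K) = g t + K*(t-a) := by
    intro t; have := hode t; linarith
  have hcont : Continuous f := continuous_iff_continuousAt.mpr fun t => (hd t).continuousAt
  have hl0 : ∀ Y : ℝ, Tendsto (fun u : ℝ => u^a * (f (Y*u) - K)) (𝓝[>] 0) (𝓝 0) := by
    intro Y
    have h2 : ContinuousAt (fun u : ℝ => u^a) 0 :=
      Real.continuousAt_rpow_const _ _ (Or.inr (by linarith))
    have h3 : ContinuousAt (fun u : ℝ => f (Y*u) - K) 0 := by fun_prop
    have := (h2.mul h3).tendsto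
    simp only [Pi.mul_apply] at this
    rw [Real.zero_rpow ha.ne', zero_mul] at this
    exact this.mono_left nhdsWithin_le_nhds
  have hlimK : Tendsto (fun s : ℝ => s^a * rexp (-s) * (f s - K)) atTop (𝓝 0) := by
    have h1 : Tendsto (fun s : ℝ => K * (s^a * rexp (-1*s))) atTop (𝓝 0) := by
      simpa using (tendsto_rpow_mul_exp_neg_mul_atTop_nhds_zero a 1 one_pos).const_mul K
    have := hlim.sub h1
    rw [sub_zero] at this
    refine this.congr (fun s => ?_)
    simp only [neg_mul, one_mul]; ring
  have hpos : ∀ t, 0 < t → f t - K ≤ 0 := by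
    intro t ht
    by_cases hk : g t + K*(t-a) ≤ 0
    · refine gs_cmpL a t (fun t => f t - K) f' (fun u _ => hd' _) ?_ (hl0 t)
      intro u hu
      rw [hode']
      refine le_trans (hmono _ t ?_) hk
      nlinarith [hu.2]
    · push Not at hk
      refine gs_cmpR a t ht (fun t => f t - K) f' (fun u _ => hd' _) ?_ hlimK
      intro s hs
      rw [hode']
      exact le_trans hk.le (hmono _ _ hs.le)
  have h0 : f 0 - K ≤ 0 := by
    have h3 : ContinuousAt (fun u : ℝ => f u - K) 0 := by fun_prop
    refine le_of_tendsto (h3.tendsto.mono_left (nhdsWithin_le_nhds (s := Ioi 0))) ?_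
    filter_upwards [self_mem_nhdsWithin] with u hu using hpos u hu
  have hk0 : g 0 + K*(0-a) ≤ 0 := by
    rw [← hode']; nlinarith
  intro t
  rcases lt_trichotomy t 0 with ht | ht | ht
  · have : f t - K ≤ 0 := by
      refine gs_cmpL a t (fun t => f t - K) f' (fun u _ => hd' _) ?_ (hl0 t)
      intro u hu
      rw [hode']
      refine le_trans (hmono _ 0 ?_) hk0
      nlinarith [hu.1]
    linarith
  · subst ht; linarith
  · have := hpos t ht; linarith

lemma gs_barL (b C D Y : ℝ) (hb : 1 < b) (hC : 0 ≤ C) (hY : Y ≠ 0) (φ φ' g B B' : ℝ → ℝ)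
    (hd : ∀ t, t ≠ 0 → HasDerivAt φ (φ' t) t)
    (hode : ∀ t, t ≠ 0 → t * φ' t + (b - t) * φ t = g t)
    (hg : ∀ t, |g t| ≤ C)
    (hgrow : ∀ t, |t * φ t| ≤ D * (1 + |t|))
    (hBd : ∀ t, HasDerivAt B (B' t) t)
    (hB : ∀ u ∈ Ioo (0:ℝ) 1, 1 ≤ (Y*u) * B' (Y*u) + (b - Y*u) * B (Y*u)) :
    φ Y ≤ C * B Y := by
  have hD : 0 ≤ D := by have := hgrow 0; simpa using this
  have hBc : Continuous B := continuous_iff_continuousAt.mpr fun t => (hBd t).continuousAt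
  have key := gs_cmpL b Y (fun t => φ t - C * B t) (fun t => φ' t - C * B' t) ?_ ?_ ?_
  · linarith
  · intro u hu
    exact (hd _ (mul_ne_zero hY hu.1.ne')).sub ((hBd _).const_mul C)
  · intro u hu
    have h1 := hode (Y*u) (mul_ne_zero hY hu.1.ne')
    have h2 := hB u hu
    have h3 := (abs_le.mp (hg (Y*u))).2
    nlinarith [mul_le_mul_of_nonneg_left h2 hC]
  · have h1 := gs_lim0 b Y (D * (1 + |Y|)) hb hY φ (by
      intro u hu
      refine (hgrow _).trans ?_
      have : |Y * u| ≤ |Y| := by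
        rw [abs_mul, abs_of_pos hu.1]
        nlinarith [abs_nonneg Y, hu.2]
      nlinarith)
    have h2 : Tendsto (fun u : ℝ => u^b * (C * B (Y*u))) (𝓝[>] 0) (𝓝 0) := by
      have h2 : ContinuousAt (fun u : ℝ => u^b) 0 :=
        Real.continuousAt_rpow_const _ _ (Or.inr (by linarith))
      have h3 : ContinuousAt (fun u : ℝ => C * B (Y*u)) 0 := by fun_prop
      have := (h2.mul h3).tendsto
      simp only [Pi.mul_apply] at this
      rw [Real.zero_rpow (by linarith), zero_mul] at this
      exact this.mono_left nhdsWithin_le_nhds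
    have := h1.sub h2
    rw [sub_zero] at this
    refine this.congr (fun s => ?_)
    ring

lemma gs_barR (b C D Y γ : ℝ) (hC : 0 ≤ C) (hY : 0 < Y) (φ φ' g : ℝ → ℝ)
    (hd : ∀ t, t ≠ 0 → HasDerivAt φ (φ' t) t)
    (hode : ∀ t, t ≠ 0 → t * φ' t + (b - t) * φ t = g t)
    (hg : ∀ t, |g t| ≤ C)
    (hgrow : ∀ t, |t * φ t| ≤ D * (1 + |t|))
    (hB : ∀ s, Y < s → (b - 1 - γ) * s + (b - 2) * γ ≤ 0) :
    φ Y ≤ C * (1/Y + γ/Y^2) := by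
  have key := gs_cmpR b Y hY (fun t => φ t - C * (t⁻¹ + γ * (t⁻¹)^2))
    (fun t => φ' t - C * (-(t^2)⁻¹ + γ * (2 * t⁻¹ * (-(t^2)⁻¹)))) ?_ ?_ ?_
  · have : 1/Y + γ/Y^2 = Y⁻¹ + γ * (Y⁻¹)^2 := by field_simp
    rw [this]; linarith
  · intro s hs
    have hs0 : s ≠ 0 := (lt_of_lt_of_le hY hs).ne'
    have h1 := hasDerivAt_inv hs0
    have h2 := (h1.pow 2).const_mul γ
    refine (hd s hs0).sub ((h1.add ?_).const_mul C)
    refine h2.congr_deriv ?_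
    norm_num
  · intro s hs
    have hs0 : 0 < s := hY.trans hs
    have h1 := hode s hs0.ne'
    have h3 := (abs_le.mp (hg s)).1
    have h4 := hB s hs
    have h5 : s * (-(s^2)⁻¹ + γ * (2 * s⁻¹ * (-(s^2)⁻¹))) + (b - s) * (s⁻¹ + γ * (s⁻¹)^2)
        = -1 + ((b - 1 - γ) * s + (b - 2) * γ) / s^2 := by
      field_simp; ring
    have h6 : ((b - 1 - γ) * s + (b - 2) * γ) / s^2 ≤ 0 :=
      div_nonpos_of_nonpos_of_nonneg h4 (by positivity)
    nlinarith [mul_nonneg hC (sub_nonneg.mpr h6)]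
  · have h1 := gs_limInf b D φ (by
      intro s hs
      have := hgrow s
      rwa [abs_of_pos (by linarith : (0:ℝ) < s)] at this)
    have h2 := gs_limInf b (|C| * (1 + |γ|)) (fun t => C * (t⁻¹ + γ * (t⁻¹)^2)) (by
      intro s hs
      have hs0 : 0 < s := by linarith
      have : s * (C * (s⁻¹ + γ * (s⁻¹)^2)) = C * (1 + γ * s⁻¹) := by field_simp
      rw [this, abs_mul, mul_assoc]
      apply mul_le_mul_of_nonneg_left _ (abs_nonneg C)
      have h7 : s⁻¹ ≤ 1 := inv_le_one_of_one_le₀ hs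
      have h8 : 0 < s⁻¹ := by positivity
      calc |1 + γ * s⁻¹| ≤ |1| + |γ * s⁻¹| := abs_add_le _ _
        _ = 1 + |γ| * s⁻¹ := by rw [abs_mul, abs_of_pos h8, abs_one]
        _ ≤ (1 + |γ|) * (1 + s) := by nlinarith [abs_nonneg γ])
    have := h1.sub h2
    rw [sub_zero] at this
    refine this.congr (fun s => ?_)
    ring

lemma gs_barrier (a C D : ℝ) (ha : 0 < a) (hC : 0 ≤ C) (φ φ' g : ℝ → ℝ)
    (hd : ∀ t, t ≠ 0 → HasDerivAt φ (φ' t) t)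
    (hode : ∀ t, t ≠ 0 → t * φ' t + (a + 1 - t) * φ t = g t)
    (hg : ∀ t, |g t| ≤ C)
    (hgrow : ∀ t, |t * φ t| ≤ D * (1 + |t|)) :
    ∀ t, t ≠ 0 → φ t ≤ C * max 1 (1/a) := by
  intro t ht
  have hM1 : 1 ≤ max 1 (1/a) := le_max_left _ _
  have hMa : 1/a ≤ max 1 (1/a) := le_max_right _ _
  have hconst : t ≤ a → φ t ≤ C * max 1 (1/a) := by
    intro hta
    have := gs_barL (a+1) C D t (by linarith) hC ht φ φ' g (fun _ => 1) (fun _ => 0) hd hode hg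
      hgrow (fun t => hasDerivAt_const _ _) (by
        intro u hu
        have : t * u ≤ a := by
          rcases le_or_gt t 0 with h | h
          · nlinarith [hu.1]
          · nlinarith [hu.2]
        linarith)
    nlinarith
  by_cases hta : t ≤ a
  · exact hconst hta
  push Not at hta
  have ht0 : 0 < t := ha.trans hta
  have hquad : ∀ T M : ℝ, ∀ B B' : ℝ → ℝ, B = (fun t => M * (1 + (-0.62*(T-t) + 0.162*(T-t)^2)/T)) →
      B' = (fun t => M * (0.62 - 0.324 * (T-t))/T) → ∀ t, HasDerivAt B (B' t) t := by
    rintro T M B B' rfl rfl t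
    have h1 : HasDerivAt (fun t : ℝ => T - t) (-1) t := (hasDerivAt_id t).const_sub T
    have h2 := ((((h1.const_mul (-0.62)).add ((h1.pow 2).const_mul 0.162)).div_const T).const_add
      1).const_mul M
    refine h2.congr_deriv ?_
    norm_num; ring
  rcases le_or_gt 1 a with h1 | h1
  · have hM : max 1 (1/a) = 1 := by
      apply max_eq_left; rw [div_le_one ha]; exact h1
    rw [hM]
    rcases le_or_gt t (a + 0.62) with h2 | h2
    · have key := gs_barL (a+1) C D t (by linarith) hC ht φ φ' g _ _ hd hode hg hgrow
        (hquad (a+0.62) 1 _ _ rfl rfl) (by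
          intro u hu
          have hs1 : t * u ≤ a + 0.62 := by nlinarith [hu.2]
          have hs0 : 0 < t * u := mul_pos ht0 hu.1
          generalize t * u = s at *
          have hT : 0 < a + 0.62 := by linarith
          obtain ⟨σ, rfl⟩ : ∃ σ, s = a + 0.62 - σ := ⟨a + 0.62 - s, by ring⟩
          have hσ : 0 ≤ σ := by linarith
          have e : (a + 0.62 - σ) * (1 * (0.62 - 0.324 * (a + 0.62 - (a + 0.62 - σ))) / (a + 0.62))
              + (a + 1 - (a + 0.62 - σ)) * (1 * (1 + (-0.62*(a + 0.62-(a + 0.62 - σ))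
                + 0.162*(a + 0.62-(a + 0.62 - σ))^2)/(a + 0.62))) - 1
              = σ * ((a+0.62) * 0.676 - 0.8556 - 0.23444 * σ + 0.162 * σ^2) / (a + 0.62) := by
            field_simp; ring
          have : 0 ≤ σ * ((a+0.62) * 0.676 - 0.8556 - 0.23444 * σ + 0.162 * σ^2) / (a + 0.62) := by
            apply div_nonneg _ hT.le
            apply mul_nonneg hσ
            nlinarith [sq_nonneg (σ - 0.7236)]
          linarith)
      refine key.trans ?_
      apply mul_le_mul_of_nonneg_left _ hC
      have : (-0.62*(a + 0.62-t) + 0.162*(a + 0.62-t)^2)/(a + 0.62) ≤ 0 := by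
        apply div_nonpos_of_nonpos_of_nonneg _ (by linarith)
        nlinarith
      linarith
    · have key := gs_barR (a+1) C D t (a * (a+0.62)/1.62) hC ht0 φ φ' g hd hode hg hgrow (by
          intro s hs
          have hs' : a + 0.62 < s := h2.trans hs
          have : 0 ≤ (a * (a + 0.62)/1.62 - a) * (s - (a + 0.62)) := by
            apply mul_nonneg _ (by linarith)
            have e : a * (a + 0.62)/1.62 - a = a * (a - 1) / 1.62 := by ring
            rw [e]
            apply div_nonneg _ (by norm_num)
            exact mul_nonneg ha.le (by linarith)
          have h3 : (a * (a + 0.62)/1.62 - a) * (a + 0.62) = (a - 1) * (a * (a + 0.62)/1.62) := by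
            ring
          nlinarith)
      refine key.trans ?_
      apply mul_le_mul_of_nonneg_left _ hC
      have e : 1/t + a * (a+0.62)/1.62/t^2 = (t + a * (a+0.62)/1.62)/t^2 := by field_simp
      rw [e, div_le_one (by positivity)]
      have q1 : 0 ≤ (t - (a + 0.62)) * (t + (a + 0.62) - 1) := 
        mul_nonneg (by linarith) (by linarith)
      have q2 : 0 ≤ (a + 0.62) * (a - 0.38 - a / 1.62) := by
        apply mul_nonneg (by linarith)
        have : a - 0.38 - a / 1.62 = (0.62 * a - 0.6156) / 1.62 := by ring
        rw [this]
        apply div_nonneg _ (by norm_num)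
        linarith
      have q3 : a * (a + 0.62) / 1.62 = (a + 0.62) * (a / 1.62) := by ring
      rw [q3]
      nlinarith
  · have hM : max 1 (1/a) = 1/a := by
      apply max_eq_right; rw [le_div_iff₀ ha]; linarith
    rcases le_or_gt t 1.62 with h2 | h2
    · have key := gs_barL (a+1) C D t (by linarith) hC ht φ φ' g _ _ hd hode hg hgrow
        (hquad 1.62 (1/a) _ _ rfl rfl) (by
          intro u hu
          have hs1 : t * u ≤ 1.62 := by nlinarith [hu.2]
          have hs0 : 0 < t * u := mul_pos ht0 hu.1
          generalize t * u = s at *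
          obtain ⟨σ, rfl⟩ : ∃ σ, s = 1.62 - σ := ⟨1.62 - s, by ring⟩
          have hσ : 0 ≤ σ := by linarith
          have e : (1.62 - σ) * ((1/a) * (0.62 - 0.324 * (1.62 - (1.62 - σ))) / 1.62)
              + (a + 1 - (1.62 - σ)) * ((1/a) * (1 + (-0.62*(1.62-(1.62 - σ))
                + 0.162*(1.62-(1.62 - σ))^2)/1.62)) - 1
              = σ * (1.62 * 0.676 - 0.62 * (a + 0.38) + (0.162 * (a + 1.38) - 0.62) * σ
                + 0.162 * σ^2) / (1.62 * a) := by
            field_simp; ring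
          have : 0 ≤ σ * (1.62 * 0.676 - 0.62 * (a + 0.38) + (0.162 * (a + 1.38) - 0.62) * σ
                + 0.162 * σ^2) / (1.62 * a) := by
            apply div_nonneg _ (by positivity)
            apply mul_nonneg hσ
            nlinarith [sq_nonneg (σ - 0.7236), sq_nonneg (σ - 1.2), mul_nonneg hσ ha.le]
          linarith)
      refine key.trans ?_
      rw [hM]
      apply mul_le_mul_of_nonneg_left _ hC
      have : (-0.62*(1.62-t) + 0.162*(1.62-t)^2)/1.62 ≤ 0 := by
        apply div_nonpos_of_nonpos_of_nonneg _ (by norm_num)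
        nlinarith
      have ha' : 0 < 1/a := by positivity
      nlinarith
    · have key := gs_barR (a+1) C D t 1 hC ht0 φ φ' g hd hode hg hgrow (by
          intro s hs
          nlinarith)
      refine key.trans ?_
      apply mul_le_mul_of_nonneg_left _ hC
      refine le_trans ?_ hM1
      have e : 1/t + 1/t^2 = (t + 1)/t^2 := by field_simp
      rw [e, div_le_one (by positivity)]
      nlinarith

lemma gs_barrier_abs (a C D : ℝ) (ha : 0 < a) (hC : 0 ≤ C) (φ φ' g : ℝ → ℝ)
    (hd : ∀ t, t ≠ 0 → HasDerivAt φ (φ' t) t)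
    (hode : ∀ t, t ≠ 0 → t * φ' t + (a + 1 - t) * φ t = g t)
    (hg : ∀ t, |g t| ≤ C)
    (hgrow : ∀ t, |t * φ t| ≤ D * (1 + |t|)) :
    ∀ t, t ≠ 0 → |φ t| ≤ C * max 1 (1/a) := by
  intro t ht
  rw [abs_le]
  refine ⟨?_, gs_barrier a C D ha hC φ φ' g hd hode hg hgrow t ht⟩
  have := gs_barrier a C D ha hC (fun t => - φ t) (fun t => - φ' t) (fun t => - g t)
    (fun t ht => (hd t ht).neg) (fun t ht => by rw [← hode t ht]; ring)
    (fun t => by rw [abs_neg]; exact hg t)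
    (fun t => by rw [mul_neg, abs_neg]; exact hgrow t) t ht
  linarith

lemma gs_int (a : ℝ) (ha : 0 < a) (k : ℝ → ℝ) (hk : Continuous k) (c d : ℝ) :
    IntervalIntegrable (fun u : ℝ => u^(a-1) * k u) volume c d :=
  (intervalIntegral.intervalIntegrable_rpow' (by linarith)).mul_continuousOn hk.continuousOn

lemma gs_bdd (k : ℝ → ℝ → ℝ) (hk : Continuous (Function.uncurry k)) (t₀ : ℝ) :
    ∃ C, ∀ t ∈ Icc (t₀ - 1) (t₀ + 1), ∀ u ∈ Icc (0:ℝ) 1, |k t u| ≤ C := by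
  obtain ⟨C, hC⟩ := (isCompact_Icc.prod isCompact_Icc :
    IsCompact (Icc (t₀ - 1) (t₀ + 1) ×ˢ Icc (0:ℝ) 1)).exists_bound_of_continuousOn hk.continuousOn
  exact ⟨C, fun t ht u hu => hC (t, u) ⟨ht, hu⟩⟩

lemma gs_cont (a : ℝ) (ha : 0 < a) (k : ℝ → ℝ → ℝ) (hk : Continuous (Function.uncurry k)) :
    Continuous (fun t => ∫ u in (0:ℝ)..1, u^(a-1) * k t u) := by
  rw [continuous_iff_continuousAt]
  intro t₀
  obtain ⟨C, hC⟩ := gs_bdd k hk t₀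
  have hku : ∀ t, Continuous (k t) := fun t => by
    exact hk.comp (by fun_prop : Continuous fun u : ℝ => (t, u))
  refine intervalIntegral.continuousAt_of_dominated_interval (bound := fun u => u^(a-1) * C) ?_ ?_ ?_ ?_
  · refine Eventually.of_forall fun t => ?_
    have := gs_int a ha (k t) (hku t) 0 1
    exact (intervalIntegrable_iff.mp this).aestronglyMeasurable
  · filter_upwards [Icc_mem_nhds (show t₀ - 1 < t₀ by linarith) (show t₀ < t₀ + 1 by linarith)]
      with t ht
    refine Eventually.of_forall fun u hu => ?_
    rw [uIoc_of_le zero_le_one] at hu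
    have h1 : 0 ≤ u^(a-1) := Real.rpow_nonneg hu.1.le _
    rw [norm_mul, Real.norm_eq_abs, Real.norm_eq_abs, abs_of_nonneg h1]
    exact mul_le_mul_of_nonneg_left (hC t ht u ⟨hu.1.le, hu.2⟩) h1
  · exact gs_int a ha (fun _ => C) continuous_const 0 1
  · refine Eventually.of_forall fun u hu => ?_
    have : Continuous fun t => k t u := hk.comp (by fun_prop : Continuous fun t : ℝ => (t, u))
    exact (continuous_const.mul this).continuousAt

lemma gs_deriv (a : ℝ) (ha : 0 < a) (k k' : ℝ → ℝ → ℝ) (hk : Continuous (Function.uncurry k))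
    (hk' : Continuous (Function.uncurry k'))
    (hd : ∀ t u, HasDerivAt (fun t => k t u) (k' t u) t) (t₀ : ℝ) :
    HasDerivAt (fun t => ∫ u in (0:ℝ)..1, u^(a-1) * k t u)
      (∫ u in (0:ℝ)..1, u^(a-1) * k' t₀ u) t₀ := by
  obtain ⟨C, hC⟩ := gs_bdd k' hk' t₀
  have hku : ∀ t, Continuous (k t) := fun t => by
    exact hk.comp (by fun_prop : Continuous fun u : ℝ => (t, u))
  have hku' : ∀ t, Continuous (k' t) := fun t => by
    exact hk'.comp (by fun_prop : Continuous fun u : ℝ => (t, u))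
  refine (intervalIntegral.hasDerivAt_integral_of_dominated_loc_of_deriv_le
    (bound := fun u => u^(a-1) * C) (F := fun t u => u^(a-1) * k t u)
    (F' := fun t u => u^(a-1) * k' t u)
    (Icc_mem_nhds (show t₀ - 1 < t₀ by linarith) (show t₀ < t₀ + 1 by linarith)) ?_ ?_ ?_ ?_ ?_ ?_).2
  · refine Eventually.of_forall fun t => ?_
    exact (intervalIntegrable_iff.mp (gs_int a ha (k t) (hku t) 0 1)).aestronglyMeasurable
  · exact gs_int a ha (k t₀) (hku t₀) 0 1
  · exact (intervalIntegrable_iff.mp (gs_int a ha (k' t₀) (hku' t₀) 0 1)).aestronglyMeasurable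
  · refine Eventually.of_forall fun u hu t ht => ?_
    rw [uIoc_of_le zero_le_one] at hu
    have h1 : 0 ≤ u^(a-1) := Real.rpow_nonneg hu.1.le _
    rw [norm_mul, Real.norm_eq_abs, Real.norm_eq_abs, abs_of_nonneg h1]
    exact mul_le_mul_of_nonneg_left (hC t ht u ⟨hu.1.le, hu.2⟩) h1
  · exact gs_int a ha (fun _ => C) continuous_const 0 1
  · refine Eventually.of_forall fun u hu t ht => ?_
    exact (hd t u).const_mul _

lemma gs_exists (a : ℝ) (ha : 0 < a) (g g' : ℝ → ℝ) (hg : ∀ t, HasDerivAt g (g' t) t)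
    (hg' : Continuous g') : ∃ f f' : ℝ → ℝ, (∀ t, HasDerivAt f (f' t) t) ∧ Continuous f' ∧
      (∀ t, t * f' t + (a - t) * f t = g t) ∧
      (∀ t, 0 < t → t^a * rexp (-t) * f t = ∫ s in (0:ℝ)..t, s^(a-1) * (rexp (-s) * g s)) := by
  have hgc : Continuous g := continuous_iff_continuousAt.mpr fun t => (hg t).continuousAt
  set k : ℝ → ℝ → ℝ := fun t u => rexp (t*(1-u)) * g (t*u) with hk
  set k' : ℝ → ℝ → ℝ := fun t u => rexp (t*(1-u)) * ((1-u) * g (t*u) + u * g' (t*u)) with hk'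
  have hkc : Continuous (Function.uncurry k) := by
    simp only [hk, Function.uncurry_def]; fun_prop
  have hkc' : Continuous (Function.uncurry k') := by
    simp only [hk', Function.uncurry_def]; fun_prop
  have hkd : ∀ t u, HasDerivAt (fun t => k t u) (k' t u) t := by
    intro t u
    have h2 : HasDerivAt (fun t : ℝ => rexp (t*(1-u))) (rexp (t*(1-u)) * (1-u)) t := by
      have : HasDerivAt (fun t : ℝ => t*(1-u)) (1-u) t := by
        simpa using (hasDerivAt_id t).mul_const (1-u)
      exact this.exp
    have h3 : HasDerivAt (fun t : ℝ => g (t*u)) (g' (t*u) * u) t := by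
      have : HasDerivAt (fun t : ℝ => t*u) u t := by
        simpa using (hasDerivAt_id t).mul_const u
      exact (hg _).comp t this
    refine (h2.mul h3).congr_deriv ?_
    simp only [hk']; ring
  have hku : ∀ t, Continuous (k t) := fun t => by
    exact hkc.comp (by fun_prop : Continuous fun u : ℝ => (t, u))
  have hku' : ∀ t, Continuous (k' t) := fun t => by
    exact hkc'.comp (by fun_prop : Continuous fun u : ℝ => (t, u))
  refine ⟨fun t => ∫ u in (0:ℝ)..1, u^(a-1) * k t u, fun t => ∫ u in (0:ℝ)..1, u^(a-1) * k' t u,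
    gs_deriv a ha k k' hkc hkc' hkd, gs_cont a ha k' hkc', ?_, ?_⟩
  · intro t
    have hI1 := gs_int a ha (k t) (hku t) 0 1
    have hI2 := gs_int a ha (k' t) (hku' t) 0 1
    have ftc := intervalIntegral.integral_eq_sub_of_hasDerivAt_of_le (a := (0:ℝ)) (b := 1)
      (f := fun u => u^a * k t u)
      (f' := fun u => t * (u^(a-1) * k' t u) + (a - t) * (u^(a-1) * k t u)) zero_le_one ?_ ?_ ?_
    · rw [intervalIntegral.integral_add (hI2.const_mul t) (hI1.const_mul (a-t)),
        intervalIntegral.integral_const_mul, intervalIntegral.integral_const_mul] at ftc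
      rw [ftc]
      simp [hk, Real.zero_rpow ha.ne']
    · apply Continuous.continuousOn
      exact (Real.continuous_rpow_const ha.le).mul (hku t)
    · intro u hu
      have h1 : HasDerivAt (fun u : ℝ => u^a) (a * u^(a-1)) u :=
        Real.hasDerivAt_rpow_const (Or.inl hu.1.ne')
      have h2 : HasDerivAt (fun u : ℝ => rexp (t*(1-u))) (rexp (t*(1-u)) * (-t)) u := by
        have : HasDerivAt (fun u : ℝ => t*(1-u)) (-t) u := by
          simpa using ((hasDerivAt_id u).const_sub 1).const_mul t
        exact this.exp
      have h3 : HasDerivAt (fun u : ℝ => g (t*u)) (g' (t*u) * t) u := by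
        have : HasDerivAt (fun u : ℝ => t*u) t u := by
          simpa using (hasDerivAt_id u).const_mul t
        exact (hg _).comp u this
      have h4 := h1.mul (h2.mul h3)
      refine h4.congr_deriv ?_
      have : u^a = u^(a-1) * u := by
        rw [← Real.rpow_add_one hu.1.ne']; ring_nf
      simp only [Pi.mul_apply, hk, hk']
      rw [this]; ring
    · exact (hI2.const_mul t).add (hI1.const_mul (a-t))
  · intro t ht
    have h1 := intervalIntegral.integral_comp_mul_left (a := 0) (b := 1)
      (fun s : ℝ => s^(a-1) * (rexp (-s) * g s)) ht.ne'
    rw [mul_zero, mul_one, smul_eq_mul] at h1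
    have h2 : ∫ s in (0:ℝ)..t, s^(a-1) * (rexp (-s) * g s) =
        t * ∫ u in (0:ℝ)..1, (t*u)^(a-1) * (rexp (-(t*u)) * g (t*u)) := by
      rw [h1]; field_simp
    rw [h2, ← intervalIntegral.integral_const_mul, ← intervalIntegral.integral_const_mul]
    apply intervalIntegral.integral_congr
    intro u hu
    rw [uIcc_of_le zero_le_one] at hu
    simp only [hk]
    rw [Real.mul_rpow ht.le hu.1]
    have e1 : t^a = t^(a-1) * t := by
      rw [← Real.rpow_add_one ht.ne']; ring_nf
    have e2 : rexp (-(t*u)) = rexp (-t) * rexp (t*(1-u)) := by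
      rw [← Real.exp_add]; ring_nf
    rw [e1, e2]; ring

lemma gs_gamma (a K : ℝ) (ha : 0 < a) (q : ℝ → ℝ) (hq : Continuous q)
    (hK : ∀ x, |q x| ≤ K * (1 + |x|)) :
    IntegrableOn (fun s : ℝ => s^(a-1) * (rexp (-s) * q s)) (Ioi 0) ∧
    ∫ s in Ioi (0:ℝ), s^(a-1) * (rexp (-s) * q s) = Real.Gamma a * ∫ x, q x ∂(gammaMeasure a 1) := by
  constructor
  · have h1 := Real.GammaIntegral_convergent ha
    have h2 := Real.GammaIntegral_convergent (show 0 < a + 1 by linarith)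
    refine ((h1.add h2).const_mul K).mono' ?_ ?_
    · apply AEStronglyMeasurable.mul
      · exact (measurable_id.pow_const _).aestronglyMeasurable
      · exact (by fun_prop : Continuous fun s : ℝ => rexp (-s) * q s).aestronglyMeasurable
    · rw [ae_restrict_iff' measurableSet_Ioi]
      refine Eventually.of_forall fun s hs => ?_
      have hs : 0 < s := hs
      have h3 : 0 ≤ s^(a-1) * rexp (-s) := by positivity
      rw [← mul_assoc, norm_mul, Real.norm_eq_abs, Real.norm_eq_abs, abs_of_nonneg h3]
      have e1 : s^(a+1-1) = s^(a-1) * s := by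
        rw [← Real.rpow_add_one hs.ne']; ring_nf
      have := mul_le_mul_of_nonneg_left (hK s) h3
      rw [abs_of_pos hs] at this
      simp only [Pi.add_apply]
      rw [e1]; linarith
  · have h1 : ∫ x, q x ∂(gammaMeasure a 1) = ∫ x, gammaPDFReal a 1 x * q x := by
      unfold gammaMeasure
      rw [integral_withDensity_eq_integral_toReal_smul]
      · apply integral_congr_ae
        refine Eventually.of_forall fun x => ?_
        simp only [gammaPDF, smul_eq_mul]
        rw [ENNReal.toReal_ofReal (gammaPDFReal_nonneg ha one_pos x)]
      · exact (measurable_gammaPDFReal a 1).ennreal_ofReal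
      · exact Eventually.of_forall fun x => ENNReal.ofReal_lt_top
    have h2 : ∫ x, gammaPDFReal a 1 x * q x = ∫ x in Ici (0:ℝ), gammaPDFReal a 1 x * q x := by
      symm
      apply setIntegral_eq_integral_of_forall_compl_eq_zero
      intro x hx
      simp only [mem_Ici, not_le] at hx
      simp [gammaPDFReal, not_le.mpr hx]
    rw [h1, h2, integral_Ici_eq_integral_Ioi, ← integral_const_mul]
    apply setIntegral_congr_fun measurableSet_Ioi
    intro s hs
    have hs : 0 < s := hs
    have := (Real.Gamma_pos_of_pos ha).ne'
    simp only [gammaPDFReal, if_pos hs.le, Real.one_rpow, one_mul]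
    field_simp

lemma gs_lip_of_deriv (f f' : ℝ → ℝ) (hf : ∀ x, HasDerivAt f (f' x) x) (K : ℝ)
    (hK : ∀ x, |f' x| ≤ K) (x y : ℝ) : |f x - f y| ≤ K * |x - y| := by
  have := convex_univ.norm_image_sub_le_of_norm_hasDerivWithin_le (f := f) (f' := f') (C := K)
    (fun x _ => (hf x).hasDerivWithinAt) (fun x _ => hK x) (mem_univ y) (mem_univ x)
  simpa [Real.norm_eq_abs] using this

lemma gs_mvt (f f' : ℝ → ℝ) (hc : Continuous f) (L : ℝ)
    (hf : ∀ x, x ≠ 0 → HasDerivAt f (f' x) x) 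
    (hL : ∀ x, x ≠ 0 → |f' x| ≤ L) (x y : ℝ) : |f x - f y| ≤ L * |x - y| := by
  have base : ∀ x y : ℝ, x < y → (0 ∉ Ioo x y) → |f x - f y| ≤ L * |x - y| := by
    intro x y hxy h0
    have hne : ∀ z ∈ Ioo x y, z ≠ 0 := by
      rintro z hz rfl; exact h0 hz
    obtain ⟨c, hc1, hc2⟩ := exists_hasDerivAt_eq_slope f f' hxy hc.continuousOn
      (fun z hz => hf z (hne z hz))
    have h1 := hL c (hne c hc1)
    rw [hc2, abs_div, div_le_iff₀ (abs_pos.mpr (by linarith))] at h1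
    rwa [abs_sub_comm, abs_sub_comm x y]
  have lt : ∀ x y : ℝ, x < y → |f x - f y| ≤ L * |x - y| := by
    intro x y hxy
    by_cases h0 : (0:ℝ) ∈ Ioo x y
    · have h1 := base x 0 h0.1 (by simp)
      have h2 := base 0 y h0.2 (by simp)
      have h3 : |f x - f y| ≤ |f x - f 0| + |f 0 - f y| := abs_sub_le _ _ _
      have e1 : |x - 0| = -x := by rw [sub_zero, abs_of_neg h0.1]
      have e2 : |0 - y| = y := by rw [zero_sub, abs_neg, abs_of_pos h0.2]
      have e3 : |x - y| = y - x := by rw [abs_of_neg (by linarith)]; ring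
      rw [e1] at h1; rw [e2] at h2; rw [e3]; linarith
    · exact base x y hxy h0
  rcases lt_trichotomy x y with h | h | h
  · exact lt x y h
  · subst h; simp
  · rw [abs_sub_comm, abs_sub_comm x y]; exact lt y x h

lemma gs_stein_t (a K K2 : ℝ) (ha : 0 < a) (g g' g'' : ℝ → ℝ)
    (hg : ∀ t, HasDerivAt g (g' t) t) (hg' : ∀ t, HasDerivAt g' (g'' t) t)
    (hK : ∀ t, |g' t| ≤ K) (hK2 : ∀ t, |g'' t| ≤ K2)
    (hmean : ∫ x, g x ∂(gammaMeasure a 1) = 0) :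
    ∃ f f' : ℝ → ℝ, (∀ t, HasDerivAt f (f' t) t) ∧ (∀ t, |f t| ≤ K) ∧
      (∀ t, |f' t| ≤ 2 * K * max 1 (1/a)) ∧
      (∀ x y, |f' x - f' y| ≤ (K2 + 2 * (2 * K * max 1 (1/a))) * |x - y|) ∧
      (∀ t, t * f' t + (a - t) * f t = g t) := by
  have hK0 : 0 ≤ K := (abs_nonneg _).trans (hK 0)
  have hK20 : 0 ≤ K2 := (abs_nonneg _).trans (hK2 0)
  have hgc : Continuous g := continuous_iff_continuousAt.mpr fun t => (hg t).continuousAt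
  have hgc' : Continuous g' := continuous_iff_continuousAt.mpr fun t => (hg' t).continuousAt
  obtain ⟨f, f', hf, hf'c, hode, hrep⟩ := gs_exists a ha g g' hg hgc'
  have hglip := gs_lip_of_deriv g g' hg K hK
  have hgrow : ∀ x, |g x| ≤ (|g 0| + K) * (1 + |x|) := by
    intro x
    have h1 := hglip x 0
    rw [sub_zero] at h1
    have h2 : |g x| ≤ |g x - g 0| + |g 0| := by
      calc |g x| = |(g x - g 0) + g 0| := by ring_nf
        _ ≤ _ := abs_add_le _ _
    nlinarith [abs_nonneg x, abs_nonneg (g 0), mul_nonneg (abs_nonneg x) (abs_nonneg (g 0))]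
  obtain ⟨hgint, hintv⟩ := gs_gamma a _ ha g hgc hgrow
  rw [hmean, mul_zero] at hintv
  have hlim : Tendsto (fun s : ℝ => s^a * rexp (-s) * f s) atTop (𝓝 0) := by
    have := intervalIntegral_tendsto_integral_Ioi 0 hgint tendsto_id
    rw [hintv] at this
    refine this.congr' ?_
    filter_upwards [eventually_gt_atTop 0] with s hs
    exact (hrep s hs).symm
  have hup := gs_first a K ha f f' g hf hode (by
    intro x y hxy
    have := (le_abs_self _).trans (hglip x y)
    rwa [abs_sub_comm, abs_of_nonneg (by linarith : 0 ≤ y - x)] at this) hlim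
  have hlo := gs_first a K ha (fun t => - f t) (fun t => - f' t) (fun t => - g t)
    (fun t => (hf t).neg) (fun t => by rw [← hode t]; ring) (by
    intro x y hxy
    have := (neg_abs_le _).trans' (neg_le_neg (hglip x y))
    rw [abs_sub_comm, abs_of_nonneg (by linarith : 0 ≤ y - x)] at this
    linarith) (by
      have := hlim.neg
      rw [neg_zero] at this
      exact this.congr fun s => by ring)
  have hfK : ∀ t, |f t| ≤ K := fun t => abs_le.mpr ⟨by have := hlo t; linarith, hup t⟩
  -- second derivative
  set f2 : ℝ → ℝ := fun t => (g' t + f t - (a + 1 - t) * f' t) / t with hf2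
  have hf'd : ∀ t, t ≠ 0 → HasDerivAt f' (f2 t) t := by
    intro t ht
    have h1 : HasDerivAt (fun t => (g t - (a - t) * f t) / t)
        (((g' t - ((-1) * f t + (a - t) * f' t)) * t - (g t - (a - t) * f t) * 1) / t^2) t :=
      ((hg t).sub (((hasDerivAt_id t).const_sub a).mul (hf t))).div (hasDerivAt_id t) ht
    have h2 : f' =ᶠ[𝓝 t] (fun t => (g t - (a - t) * f t) / t) := by
      filter_upwards [isOpen_ne.mem_nhds ht] with s hs
      rw [eq_div_iff hs, ← hode s]; ring
    refine (h1.congr_of_eventuallyEq h2).congr_deriv ?_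
    rw [← hode t]; simp only [hf2]; field_simp; ring
  have hM0 : (0:ℝ) ≤ max 1 (1/a) := zero_le_one.trans (le_max_left _ _)
  have hf'b0 : ∀ t, t ≠ 0 → |f' t| ≤ 2 * K * max 1 (1/a) := by
    refine gs_barrier_abs a (2*K) (|g 0| + K + (a + 1) * K) ha (by linarith) f' f2
      (fun t => g' t + f t) hf'd ?_ ?_ ?_
    · intro t ht
      simp only [hf2]; field_simp; ring
    · intro t
      have := abs_add_le (g' t) (f t)
      linarith [hK t, hfK t]
    · intro t
      have e : t * f' t = g t - (a - t) * f t := by rw [← hode t]; ring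
      rw [e]
      have h1 : |g t - (a - t) * f t| ≤ |g t| + |a - t| * |f t| := by
        rw [← abs_mul]; exact abs_sub _ _
      have h2 : |a - t| ≤ a + |t| := by
        have := abs_sub a t
        rwa [abs_of_pos ha] at this
      have h3 : |a - t| * |f t| ≤ (a + |t|) * K :=
        mul_le_mul h2 (hfK t) (abs_nonneg _) (by positivity)
      have h4 := hgrow t
      nlinarith [abs_nonneg t, mul_nonneg (mul_nonneg ha.le hK0) (abs_nonneg t)]
  have hf'b : ∀ t, |f' t| ≤ 2 * K * max 1 (1/a) := by
    intro t
    by_cases ht : t = 0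
    · subst ht
      refine le_of_tendsto ((hf'c.abs.tendsto 0).mono_left (nhdsWithin_le_nhds (s := Ioi 0))) ?_
      filter_upwards [self_mem_nhdsWithin] with u hu using hf'b0 u (ne_of_gt hu)
    · exact hf'b0 t ht
  set P := 2 * K * max 1 (1/a) with hP
  have hP0 : 0 ≤ P := by positivity
  have hf2b : ∀ t, t ≠ 0 → |f2 t| ≤ K2 + 2 * P := by
    have key := gs_barrier_abs (a+1) (K2 + 2*P) (2*K + (a+2)*P) (by linarith) (by linarith) f2
      (fun t => (g'' t + 2 * f' t - (a + 2 - t) * f2 t) / t)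
      (fun t => g'' t + 2 * f' t) ?_ ?_ ?_ ?_
    · have : max 1 (1/(a+1)) = 1 := by
        apply max_eq_left; rw [div_le_one (by linarith)]; linarith
      rw [this, mul_one] at key
      exact key
    · intro t ht
      have h1 : HasDerivAt f2
        (((g'' t + f' t - ((-1) * f' t + (a + 1 - t) * f2 t)) * t
          - (g' t + f t - (a + 1 - t) * f' t) * 1) / t^2) t :=
        (((hg' t).add (hf t)).sub (((hasDerivAt_id t).const_sub (a+1)).mul (hf'd t ht))).div
          (hasDerivAt_id t) ht
      refine h1.congr_deriv ?_
      have e : g' t + f t - (a + 1 - t) * f' t = t * f2 t := by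
        simp only [hf2]; field_simp
      rw [e]; field_simp; ring
    · intro t ht
      field_simp; ring
    · intro t
      have h1 := abs_add_le (g'' t) (2 * f' t)
      rw [abs_mul, abs_two] at h1
      linarith [hK2 t, hf'b t]
    · intro t
      by_cases ht : t = 0
      · subst ht; simp; positivity
      have e : t * f2 t = g' t + f t - (a + 1 - t) * f' t := by
        simp only [hf2]; field_simp
      rw [e]
      have h1 : |g' t + f t - (a + 1 - t) * f' t| ≤ |g' t| + |f t| + |a + 1 - t| * |f' t| := by
        rw [← abs_mul]; exact (abs_sub _ _).trans (by linarith [abs_add_le (g' t) (f t)])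
      have h2 : |a + 1 - t| ≤ a + 1 + |t| := by
        have := abs_sub (a+1) t
        rwa [abs_of_pos (by linarith : 0 < a + 1)] at this
      have h3 : |a + 1 - t| * |f' t| ≤ (a + 1 + |t|) * P :=
        mul_le_mul h2 (hf'b t) (abs_nonneg _) (by positivity)
      nlinarith [abs_nonneg t, hK t, hfK t, mul_nonneg hK0 (abs_nonneg t),
        mul_nonneg hP0 (abs_nonneg t), mul_nonneg (mul_nonneg ha.le hP0) (abs_nonneg t)]
  exact ⟨f, f', hf, hfK, hf'b, gs_mvt f' f2 hf'c _ hf'd hf2b, hode⟩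

lemma gs_gamma_int (a K : ℝ) (ha : 0 < a) (q : ℝ → ℝ) (hq : Continuous q)
    (hK : ∀ x, |q x| ≤ K * (1 + |x|)) : Integrable q (gammaMeasure a 1) := by
  have h0 := (gs_gamma a K ha q hq hK).1
  unfold gammaMeasure
  rw [integrable_withDensity_iff_integrable_smul']
  · have h1 : IntegrableOn (fun s : ℝ => (Real.Gamma a)⁻¹ * (s^(a-1) * (rexp (-s) * q s))) (Ici 0) :=
      Iff.mpr integrableOn_Ici_iff_integrableOn_Ioi (h0.const_mul _)
    rw [← integrable_indicator_iff measurableSet_Ici] at h1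
    refine h1.congr (Eventually.of_forall fun x => ?_)
    simp only [gammaPDF, smul_eq_mul]
    rw [ENNReal.toReal_ofReal (gammaPDFReal_nonneg ha one_pos x)]
    by_cases hx : 0 ≤ x
    · rw [indicator_of_mem (by exact hx)]
      simp only [gammaPDFReal, if_pos hx, Real.one_rpow, one_mul]
      ring
    · rw [indicator_of_notMem (by exact hx)]
      simp only [gammaPDFReal, if_neg hx, zero_mul]
  · exact (measurable_gammaPDFReal a 1).ennreal_ofReal
  · exact Eventually.of_forall fun x => ENNReal.ofReal_lt_top

lemma gs_cg_int (ν K : ℝ) (hν : 0 < ν) (h : ℝ → ℝ) (hc : Continuous h)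
    (hK : ∀ x y, |h x - h y| ≤ K * |x - y|) :
    Integrable (fun t => h (2*t - ν)) (gammaMeasure (ν/2) 1) := by
  have hK0 : 0 ≤ K := by
    have := (abs_nonneg _).trans (hK 1 0)
    simpa using this
  refine gs_gamma_int (ν/2) (|h (-ν)| + 2 * K) (by linarith) _ (by fun_prop) ?_
  intro x
  have h1 := hK (2*x-ν) (-ν)
  have e : 2*x - ν - -ν = 2 * x := by ring
  rw [e, abs_mul, abs_two] at h1
  have h2 : |h (2*x-ν)| ≤ |h (2*x-ν) - h (-ν)| + |h (-ν)| := by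
    calc |h (2*x-ν)| = |(h (2*x-ν) - h (-ν)) + h (-ν)| := by ring_nf
      _ ≤ _ := abs_add_le _ _
  nlinarith [abs_nonneg x, mul_nonneg (abs_nonneg x) (abs_nonneg (h (-ν)))]

lemma gs_stein (ν K K2 : ℝ) (hν : 0 < ν) (h h' h'' : ℝ → ℝ)
    (hh : ∀ t, HasDerivAt h (h' t) t) (hh' : ∀ t, HasDerivAt h' (h'' t) t)
    (hK : ∀ t, |h' t| ≤ K) (hK2 : ∀ t, |h'' t| ≤ K2) :
    ∃ f f' : ℝ → ℝ, (∀ t, HasDerivAt f (f' t) t) ∧ (∀ t, |f t| ≤ K) ∧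
      (∀ t, |f' t| ≤ max 1 (2/ν) * K) ∧
      (∀ x y, |f' x - f' y| ≤ (max 1 (2/ν) * K + K2) * |x - y|) ∧
      (∀ x, 2 * (x + ν) * f' x - x * f x = h x - centeredGammaExp ν h) := by
  have ha : 0 < ν/2 := by linarith
  have hK0 : 0 ≤ K := (abs_nonneg _).trans (hK 0)
  have hK20 : 0 ≤ K2 := (abs_nonneg _).trans (hK2 0)
  have hM : 1/(ν/2) = 2/ν := by field_simp
  have hlin : ∀ t : ℝ, HasDerivAt (fun t : ℝ => 2 * t - ν) 2 t := by
    intro t; simpa using ((hasDerivAt_id t).const_mul 2).sub_const ν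
  have hq : ∀ t, HasDerivAt (fun t => h (2*t - ν)) (h' (2*t-ν) * 2) t := fun t =>
    (hh _).comp t (hlin t)
  have hqc : Continuous (fun t => h (2*t - ν)) :=
    continuous_iff_continuousAt.mpr fun t => (hq t).continuousAt
  have : IsProbabilityMeasure (gammaMeasure (ν/2) 1) :=
    isProbabilityMeasure_gammaMeasure ha one_pos
  have hqi : Integrable (fun t => h (2*t - ν)) (gammaMeasure (ν/2) 1) :=
    gs_cg_int ν K hν h (continuous_iff_continuousAt.mpr fun t => (hh t).continuousAt)
      (gs_lip_of_deriv h h' hh K hK)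
  set m := centeredGammaExp ν h with hm
  obtain ⟨f, f', hf, hf1, hf2, hf3, hf4⟩ := gs_stein_t (ν/2) K (2*K2) ha
    (fun t => (h (2*t-ν) - m)/2) (fun t => h' (2*t-ν)) (fun t => h'' (2*t-ν) * 2)
    (fun t => (((hq t).sub_const m).div_const 2).congr_deriv (by ring))
    (fun t => (hh' _).comp t (hlin t)) (fun t => hK _)
    (fun t => by rw [abs_mul, abs_two]; linarith [hK2 (2*t-ν)])
    (by
      rw [integral_div, integral_sub hqi (integrable_const _)]
      simp [hm, centeredGammaExp])
  rw [hM] at hf2 hf3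
  have hlin2 : ∀ x : ℝ, HasDerivAt (fun x : ℝ => (x + ν)/2) (1/2) x := fun x =>
    ((hasDerivAt_id x).add_const ν).div_const 2
  have hM0 : (0:ℝ) ≤ max 1 (2/ν) := zero_le_one.trans (le_max_left _ _)
  refine ⟨fun x => f ((x+ν)/2), fun x => f' ((x+ν)/2) * (1/2), fun x => (hf _).comp x (hlin2 x),
    fun x => hf1 _, ?_, ?_, ?_⟩
  · intro x
    have := hf2 ((x+ν)/2)
    rw [abs_mul, abs_of_pos (by norm_num : (0:ℝ) < 1/2)]
    linarith
  · intro x y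
    have := hf3 ((x+ν)/2) ((y+ν)/2)
    have e : (x+ν)/2 - (y+ν)/2 = (x - y) * (1/2) := by ring
    rw [e, abs_mul, abs_of_pos (by norm_num : (0:ℝ) < 1/2)] at this
    rw [← sub_mul, abs_mul, abs_of_pos (by norm_num : (0:ℝ) < 1/2)]
    nlinarith [abs_nonneg (x-y), mul_nonneg hK20 (abs_nonneg (x-y))]
  · intro x
    have := hf4 ((x+ν)/2)
    have e : 2 * ((x+ν)/2) - ν = x := by ring
    rw [e] at this
    linarith

lemma gs_poly_pos (n : ℕ) (c : ℝ) (r r' : ℝ → ℝ) (hr : ∀ s, HasDerivAt r (r' s) s)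
    (h0 : r 0 = 0) (hb : ∀ s, 0 < s → r' s ≤ c * s^n) (s : ℝ) (hs : 0 ≤ s) :
    r s ≤ c * s^(n+1) / (n+1) := by
  have hd : ∀ s, HasDerivAt (fun s => c * s^(n+1) / (n+1) - r s) (c * s^n - r' s) s := by
    intro s
    have := (((hasDerivAt_pow (n+1) s).const_mul c).div_const ((n:ℝ)+1)).sub (hr s)
    refine this.congr_deriv ?_
    have : (n:ℝ) + 1 ≠ 0 := by positivity
    push_cast
    field_simp
  have hm : MonotoneOn (fun s => c * s^(n+1) / (n+1) - r s) (Ici 0) := by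
    apply monotoneOn_of_deriv_nonneg (convex_Ici 0)
    · intro u hu; exact (hd u).continuousAt.continuousWithinAt
    · intro u hu; exact (hd u).differentiableAt.differentiableWithinAt
    · intro u hu; rw [interior_Ici] at hu
      rw [(hd u).deriv]; linarith [hb u hu]
  have := hm (by simp) (show s ∈ Ici 0 from hs) hs
  simp only [h0] at this
  simp at this
  linarith

lemma gs_poly (n : ℕ) (c : ℝ) (r r' : ℝ → ℝ) (hr : ∀ s, HasDerivAt r (r' s) s)
    (h0 : r 0 = 0) (hb : ∀ s, |r' s| ≤ c * |s|^n) (s : ℝ) :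
    |r s| ≤ c * |s|^(n+1) / (n+1) := by
  have hpos : ∀ r r' : ℝ → ℝ, (∀ s, HasDerivAt r (r' s) s) → r 0 = 0 →
      (∀ s, |r' s| ≤ c * |s|^n) → ∀ s, 0 ≤ s → |r s| ≤ c * s^(n+1) / (n+1) := by
    intro r r' hr h0 hb s hs
    have h1 := gs_poly_pos n c r r' hr h0 (fun s hs => by
      have := (le_abs_self _).trans (hb s); rwa [abs_of_pos hs] at this) s hs
    have h2 := gs_poly_pos n c (fun s => - r s) (fun s => - r' s) (fun s => (hr s).neg)
      (by simp [h0]) (fun s hs => by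
      have := (neg_le_abs _).trans (hb s); rwa [abs_of_pos hs] at this) s hs
    rw [abs_le]; constructor <;> linarith
  rcases le_total 0 s with hs | hs
  · rw [abs_of_nonneg hs]; exact hpos r r' hr h0 hb s hs
  · have := hpos (fun s => r (-s)) (fun s => r' (-s) * (-1)) 
      (fun s => (hr (-s)).comp s (hasDerivAt_neg s)) (by simp [h0])
      (fun s => by have := hb (-s); simpa using this) (-s) (by linarith)
    rw [abs_of_nonpos hs]
    simpa using this

lemma gs_taylor (F f f' : ℝ → ℝ) (L : ℝ) (hF : ∀ x, HasDerivAt F (f x) x)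
    (hf : ∀ x, HasDerivAt f (f' x) x) (hL : ∀ x y, |f' x - f' y| ≤ L * |x - y|) (x y : ℝ) :
    |F y - F x - f x * (y - x) - f' x * (y - x)^2 / 2| ≤ L / 6 * |y - x|^3 := by
  have hsh : ∀ s : ℝ, HasDerivAt (fun s : ℝ => x + s) 1 s := fun s =>
    (hasDerivAt_id s).const_add x
  have hf1 : ∀ s, HasDerivAt (fun s => f (x + s) - f x - f' x * s) (f' (x+s) - f' x) s := by
    intro s
    have h1 : HasDerivAt (fun s => f (x+s)) (f' (x+s) * 1) s := (hf (x+s)).comp s (hsh s)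
    refine ((h1.sub_const (f x)).sub ((hasDerivAt_id s).const_mul (f' x))).congr_deriv (by ring)
  have hF1 : ∀ s, HasDerivAt (fun s => F (x + s) - F x - f x * s - f' x * s^2/2)
      (f (x + s) - f x - f' x * s) s := by
    intro s
    have h1 : HasDerivAt (fun s => F (x+s)) (f (x+s) * 1) s := (hF (x+s)).comp s (hsh s)
    refine (((h1.sub_const (F x)).sub ((hasDerivAt_id s).const_mul (f x))).sub
      (((hasDerivAt_pow 2 s).const_mul (f' x)).div_const 2)).congr_deriv ?_
    norm_num; ring
  have b1 := gs_poly 1 L _ _ hf1 (by simp) (fun s => by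
    have := hL (x+s) x
    simpa using this)
  have b2 := gs_poly 2 (L/2) _ _ hF1 (by simp) (fun s => by
    refine (b1 s).trans (le_of_eq ?_)
    norm_num; ring) (y - x)
  have e : x + (y - x) = y := by ring
  rw [e] at b2
  refine b2.trans (le_of_eq ?_)
  norm_num; ring

lemma gs_exch {Ω : Type*} {mΩ : MeasurableSpace Ω} (μ : Measure Ω)
    (W W' : Ω → ℝ) (hW : Measurable W) (hW' : Measurable W')
    (hexch : μ.map (fun ω => (W ω, W' ω)) = μ.map (fun ω => (W' ω, W ω)))
    (F : ℝ → ℝ) (hFc : Continuous F) : ∫ ω, F (W' ω) ∂μ = ∫ ω, F (W ω) ∂μ := by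
  have h1 : ∫ p : ℝ × ℝ, F p.1 ∂(μ.map (fun ω => (W ω, W' ω)))
      = ∫ p : ℝ × ℝ, F p.1 ∂(μ.map (fun ω => (W' ω, W ω))) := by rw [hexch]
  rw [integral_map (hW.prodMk hW').aemeasurable
      (by fun_prop : Continuous fun p : ℝ × ℝ => F p.1).aestronglyMeasurable,
    integral_map (hW'.prodMk hW).aemeasurable
      (by fun_prop : Continuous fun p : ℝ × ℝ => F p.1).aestronglyMeasurable] at h1
  exact h1.symm

lemma gs_core {Ω : Type*} {mΩ : MeasurableSpace Ω} (μ : Measure Ω) [IsProbabilityMeasure μ]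
    (ν : ℝ) (hν : 0 < ν)
    (W W' : Ω → ℝ) (hW : Measurable W) (hW' : Measurable W')
    (hWL2 : MemLp W 2 μ) (hW'L2 : MemLp W' 2 μ)
    (hexch : μ.map (fun ω => (W ω, W' ω)) = μ.map (fun ω => (W' ω, W ω)))
    (𝒢 : MeasurableSpace Ω) (h𝒢 : 𝒢 ≤ mΩ)
    (hσW : MeasurableSpace.comap W inferInstance ≤ 𝒢)
    (lam : ℝ) (hlam : 0 < lam)
    (R S : Ω → ℝ)
    (hR : ∀ᵐ ω ∂μ, (1 / lam) * (μ[fun ω => W' ω - W ω|𝒢]) ω = -W ω + R ω)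
    (hS : ∀ᵐ ω ∂μ, (1 / (2 * lam)) * (μ[fun ω => (W' ω - W ω) ^ 2|𝒢]) ω
      = 2 * (W ω + ν) + S ω)
    (hcube : Integrable (fun ω => |W' ω - W ω| ^ 3) μ)
    (h h' h'' : ℝ → ℝ) (K K2 : ℝ)
    (hh : ∀ t, HasDerivAt h (h' t) t) (hh' : ∀ t, HasDerivAt h' (h'' t) t)
    (hK : ∀ t, |h' t| ≤ K) (hK2 : ∀ t, |h'' t| ≤ K2) :
    |(∫ ω, h (W ω) ∂μ) - centeredGammaExp ν h|
      ≤ K * (max 1 (2 / ν) * (∫ ω, |S ω| ∂μ) + ∫ ω, |R ω| ∂μ)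
        + ((max 1 (2 / ν) * K + K2) / (6 * lam))
            * ∫ ω, |W' ω - W ω| ^ 3 ∂μ := by
  obtain ⟨f, f', hf, hf1, hf2, hf3, hf4⟩ := gs_stein ν K K2 hν h h' h'' hh hh' hK hK2
  set m := centeredGammaExp ν h
  set M := max 1 (2/ν)
  set L := M * K + K2
  have hK0 : 0 ≤ K := (abs_nonneg _).trans (hK 0)
  have hfc : Continuous f := continuous_iff_continuousAt.mpr fun t => (hf t).continuousAt
  have hfc' : Continuous f' := by
    have : LipschitzWith L.toNNReal f' := LipschitzWith.of_dist_le' hf3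
    exact this.continuous
  have hWi : Integrable W μ := hWL2.integrable one_le_two
  have hWi' : Integrable W' μ := hW'L2.integrable one_le_two
  have hΔ : Integrable (fun ω => W' ω - W ω) μ := hWi'.sub hWi
  have hΔ2 : Integrable (fun ω => (W' ω - W ω)^2) μ := (hW'L2.sub hWL2).integrable_sq
  have hWG : Measurable[𝒢] W := measurable_iff_comap_le.mpr hσW
  have hfWG : StronglyMeasurable[𝒢] (fun ω => f (W ω)) :=
    (hfc.measurable.comp hWG).stronglyMeasurable
  have hfWG' : StronglyMeasurable[𝒢] (fun ω => f' (W ω)) :=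
    (hfc'.measurable.comp hWG).stronglyMeasurable
  -- products with bounded functions
  have hmulf : ∀ X : Ω → ℝ, Integrable X μ → Integrable (fun ω => f (W ω) * X ω) μ := by
    intro X hX
    exact hX.bdd_mul (hfWG.mono h𝒢).aestronglyMeasurable (c := K)
      (Eventually.of_forall fun ω => hf1 _)
  have hmulf' : ∀ X : Ω → ℝ, Integrable X μ → Integrable (fun ω => f' (W ω) * X ω) μ := by
    intro X hX
    exact hX.bdd_mul (hfWG'.mono h𝒢).aestronglyMeasurable (c := M * K)
      (Eventually.of_forall fun ω => hf2 _)
  have hRi : Integrable R μ := by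
    have : Integrable (fun ω => (1 / lam) * (μ[fun ω => W' ω - W ω|𝒢]) ω + W ω) μ :=
      (integrable_condExp.const_mul _).add hWi
    refine this.congr ?_
    filter_upwards [hR] with ω h1
    rw [h1]; ring
  have hSi : Integrable S μ := by
    have : Integrable (fun ω => (1 / (2*lam)) * (μ[fun ω => (W' ω - W ω)^2|𝒢]) ω
        - 2 * (W ω + ν)) μ :=
      (integrable_condExp.const_mul _).sub ((hWi.add (integrable_const ν)).const_mul 2)
    refine this.congr ?_
    filter_upwards [hS] with ω h1
    rw [h1]; ring
  -- conditioning
  have c1 : ∫ ω, f (W ω) * (W' ω - W ω) ∂μ = lam * ∫ ω, f (W ω) * (-W ω + R ω) ∂μ := by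
    have h1 := condExp_mul_of_stronglyMeasurable_left (m := 𝒢) hfWG
      (hmulf _ hΔ) hΔ
    have h2 := integral_condExp h𝒢 (μ := μ) (f := (fun ω => f (W ω)) * (fun ω => W' ω - W ω))
    rw [integral_congr_ae h1] at h2
    have h3 : ∫ ω, f (W ω) * (W' ω - W ω) ∂μ
        = ∫ ω, ((fun ω => f (W ω)) * (fun ω => W' ω - W ω)) ω ∂μ := rfl
    rw [h3, ← h2, ← integral_const_mul]
    apply integral_congr_ae
    filter_upwards [hR] with ω h4
    rw [← h4]
    simp only [Pi.mul_apply]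
    field_simp
  have c2 : ∫ ω, f' (W ω) * (W' ω - W ω)^2 ∂μ
      = 2 * lam * ∫ ω, f' (W ω) * (2 * (W ω + ν) + S ω) ∂μ := by
    have h1 := condExp_mul_of_stronglyMeasurable_left (m := 𝒢) hfWG'
      (hmulf' _ hΔ2) hΔ2
    have h2 := integral_condExp h𝒢 (μ := μ) (f := (fun ω => f' (W ω)) * (fun ω => (W' ω - W ω)^2))
    rw [integral_congr_ae h1] at h2
    have h3 : ∫ ω, f' (W ω) * (W' ω - W ω)^2 ∂μ
        = ∫ ω, ((fun ω => f' (W ω)) * (fun ω => (W' ω - W ω)^2)) ω ∂μ := rfl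
    rw [h3, ← h2, ← integral_const_mul]
    apply integral_congr_ae
    filter_upwards [hS] with ω h4
    rw [← h4]
    simp only [Pi.mul_apply]
    field_simp
  -- antiderivative
  set F : ℝ → ℝ := fun x => ∫ s in (0:ℝ)..x, f s with hFdef
  have hF : ∀ x, HasDerivAt F (f x) x := fun x =>
    intervalIntegral.integral_hasDerivAt_right (hfc.intervalIntegrable _ _)
      (hfc.stronglyMeasurableAtFilter _ _) hfc.continuousAt
  have hFc : Continuous F := continuous_iff_continuousAt.mpr fun t => (hF t).continuousAt
  have hF0 : F 0 = 0 := by simp [hFdef]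
  have hFb : ∀ x, |F x| ≤ K * |x| := by
    intro x
    have := gs_lip_of_deriv F f hF K hf1 x 0
    simpa [hF0] using this
  have hFi : ∀ X : Ω → ℝ, Integrable X μ → Integrable (fun ω => F (X ω)) μ := by
    intro X hX
    refine (hX.abs.const_mul K).mono' (hFc.comp_aestronglyMeasurable hX.aestronglyMeasurable) ?_
    exact Eventually.of_forall fun ω => hFb _
  have hFeq : ∫ ω, F (W' ω) ∂μ = ∫ ω, F (W ω) ∂μ := by
    exact gs_exch μ W W' hW hW' hexch F hFc
  -- remainder
  have hremb : |∫ ω, (F (W' ω) - F (W ω) - f (W ω) * (W' ω - W ω)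
      - (1/2) * (f' (W ω) * (W' ω - W ω)^2)) ∂μ| ≤ L / 6 * ∫ ω, |W' ω - W ω|^3 ∂μ := by
    rw [← integral_const_mul, ← Real.norm_eq_abs]
    refine norm_integral_le_of_norm_le (hcube.const_mul _) (Eventually.of_forall fun ω => ?_)
    have := gs_taylor F f f' L hF hf hf3 (W ω) (W' ω)
    rw [Real.norm_eq_abs]
    refine le_trans (le_of_eq ?_) this
    congr 1; ring
  have hI1 : Integrable (fun ω => F (W' ω) - F (W ω)) μ := (hFi _ hWi').sub (hFi _ hWi)
  have hI2 : Integrable (fun ω => F (W' ω) - F (W ω) - f (W ω) * (W' ω - W ω)) μ :=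
    hI1.sub (hmulf _ hΔ)
  have hI3 : Integrable (fun ω => (1/2) * (f' (W ω) * (W' ω - W ω)^2)) μ :=
    (hmulf' _ hΔ2).const_mul _
  rw [integral_sub hI2 hI3, integral_sub hI1 (hmulf _ hΔ),
    integral_sub (hFi _ hWi') (hFi _ hWi), hFeq, integral_const_mul, c1, c2] at hremb
  -- Stein identity
  have hA : Integrable (fun ω => f (W ω) * (-W ω + R ω)) μ := hmulf _ (hWi.neg.add hRi)
  have hB : Integrable (fun ω => f' (W ω) * (2 * (W ω + ν) + S ω)) μ :=
    hmulf' _ (((hWi.add (integrable_const ν)).const_mul 2).add hSi)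
  have hfR := hmulf R hRi
  have hfS := hmulf' S hSi
  have hid : ∀ ω, h (W ω) = f (W ω) * (-W ω + R ω) + f' (W ω) * (2 * (W ω + ν) + S ω)
      - f (W ω) * R ω - f' (W ω) * S ω + m := by
    intro ω; have := hf4 (W ω); linarith
  have hE : ∫ ω, h (W ω) ∂μ = ∫ ω, f (W ω) * (-W ω + R ω) ∂μ
      + ∫ ω, f' (W ω) * (2 * (W ω + ν) + S ω) ∂μ
      - ∫ ω, f (W ω) * R ω ∂μ - ∫ ω, f' (W ω) * S ω ∂μ + m := by
    simp_rw [hid]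
    have hJ1 : Integrable (fun ω => f (W ω) * (-W ω + R ω)
        + f' (W ω) * (2 * (W ω + ν) + S ω)) μ := hA.add hB
    have hJ2 : Integrable (fun ω => f (W ω) * (-W ω + R ω)
        + f' (W ω) * (2 * (W ω + ν) + S ω) - f (W ω) * R ω) μ := hJ1.sub hfR
    have hJ3 : Integrable (fun ω => f (W ω) * (-W ω + R ω)
        + f' (W ω) * (2 * (W ω + ν) + S ω) - f (W ω) * R ω - f' (W ω) * S ω) μ := hJ2.sub hfS
    rw [integral_add hJ3 (integrable_const _), integral_sub hJ2 hfS, integral_sub hJ1 hfR,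
      integral_add hA hB]
    simp
  have bR : |∫ ω, f (W ω) * R ω ∂μ| ≤ K * ∫ ω, |R ω| ∂μ := by
    rw [← integral_const_mul, ← Real.norm_eq_abs]
    refine norm_integral_le_of_norm_le (hRi.abs.const_mul _) (Eventually.of_forall fun ω => ?_)
    rw [norm_mul]
    exact mul_le_mul_of_nonneg_right (hf1 _) (abs_nonneg _)
  have bS : |∫ ω, f' (W ω) * S ω ∂μ| ≤ M * K * ∫ ω, |S ω| ∂μ := by
    rw [← integral_const_mul, ← Real.norm_eq_abs]
    refine norm_integral_le_of_norm_le (hSi.abs.const_mul _) (Eventually.of_forall fun ω => ?_)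
    rw [norm_mul]
    exact mul_le_mul_of_nonneg_right (hf2 _) (abs_nonneg _)
  rw [hE]
  generalize (∫ ω, f (W ω) * (-W ω + R ω) ∂μ) = A at *
  generalize (∫ ω, f' (W ω) * (2 * (W ω + ν) + S ω) ∂μ) = B at *
  generalize (∫ ω, f (W ω) * R ω ∂μ) = r at *
  generalize (∫ ω, f' (W ω) * S ω ∂μ) = s at *
  generalize (∫ ω, |W' ω - W ω|^3 ∂μ) = T at *
  have e1 : |A + B| ≤ L / (6 * lam) * T := by
    have h1 : ∫ ω, F (W ω) ∂μ - ∫ ω, F (W ω) ∂μ - lam * A - 1/2 * (2 * lam * B)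
        = -(lam * (A + B)) := by ring
    rw [h1, abs_neg, abs_mul, abs_of_pos hlam] at hremb
    have h2 : L / (6 * lam) * T = (L / 6 * T) / lam := by field_simp
    rw [h2, le_div_iff₀ hlam]; linarith
  have e2 : A + B - r - s + m - m = (A + B) - r - s := by ring
  rw [e2]
  have e3 := abs_sub (A + B - r) s
  have e4 := abs_sub (A + B) r
  linarith

lemma gs_lipConst (g : ℝ → ℝ) (hg : ∃ K : NNReal, LipschitzWith K g) (x y : ℝ) :
    |g x - g y| ≤ lipConst g * |x - y| := by
  obtain ⟨K, hK⟩ := hg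
  by_cases hxy : x = y
  · subst hxy; simp
  have hpos : 0 < |x - y| := abs_pos.mpr (sub_ne_zero.mpr hxy)
  rw [← div_le_iff₀ hpos]
  apply le_csSup
  · refine ⟨K, ?_⟩
    rintro c ⟨u, v, huv, rfl⟩
    rw [div_le_iff₀ (abs_pos.mpr (sub_ne_zero.mpr huv))]
    have := hK.dist_le_mul u v
    simpa [Real.dist_eq] using this
  · exact ⟨x, y, hxy, rfl⟩

lemma gs_lip_int {Ω : Type*} {mΩ : MeasurableSpace Ω} (μ : Measure Ω) [IsProbabilityMeasure μ]
    (W : Ω → ℝ) (hW : Integrable W μ) (q : ℝ → ℝ) (hq : Continuous q) (K : ℝ)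
    (hK : ∀ x y, |q x - q y| ≤ K * |x - y|) : Integrable (fun ω => q (W ω)) μ := by
  refine ((hW.abs.const_mul K).add (integrable_const |q 0|)).mono'
    (hq.comp_aestronglyMeasurable hW.aestronglyMeasurable) (Eventually.of_forall fun ω => ?_)
  have h1 := hK (W ω) 0
  rw [sub_zero] at h1
  have h2 : |q (W ω)| ≤ |q (W ω) - q 0| + |q 0| := by
    calc |q (W ω)| = |(q (W ω) - q 0) + q 0| := by ring_nf
      _ ≤ _ := abs_add_le _ _
  simp only [Pi.add_apply, Real.norm_eq_abs]
  linarith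

lemma gs_close {Ω : Type*} [MeasurableSpace Ω] (μ : Measure Ω) [IsProbabilityMeasure μ]
    (p q : Ω → ℝ) (hp : Integrable p μ) (hq : Integrable q μ) (d : ℝ)
    (hd : ∀ ω, |p ω - q ω| ≤ d) : |∫ ω, p ω ∂μ - ∫ ω, q ω ∂μ| ≤ d := by
  rw [← integral_sub hp hq, ← Real.norm_eq_abs]
  have := norm_integral_le_of_norm_le (integrable_const (μ := μ) d)
    (f := fun ω => p ω - q ω) (Eventually.of_forall fun ω => hd ω)
  simpa using this

lemma gs_mollify (ν : ℝ) (hν : 0 < ν) {Ω : Type*} {mΩ : MeasurableSpace Ω} (μ : Measure Ω)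
    [IsProbabilityMeasure μ] (W : Ω → ℝ) (hW : Integrable W μ)
    (h : ℝ → ℝ) (hC1 : ContDiff ℝ 1 h)
    (hLip : ∃ K : NNReal, LipschitzWith K h)
    (hLip' : ∃ K : NNReal, LipschitzWith K (deriv h)) (B : ℝ)
    (hB : ∀ g g' g'' : ℝ → ℝ, (∀ t, HasDerivAt g (g' t) t) → (∀ t, HasDerivAt g' (g'' t) t) →
      (∀ t, |g' t| ≤ lipConst h) → (∀ t, |g'' t| ≤ lipConst (deriv h)) →
      |(∫ ω, g (W ω) ∂μ) - centeredGammaExp ν g| ≤ B) :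
    |(∫ ω, h (W ω) ∂μ) - centeredGammaExp ν h| ≤ B := by
  have L1 := gs_lipConst h hLip
  have L2 := gs_lipConst (deriv h) hLip'
  set K1 := lipConst h with hK1
  have hK0 : 0 ≤ K1 := by
    have := (abs_nonneg _).trans (L1 1 0)
    simpa using this
  have hhc : Continuous h := hC1.continuous
  have hhd : ∀ x, HasDerivAt h (deriv h x) x := fun x =>
    (hC1.differentiable one_ne_zero x).hasDerivAt
  set H : ℝ → ℝ := fun x => ∫ s in (0:ℝ)..x, h s with hHdef
  have hH : ∀ x, HasDerivAt H (h x) x := fun x =>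
    intervalIntegral.integral_hasDerivAt_right (hhc.intervalIntegrable _ _)
      (hhc.stronglyMeasurableAtFilter _ _) hhc.continuousAt
  have hHc : Continuous H := continuous_iff_continuousAt.mpr fun t => (hH t).continuousAt
  have main : ∀ ε > 0, |(∫ ω, h (W ω) ∂μ) - centeredGammaExp ν h| ≤ B + 2 * (K1 * ε) := by
    intro ε hε
    have d1 : ∀ t, HasDerivAt (fun x => (H (x+ε) - H x)/ε) ((h (t+ε) - h t)/ε) t := fun t =>
      (((hH (t+ε)).comp_add_const t ε).sub (hH t)).div_const ε
    have d2 : ∀ t, HasDerivAt (fun x => (h (x+ε) - h x)/ε)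
        ((deriv h (t+ε) - deriv h t)/ε) t := fun t =>
      (((hhd (t+ε)).comp_add_const t ε).sub (hhd t)).div_const ε
    have b1 : ∀ t, |(h (t+ε) - h t)/ε| ≤ K1 := by
      intro t
      rw [abs_div, div_le_iff₀ (abs_pos.mpr hε.ne')]
      have := L1 (t+ε) t
      rwa [add_sub_cancel_left] at this
    have b2 : ∀ t, |(deriv h (t+ε) - deriv h t)/ε| ≤ lipConst (deriv h) := by
      intro t
      rw [abs_div, div_le_iff₀ (abs_pos.mpr hε.ne')]
      have := L2 (t+ε) t
      rwa [add_sub_cancel_left] at this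
    have hb := hB _ _ _ d1 d2 b1 b2
    have cl : ∀ x, |h x - (H (x+ε) - H x)/ε| ≤ K1 * ε := by
      intro x
      obtain ⟨c, hc1, hc2⟩ := exists_hasDerivAt_eq_slope H h (by linarith : x < x + ε)
        hHc.continuousOn (fun z _ => hH z)
      rw [add_sub_cancel_left] at hc2
      rw [← hc2]
      refine (L1 x c).trans (mul_le_mul_of_nonneg_left ?_ hK0)
      rw [abs_sub_comm, abs_of_nonneg (by linarith [hc1.1])]
      linarith [hc1.2]
    have gl := gs_lip_of_deriv _ _ d1 K1 b1
    have gc : Continuous (fun x => (H (x+ε) - H x)/ε) :=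
      continuous_iff_continuousAt.mpr fun t => (d1 t).continuousAt
    have : IsProbabilityMeasure (gammaMeasure (ν/2) 1) :=
      isProbabilityMeasure_gammaMeasure (by linarith) one_pos
    have q1 := gs_close μ _ _ (gs_lip_int μ W hW h hhc K1 L1) (gs_lip_int μ W hW _ gc K1 gl)
      (K1 * ε) (fun ω => cl (W ω))
    have q2 := gs_close (gammaMeasure (ν/2) 1) _ _ (gs_cg_int ν K1 hν h hhc L1)
      (gs_cg_int ν K1 hν _ gc gl) (K1 * ε) (fun t => cl (2*t-ν))
    simp only [centeredGammaExp] at hb ⊢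
    rw [abs_le] at *
    constructor <;> linarith [hb.1, hb.2, q1.1, q1.2, q2.1, q2.2]
  refine le_of_forall_pos_le_add fun δ hδ => ?_
  have hp : 0 < 2 * K1 + 1 := by linarith
  refine (main (δ / (2*K1+1)) (by positivity)).trans ?_
  have : 2 * (K1 * (δ / (2*K1+1))) ≤ δ := by
    have e : 2 * (K1 * (δ / (2*K1+1))) = 2 * K1 * δ / (2*K1+1) := by ring
    rw [e, div_le_iff₀ hp]
    nlinarith
  linarith

lemma gs_core0 {Ω : Type*} {mΩ : MeasurableSpace Ω} (μ : Measure Ω) [IsProbabilityMeasure μ]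
    (ν : ℝ) (hν : 0 < ν) (W R S : Ω → ℝ) (hWi : Integrable W μ)
    (hR : ∀ᵐ ω ∂μ, 0 = -W ω + R ω) (hS : ∀ᵐ ω ∂μ, 0 = 2 * (W ω + ν) + S ω)
    (h h' h'' : ℝ → ℝ) (K K2 : ℝ)
    (hh : ∀ t, HasDerivAt h (h' t) t) (hh' : ∀ t, HasDerivAt h' (h'' t) t)
    (hK : ∀ t, |h' t| ≤ K) (hK2 : ∀ t, |h'' t| ≤ K2) :
    |(∫ ω, h (W ω) ∂μ) - centeredGammaExp ν h|
      ≤ K * (max 1 (2 / ν) * (∫ ω, |S ω| ∂μ) + ∫ ω, |R ω| ∂μ) := by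
  obtain ⟨f, f', hf, hf1, hf2, hf3, hf4⟩ := gs_stein ν K K2 hν h h' h'' hh hh' hK hK2
  set m := centeredGammaExp ν h
  set M := max 1 (2/ν)
  have hRi : Integrable R μ := by
    refine hWi.congr ?_
    filter_upwards [hR] with ω h1
    linarith
  have hSi : Integrable S μ := by
    have : Integrable (fun ω => -(2 * (W ω + ν))) μ :=
      ((hWi.add (integrable_const ν)).const_mul 2).neg
    refine this.congr ?_
    filter_upwards [hS] with ω h1
    linarith
  have hhi : Integrable (fun ω => h (W ω)) μ :=
    gs_lip_int μ W hWi h (continuous_iff_continuousAt.mpr fun t => (hh t).continuousAt) K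
      (gs_lip_of_deriv h h' hh K hK)
  have e1 : (∫ ω, h (W ω) ∂μ) - m = ∫ ω, (h (W ω) - m) ∂μ := by
    rw [integral_sub hhi (integrable_const _)]; simp
  have hI1 : Integrable (fun ω => M * |S ω|) μ := hSi.abs.const_mul M
  have hI2 : Integrable (fun ω => |R ω|) μ := hRi.abs
  have hI3 : Integrable (fun ω => M * |S ω| + |R ω|) μ := hI1.add hI2
  rw [e1, ← integral_const_mul, ← integral_add hI1 hI2, ← integral_const_mul,
    ← Real.norm_eq_abs]
  refine norm_integral_le_of_norm_le (hI3.const_mul K) ?_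
  filter_upwards [hR, hS] with ω h1 h2
  have e2 : h (W ω) - m = -(S ω * f' (W ω)) - R ω * f (W ω) := by
    have e3 : S ω = -(2 * (W ω + ν)) := by linarith
    have e4 : R ω = W ω := by linarith
    rw [← hf4, e3, e4]; ring
  rw [e2, Real.norm_eq_abs]
  have a1 := abs_sub (-(S ω * f' (W ω))) (R ω * f (W ω))
  rw [abs_neg, abs_mul, abs_mul] at a1
  have a2 := mul_le_mul_of_nonneg_left (hf2 (W ω)) (abs_nonneg (S ω))
  have a3 := mul_le_mul_of_nonneg_left (hf1 (W ω)) (abs_nonneg (R ω))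
  linarith

end GammaStein

/-- Theorem `plugin`, first bound: let `ν > 0`, let `(W, W')` be an
exchangeable pair of square-integrable real random variables, `𝒢 ⊇ σ(W)` a sub-σ-field,
`λ > 0`, and let `R`, `S` be defined by the regression equations
`(1/λ) E[W' − W | 𝒢] = −W + R` and `(1/(2λ)) E[(W' − W)² | 𝒢] = 2(W + ν) + S`
(the integrability of `|W' − W|³` is the implicit well-definedness assumption of the bound).
Then for every `C¹` function `h` with `h` and `h'` Lipschitz,
`|E[h(W)] − E[h(Z_ν)]| ≤ ‖h'‖ (max(1, 2/ν) E|S| + E|R|)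
  + ((max(1, 2/ν) ‖h'‖ + ‖h''‖) / (6λ)) E|W' − W|³`. -/
theorem exchangeable_pair_centered_gamma_bound
    {Ω : Type*} [MeasurableSpace Ω] (μ : Measure Ω) [IsProbabilityMeasure μ]
    (ν : ℝ) (hν : 0 < ν)
    (W W' : Ω → ℝ) (hW : Measurable W) (hW' : Measurable W')
    (hWL2 : MemLp W 2 μ) (hW'L2 : MemLp W' 2 μ)
    (hexch : μ.map (fun ω => (W ω, W' ω)) = μ.map (fun ω => (W' ω, W ω)))
    (𝒢 : MeasurableSpace Ω) (h𝒢 : 𝒢 ≤ ‹MeasurableSpace Ω›)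
    (hσW : MeasurableSpace.comap W inferInstance ≤ 𝒢)
    (lam : ℝ) (hlam : 0 < lam)
    (R S : Ω → ℝ)
    (hR : ∀ᵐ ω ∂μ, (1 / lam) * (μ[fun ω => W' ω - W ω|𝒢]) ω = -W ω + R ω)
    (hS : ∀ᵐ ω ∂μ, (1 / (2 * lam)) * (μ[fun ω => (W' ω - W ω) ^ 2|𝒢]) ω
      = 2 * (W ω + ν) + S ω)
    (hcube : Integrable (fun ω => |W' ω - W ω| ^ 3) μ)
    (h : ℝ → ℝ) (hC1 : ContDiff ℝ 1 h)
    (hLip : ∃ K : NNReal, LipschitzWith K h)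
    (hLip' : ∃ K : NNReal, LipschitzWith K (deriv h)) :
    |(∫ ω, h (W ω) ∂μ) - centeredGammaExp ν h|
      ≤ lipConst h * (max 1 (2 / ν) * (∫ ω, |S ω| ∂μ) + ∫ ω, |R ω| ∂μ)
        + ((max 1 (2 / ν) * lipConst h + lipConst (deriv h)) / (6 * lam))
            * ∫ ω, |W' ω - W ω| ^ 3 ∂μ := by
  refine gs_mollify ν hν μ W (hWL2.integrable one_le_two) h hC1 hLip hLip' _ ?_
  intro g g' g'' hg hg' hK hK2
  by_cases hle : 𝒢 ≤ (by clear h𝒢 hσW hR hS; clear 𝒢; infer_instance : MeasurableSpace Ω)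
  · exact gs_core μ ν hν W W' hW hW' hWL2 hW'L2 hexch 𝒢 hle hσW lam hlam R S hR hS hcube
      g g' g'' _ _ hg hg' hK hK2
  · rw [condExp_of_not_le hle] at hR hS
    have key := gs_core0 μ ν hν W R S (hWL2.integrable one_le_two)
      (by filter_upwards [hR] with ω h1; simpa using h1)
      (by filter_upwards [hS] with ω h1; simpa using h1) g g' g'' _ _ hg hg' hK hK2
    refine key.trans (le_add_of_nonneg_right ?_)
    have k1 : 0 ≤ lipConst h := (abs_nonneg _).trans (hK 0)
    have k2 : 0 ≤ lipConst (deriv h) := (abs_nonneg _).trans (hK2 0)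
    have k3 : (0:ℝ) ≤ max 1 (2 / ν) := zero_le_one.trans (le_max_left _ _)
    have k4 : 0 ≤ ∫ ω, |W' ω - W ω| ^ 3 ∂μ := integral_nonneg fun ω => by positivity
    positivity
end

section
/- Let ν > 0, let (W, W') be an exchangeable pair of square-integrable real random variables with E[W²] = 2ν, let G be a sub-σ-field containing σ(W), let λ > 0, and suppose (1/λ)E[W'−W | G] = −W almost surely. Define S := (1/(2λ))E[(W'−W)² | G] − 2(W+ν). Then E[S] = 0 and for every continuously differentiable h : ℝ → ℝ with both h and h' Lipschitz-continuous, |E[h(W)] − E[h(Z_ν)]| ≤ max(1, 2/ν)·‖h'‖·√(Var(S)) + ((max(1, 2/ν)·‖h'‖ + ‖h''‖)/(6λ))·E|W'−W|³. -/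
open MeasureTheory ProbabilityTheory Real

section GsAux

open Filter Topology Set

lemma gsAux_mono_zero {φ φ' : ℝ → ℝ} {c : ℝ}
    (hd : ∀ s, 0 < s → s ≤ 1 → HasDerivAt φ (φ' s) s)
    (hn : ∀ s, 0 < s → s ≤ 1 → 0 ≤ φ' s)
    (ht : Tendsto φ (𝓝[>] 0) (𝓝 c)) : c ≤ φ 1 := by
  have hm : MonotoneOn φ (Ioc 0 1) := by
    refine monotoneOn_of_deriv_nonneg (convex_Ioc 0 1) ?_ ?_ ?_
    · intro s hs
      exact (hd s hs.1 hs.2).continuousAt.continuousWithinAt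
    · intro s hs
      have hs := interior_subset hs
      exact (hd s hs.1 hs.2).differentiableAt.differentiableWithinAt
    · intro s hs
      have hs := interior_subset hs
      rw [(hd s hs.1 hs.2).deriv]
      exact hn s hs.1 hs.2
  refine le_of_tendsto ht ?_
  filter_upwards [Ioc_mem_nhdsGT (zero_lt_one : (0:ℝ) < 1)] with s hs
  exact hm hs ⟨zero_lt_one, le_rfl⟩ hs.2

lemma gsAux_mono_top {φ φ' : ℝ → ℝ} {c : ℝ}
    (hd : ∀ s, 1 ≤ s → HasDerivAt φ (φ' s) s)
    (hn : ∀ s, 1 ≤ s → 0 ≤ φ' s)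
    (ht : Tendsto φ atTop (𝓝 c)) : φ 1 ≤ c := by
  have hm : MonotoneOn φ (Ici 1) := by
    refine monotoneOn_of_deriv_nonneg (convex_Ici 1) ?_ ?_ ?_
    · intro s hs
      exact (hd s hs).continuousAt.continuousWithinAt
    · intro s hs
      have hs := interior_subset hs
      exact (hd s hs).differentiableAt.differentiableWithinAt
    · intro s hs
      have hs := interior_subset hs
      rw [(hd s hs).deriv]
      exact hn s hs
  refine ge_of_tendsto ht ?_
  filter_upwards [eventually_ge_atTop (1:ℝ)] with s hs
  exact hm (mem_Ici.2 le_rfl) hs hs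

/-- `g` solves the Gamma Stein equation `y g' + (ρ - y) g = M`, with `g' = u` away from `0`. -/
structure GammaSol (ρ : ℝ) (M g u : ℝ → ℝ) : Prop where
  cont : Continuous g
  der : ∀ y, y ≠ 0 → HasDerivAt g (u y) y
  ode : ∀ y, y * u y + (ρ - y) * g y = M y
  decay : Tendsto (fun y => y ^ ρ * exp (-y) * g y) atTop (𝓝 0)

lemma gsAux_scaled_deriv {ρ : ℝ} {M g u : ℝ → ℝ}
    (der : ∀ y, y ≠ 0 → HasDerivAt g (u y) y)
    (ode : ∀ y, y ≠ 0 → y * u y + (ρ - y) * g y = M y) {y s : ℝ} (hy : y ≠ 0) (hs : 0 < s) :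
    HasDerivAt (fun s => s ^ ρ * exp (y * (1 - s)) * g (y * s))
      (s ^ (ρ - 1) * exp (y * (1 - s)) * M (y * s)) s := by
  have h1 : HasDerivAt (fun s : ℝ => s ^ ρ) (ρ * s ^ (ρ - 1)) s :=
    Real.hasDerivAt_rpow_const (Or.inl hs.ne')
  have h2 : HasDerivAt (fun s : ℝ => exp (y * (1 - s))) (exp (y * (1 - s)) * (y * (0 - 1))) s :=
    (((hasDerivAt_const s (1:ℝ)).sub (hasDerivAt_id s)).const_mul y).exp
  have hys : y * s ≠ 0 := mul_ne_zero hy hs.ne'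
  have h3 : HasDerivAt (fun s : ℝ => g (y * s)) (u (y * s) * (y * 1)) s :=
    (der _ hys).comp s ((hasDerivAt_id s).const_mul y)
  refine ((h1.mul h2).mul h3).congr_deriv ?_
  rw [← ode _ hys]
  have : s ^ ρ = s ^ (ρ - 1) * s := by
    rw [Real.rpow_sub_one hs.ne']; field_simp
  simp only [Pi.mul_apply]
  rw [this]; ring

lemma gsAux_scaled_decay {ρ : ℝ} {g : ℝ → ℝ}
    (decay : Tendsto (fun y => y ^ ρ * exp (-y) * g y) atTop (𝓝 0)) {y : ℝ} (hy : 0 < y) :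
    Tendsto (fun s => s ^ ρ * exp (y * (1 - s)) * g (y * s)) atTop (𝓝 0) := by
  have h1 : Tendsto (fun s : ℝ => y * s) atTop atTop := tendsto_id.const_mul_atTop hy
  have h2 := (decay.comp h1).const_mul (exp y / y ^ ρ)
  rw [mul_zero] at h2
  refine h2.congr' ?_
  filter_upwards [eventually_gt_atTop (0:ℝ)] with s hs
  have : exp (y * (1 - s)) = exp y * exp (-(y * s)) := by rw [← exp_add]; congr 1; ring
  simp only [Function.comp]
  rw [this, Real.mul_rpow hy.le hs.le]
  have := (Real.rpow_pos_of_pos hy ρ).ne'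
  field_simp

lemma gsAux_scaled_zero {ρ : ℝ} (hρ : 0 < ρ) {g : ℝ → ℝ} (hg : Continuous g) (y : ℝ) :
    Tendsto (fun s => s ^ ρ * exp (y * (1 - s)) * g (y * s)) (𝓝[>] 0) (𝓝 0) := by
  have h1 : Continuous (fun s : ℝ => s ^ ρ * exp (y * (1 - s)) * g (y * s)) := by
    have : Continuous (fun s : ℝ => s ^ ρ) := Real.continuous_rpow_const hρ.le
    fun_prop
  have h2 := h1.tendsto 0
  simp only [Real.zero_rpow hρ.ne', zero_mul] at h2
  exact h2.mono_left nhdsWithin_le_nhds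

lemma gsAux_nonpos {ρ : ℝ} (hρ : 0 < ρ) {M g u : ℝ → ℝ} (h : GammaSol ρ M g u)
    (hM : Monotone M) (y : ℝ) : g y ≤ 0 := by
  have key : ∀ y, y ≠ 0 → M y ≤ 0 → M 0 ≤ 0 → g y ≤ 0 := by
    intro y hy h1 h0
    have := gsAux_mono_zero (c := 0) (φ := fun s => - (s ^ ρ * exp (y * (1 - s)) * g (y * s)))
      (fun s hs _ => (gsAux_scaled_deriv h.der (fun y _ => h.ode y) hy hs).neg)
      (fun s hs hs1 => by
        have : M (y * s) ≤ 0 := by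
          rcases le_total 0 y with hy0 | hy0
          · exact (hM (by nlinarith)).trans h1
          · exact (hM (by nlinarith)).trans h0
        have := mul_nonneg (mul_nonneg (Real.rpow_nonneg hs.le (ρ - 1))
          (exp_pos (y * (1 - s))).le) (neg_nonneg.2 this)
        linarith)
      (by simpa using (gsAux_scaled_zero hρ h.cont y).neg)
    simp at this
    exact this
  have pos : ∀ y, 0 < y → g y ≤ 0 := by
    intro y hy
    rcases le_total (M y) 0 with h1 | h1
    · exact key y hy.ne' h1 ((hM hy.le).trans h1)
    · have := gsAux_mono_top (c := 0) (φ := fun s => (s ^ ρ * exp (y * (1 - s)) * g (y * s)))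
        (fun s hs => (gsAux_scaled_deriv h.der (fun y _ => h.ode y) hy.ne' (by linarith)))
        (fun s hs => by
          have : 0 ≤ M (y * s) := h1.trans (hM (by nlinarith))
          have hs0 : 0 ≤ s := by linarith
          positivity)
        (gsAux_scaled_decay h.decay hy)
      simpa using this
  have zero : g 0 ≤ 0 := by
    have : Tendsto g (𝓝[>] 0) (𝓝 (g 0)) := (h.cont.tendsto 0).mono_left nhdsWithin_le_nhds
    refine le_of_tendsto this ?_
    filter_upwards [self_mem_nhdsWithin] with s hs using pos s hs
  have hM0 : M 0 ≤ 0 := by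
    rw [← h.ode 0]; nlinarith
  rcases lt_trichotomy y 0 with hy | hy | hy
  · exact key y hy.ne ((hM hy.le).trans hM0) hM0
  · rw [hy]; exact zero
  · exact pos y hy

lemma gsAux_decay_rpow (a : ℝ) : Tendsto (fun y : ℝ => y ^ a * exp (-y)) atTop (𝓝 0) := by
  simpa using tendsto_rpow_mul_exp_neg_mul_atTop_nhds_zero a 1 one_pos

lemma gsAux_bound {ρ : ℝ} (hρ : 0 < ρ) {M g u : ℝ → ℝ} (h : GammaSol ρ M g u) {L : ℝ}
    (hM : ∀ x y, |M x - M y| ≤ L * |x - y|) (y : ℝ) : |g y| ≤ L := by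
  have h1 : GammaSol ρ (fun y => M y - L * (ρ - y)) (fun y => g y - L) u :=
    { cont := h.cont.sub continuous_const
      der := fun y hy => (h.der y hy).sub_const L
      ode := fun y => by rw [← h.ode y]; ring
      decay := by
        have := h.decay.sub ((gsAux_decay_rpow ρ).mul_const L)
        simp only [zero_mul, sub_zero] at this
        refine this.congr fun y => by ring }
  have h2 : GammaSol ρ (fun y => - M y - L * (ρ - y)) (fun y => - g y - L) (fun y => - u y) :=
    { cont := h.cont.neg.sub continuous_const
      der := fun y hy => (h.der y hy).neg.sub_const L
      ode := fun y => by rw [← h.ode y]; ring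
      decay := by
        have := h.decay.neg.sub ((gsAux_decay_rpow ρ).mul_const L)
        simp only [zero_mul, sub_zero, neg_zero] at this
        refine this.congr fun y => by ring }
  have a1 := gsAux_nonpos hρ h1 (fun a b hab => by
    have := hM a b
    rw [abs_sub_comm a b, abs_of_nonneg (sub_nonneg.2 hab)] at this
    have := (abs_le.1 this)
    linarith) y
  have a2 := gsAux_nonpos hρ h2 (fun a b hab => by
    have := hM a b
    rw [abs_sub_comm a b, abs_of_nonneg (sub_nonneg.2 hab)] at this
    have := (abs_le.1 this)
    linarith) y
  exact abs_le.2 ⟨by linarith, by linarith⟩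

/-- second derivative away from zero -/
lemma gsAux_second {ρ : ℝ} {M M' g u : ℝ → ℝ} (h : GammaSol ρ M g u)
    (hM : ∀ y, HasDerivAt M (M' y) y) (y : ℝ) (hy : y ≠ 0) :
    HasDerivAt u ((M' y + g y - (ρ + 1 - y) * u y) / y) y := by
  have h1 : HasDerivAt (fun y => (M y - (ρ - y) * g y) / y)
      (((M' y - ((0 - 1) * g y + (ρ - y) * u y)) * y - (M y - (ρ - y) * g y) * 1) / y ^ 2) y :=
    ((hM y).sub ((((hasDerivAt_const y ρ).sub (hasDerivAt_id y))).mul (h.der y hy))).div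
      (hasDerivAt_id y) hy
  have h2 : u =ᶠ[𝓝 y] (fun y => (M y - (ρ - y) * g y) / y) := by
    filter_upwards [isOpen_ne.mem_nhds hy] with x hx
    have hx : x ≠ 0 := hx
    rw [← h.ode x]; field_simp; ring
  refine (h1.congr_of_eventuallyEq h2).congr_deriv ?_
  rw [← h.ode y]; field_simp; ring

lemma gsAux_decay_next {ρ : ℝ} (hρ : 0 < ρ) {M g u : ℝ → ℝ} (h : GammaSol ρ M g u) {L : ℝ}
    (hM : ∀ x y, |M x - M y| ≤ L * |x - y|) :
    Tendsto (fun y => y ^ (ρ + 1) * exp (-y) * u y) atTop (𝓝 0) := by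
  have hg := gsAux_bound hρ h hM
  have hL : 0 ≤ L := (abs_nonneg _).trans (hg 0)
  have t1 := (gsAux_decay_rpow ρ).mul_const (|M 0| + L * ρ)
  have t2 := (gsAux_decay_rpow (ρ + 1)).mul_const (2 * L)
  have t := t1.add t2
  simp only [zero_mul, add_zero] at t
  refine squeeze_zero_norm' ?_ t
  filter_upwards [eventually_gt_atTop (0:ℝ)] with y hy
  have e : y ^ (ρ + 1) * exp (-y) * u y = y ^ ρ * exp (-y) * (M y - (ρ - y) * g y) := by
    rw [← h.ode y, Real.rpow_add_one hy.ne']; ring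
  rw [e, norm_mul, Real.norm_of_nonneg (by positivity), Real.norm_eq_abs]
  have b1 : |M y| ≤ |M 0| + L * y := by
    have := hM y 0
    rw [sub_zero, abs_of_pos hy] at this
    have := abs_sub_abs_le_abs_sub (M y) (M 0)
    linarith
  have b2 : |(ρ - y) * g y| ≤ (ρ + y) * L := by
    rw [abs_mul]
    refine mul_le_mul ?_ (hg y) (abs_nonneg _) (by positivity)
    rw [abs_le]; constructor <;> linarith
  have b3 : |M y - (ρ - y) * g y| ≤ |M 0| + L * ρ + 2 * L * y := by
    have := abs_sub (M y) ((ρ - y) * g y)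
    linarith
  calc y ^ ρ * exp (-y) * |M y - (ρ - y) * g y|
      ≤ y ^ ρ * exp (-y) * (|M 0| + L * ρ + 2 * L * y) := by gcongr
    _ = _ := by rw [Real.rpow_add_one hy.ne']; ring

lemma gsAux_kernel {ρ y s : ℝ} (hρ : 0 < ρ) (hs : 0 < s)
    (h : y * (1 - s) ≤ (ρ + 2 / 3) * (1 - s)) :
    s ^ ρ * exp (y * (1 - s)) ≤
      (1 - min 1 ρ + min 1 ρ * (s * exp (1 - s))) * exp (2 / 3 * (1 - s)) := by
  have ha0 : 0 < s * exp (1 - s) := by positivity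
  have ha1 : s * exp (1 - s) ≤ 1 := by
    have h1 : s ≤ exp (s - 1) := by have := add_one_le_exp (s - 1); linarith
    calc s * exp (1 - s) ≤ exp (s - 1) * exp (1 - s) := by gcongr
      _ = 1 := by rw [← exp_add]; simp
  have e1 : s ^ ρ * exp (y * (1 - s)) ≤ (s * exp (1 - s)) ^ ρ * exp (2 / 3 * (1 - s)) := by
    rw [Real.mul_rpow hs.le (exp_pos _).le, mul_assoc, ← Real.exp_mul, ← exp_add]
    gcongr
    linarith
  refine e1.trans ?_
  gcongr
  rcases le_total ρ 1 with h1 | h1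
  · rw [min_eq_right h1]
    have := _root_.rpow_one_add_le_one_add_mul_self (s := s * exp (1 - s) - 1) (by linarith)
      hρ.le h1
    rw [add_sub_cancel] at this
    linarith
  · rw [min_eq_left h1]
    have := Real.rpow_le_rpow_of_exponent_ge ha0 ha1 h1
    rw [Real.rpow_one] at this
    linarith

/-- Barrier function. -/
noncomputable def gsBar (q s : ℝ) : ℝ :=
  (1 - q) * (-(3 / 2) * exp (2 / 3 * (1 - s))) +
    q * (-(3 / 5 * s + 9 / 25) * exp (5 / 3 * (1 - s)))

lemma gsBar_deriv (q s : ℝ) : HasDerivAt (gsBar q)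
    ((1 - q + q * (s * exp (1 - s))) * exp (2 / 3 * (1 - s))) s := by
  have h2 : ∀ c : ℝ, HasDerivAt (fun s : ℝ => exp (c * (1 - s)))
      (exp (c * (1 - s)) * (c * (0 - 1))) s := fun c =>
    (((hasDerivAt_const s (1:ℝ)).sub (hasDerivAt_id s)).const_mul c).exp
  have h3 : HasDerivAt (fun s : ℝ => -(3 / 5 * s + 9 / 25)) (-(3 / 5 * 1)) s :=
    ((((hasDerivAt_id s).const_mul (3 / 5 : ℝ)).add_const (9 / 25 : ℝ))).neg
  have h := (((h2 (2 / 3)).const_mul (-(3 / 2) : ℝ)).const_mul (1 - q)).add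
    ((h3.mul (h2 (5 / 3))).const_mul q)
  refine h.congr_deriv ?_
  have : exp (5 / 3 * (1 - s)) = exp (1 - s) * exp (2 / 3 * (1 - s)) := by
    rw [← exp_add]; congr 1; ring
  rw [this]; ring

lemma gsBar_tendsto (q : ℝ) : Tendsto (gsBar q) atTop (𝓝 0) := by
  have h0 : ∀ c : ℝ, 0 < c → Tendsto (fun s : ℝ => exp (c * (1 - s))) atTop (𝓝 0) := by
    intro c hc
    have := (tendsto_rpow_mul_exp_neg_mul_atTop_nhds_zero 0 c hc).const_mul (exp c)
    rw [mul_zero] at this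
    refine this.congr fun s => ?_
    rw [Real.rpow_zero, one_mul, ← exp_add]; congr 1; ring
  have h1 : ∀ c : ℝ, 0 < c → Tendsto (fun s : ℝ => s * exp (c * (1 - s))) atTop (𝓝 0) := by
    intro c hc
    have := (tendsto_rpow_mul_exp_neg_mul_atTop_nhds_zero 1 c hc).const_mul (exp c)
    rw [mul_zero] at this
    refine this.congr fun s => ?_
    rw [Real.rpow_one]
    have : exp (c * (1 - s)) = exp c * exp (-c * s) := by rw [← exp_add]; congr 1; ring
    rw [this]; ring
  have := (((h0 (2 / 3) (by norm_num)).const_mul (-(3 / 2) * (1 - q))).add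
    ((h1 (5 / 3) (by norm_num)).const_mul (-(3 / 5) * q))).add
    ((h0 (5 / 3) (by norm_num)).const_mul (-(9 / 25) * q))
  simp only [mul_zero, add_zero] at this
  refine this.congr fun s => ?_
  unfold gsBar; ring

lemma gsBar_one (q : ℝ) : gsBar q 1 = -(3 / 2) * (1 - q) - 24 / 25 * q := by
  unfold gsBar; simp; ring

lemma gsBar_num {ρ : ℝ} (hρ : 0 < ρ) :
    3 / 2 * (1 - min 1 ρ) + 24 / 25 * min 1 ρ ≤ max 1 (1 / ρ) := by
  rcases le_total ρ 1 with h | h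
  · rw [min_eq_right h]
    refine le_trans ?_ (le_max_right _ _)
    rw [le_div_iff₀ hρ]
    nlinarith
  · rw [min_eq_left h]
    refine le_trans ?_ (le_max_left _ _)
    norm_num

lemma gsBar_zero {q : ℝ} (h0 : 0 ≤ q) (h1 : q ≤ 1) :
    gsBar q 1 - gsBar q 0 ≤ 3 / 2 * (1 - q) + 24 / 25 * q := by
  rw [gsBar_one]
  have e : exp 1 < 2.7182818286 := Real.exp_one_lt_d9
  have e0 : 0 < exp 1 := exp_pos 1
  have a1 : exp (2 / 3) ≤ 2 := by
    have : exp (2 / 3) ^ 3 = exp 1 ^ 2 := by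
      rw [← exp_nat_mul, ← exp_nat_mul]; norm_num
    refine le_of_pow_le_pow_left₀ (n := 3) (by norm_num) (by norm_num) ?_
    rw [this]; nlinarith
  have a2 : exp (5 / 3) ≤ 16 / 3 := by
    have : exp (5 / 3) ^ 3 = exp 1 ^ 5 := by
      rw [← exp_nat_mul, ← exp_nat_mul]; norm_num
    refine le_of_pow_le_pow_left₀ (n := 3) (by norm_num) (by norm_num) ?_
    rw [this]
    calc exp 1 ^ 5 ≤ 2.7182818286 ^ 5 := by gcongr
      _ ≤ _ := by norm_num
  unfold gsBar
  simp only [sub_zero, mul_one, mul_zero, zero_add]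
  nlinarith [mul_nonneg h0 (sub_nonneg.2 a2), mul_nonneg (sub_nonneg.2 h1) (sub_nonneg.2 a1)]

lemma gsAux_deriv_bound0 {ρ : ℝ} (hρ : 0 < ρ) {u u2 m : ℝ → ℝ} {K : ℝ} (hK : 0 ≤ K)
    (der : ∀ y, y ≠ 0 → HasDerivAt u (u2 y) y)
    (ode : ∀ y, y ≠ 0 → y * u2 y + (ρ + 1 - y) * u y = m y)
    (decay : Tendsto (fun y => y ^ (ρ + 1) * exp (-y) * u y) atTop (𝓝 0))
    (hc : Continuous (fun y => y * u y))
    (hm : ∀ y, y ≠ 0 → |m y| ≤ K) (y : ℝ) (hy : y ≠ 0) : |u y| ≤ K * max 1 (1 / ρ) := by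
  have hder : ∀ s, 0 < s → HasDerivAt (fun s => s ^ (ρ + 1) * exp (y * (1 - s)) * u (y * s))
      (s ^ ρ * exp (y * (1 - s)) * m (y * s)) s := by
    intro s hs
    have := gsAux_scaled_deriv der ode hy hs
    rwa [add_sub_cancel_right] at this
  set q := min 1 ρ with hq
  have hq0 : 0 ≤ q := le_min zero_le_one hρ.le
  have hq1 : q ≤ 1 := min_le_left _ _
  have hnum := gsBar_num hρ
  rw [← hq] at hnum
  have hb : ∀ s, 0 < s → y * (1 - s) ≤ (ρ + 2 / 3) * (1 - s) →
      |s ^ ρ * exp (y * (1 - s)) * m (y * s)| ≤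
        K * ((1 - q + q * (s * exp (1 - s))) * exp (2 / 3 * (1 - s))) := by
    intro s hs h
    rw [abs_mul, abs_of_nonneg (by positivity), mul_comm]
    exact mul_le_mul (hm _ (mul_ne_zero hy hs.ne')) (gsAux_kernel hρ hs h) (by positivity) hK
  suffices hh : |u y| ≤ K * (3 / 2 * (1 - q) + 24 / 25 * q) from
    hh.trans (mul_le_mul_of_nonneg_left hnum hK)
  rcases le_total y (ρ + 2 / 3) with h | h
  · have hz : Tendsto (fun s => s ^ (ρ + 1) * exp (y * (1 - s)) * u (y * s)) (𝓝[>] 0) (𝓝 0) := by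
      have := (gsAux_scaled_zero hρ hc y).const_mul (1 / y)
      rw [mul_zero] at this
      refine this.congr' ?_
      filter_upwards [self_mem_nhdsWithin] with s hs
      have hs : 0 < s := hs
      rw [Real.rpow_add_one hs.ne']; field_simp
    have hbz : Tendsto (fun s => K * gsBar q s) (𝓝[>] 0) (𝓝 (K * gsBar q 0)) :=
      ((gsBar_deriv q 0).continuousAt.tendsto.const_mul K).mono_left nhdsWithin_le_nhds
    have hk : ∀ s : ℝ, s ≤ 1 → y * (1 - s) ≤ (ρ + 2 / 3) * (1 - s) := fun s hs =>
      mul_le_mul_of_nonneg_right h (by linarith)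
    have i1 := gsAux_mono_zero
      (fun s hs _ => ((gsBar_deriv q s).const_mul K).sub (hder s hs))
      (fun s hs hs1 => by
        have := abs_le.1 (hb s hs (hk s hs1)); linarith) (hbz.sub hz)
    have i2 := gsAux_mono_zero
      (fun s hs _ => ((gsBar_deriv q s).const_mul K).add (hder s hs))
      (fun s hs hs1 => by
        have := abs_le.1 (hb s hs (hk s hs1)); linarith) (hbz.add hz)
    simp at i1 i2
    have := mul_le_mul_of_nonneg_left (gsBar_zero hq0 hq1) hK
    rw [abs_le]; constructor <;> nlinarith
  · have hy0 : 0 < y := by linarith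
    have hz := gsAux_scaled_decay decay hy0
    have hbz := (gsBar_tendsto q).const_mul K
    have hk : ∀ s : ℝ, 1 ≤ s → y * (1 - s) ≤ (ρ + 2 / 3) * (1 - s) := fun s hs =>
      mul_le_mul_of_nonpos_right h (by linarith)
    have i1 := gsAux_mono_top
      (fun s hs => ((gsBar_deriv q s).const_mul K).sub (hder s (by linarith)))
      (fun s hs => by
        have := abs_le.1 (hb s (by linarith) (hk s hs)); linarith) (hbz.sub hz)
    have i2 := gsAux_mono_top
      (fun s hs => ((gsBar_deriv q s).const_mul K).add (hder s (by linarith)))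
      (fun s hs => by
        have := abs_le.1 (hb s (by linarith) (hk s hs)); linarith) (hbz.add hz)
    simp [gsBar_one] at i1 i2
    rw [abs_le]; constructor <;> nlinarith

lemma gsAux_lip_of_deriv {M M' : ℝ → ℝ} {L : ℝ} (hM : ∀ y, HasDerivAt M (M' y) y)
    (hL : ∀ y, |M' y| ≤ L) (x y : ℝ) : |M x - M y| ≤ L * |x - y| := by
  have := convex_univ.norm_image_sub_le_of_norm_hasDerivWithin_le (f := M) (f' := M') (C := L)
    (fun z _ => (hM z).hasDerivWithinAt) (fun z _ => hL z) (mem_univ y) (mem_univ x)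
  simpa using this

lemma gsAux_deriv_bound {ρ : ℝ} (hρ : 0 < ρ) {M M' g u : ℝ → ℝ} (h : GammaSol ρ M g u) {L : ℝ}
    (hM : ∀ y, HasDerivAt M (M' y) y) (hlip : ∀ x y, |M x - M y| ≤ L * |x - y|)
    (hL : ∀ y, y ≠ 0 → |M' y| ≤ L)
    (y : ℝ) (hy : y ≠ 0) : |u y| ≤ 2 * L * max 1 (1 / ρ) := by
  have hg := gsAux_bound hρ h hlip
  have hL0 : 0 ≤ L := (abs_nonneg _).trans (hg 0)
  refine gsAux_deriv_bound0 hρ (u := u) (m := fun y => M' y + g y)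
    (u2 := fun y => (M' y + g y - (ρ + 1 - y) * u y) / y) (by positivity)
    (gsAux_second h hM) ?_ (gsAux_decay_next hρ h hlip) ?_ ?_ y hy
  · intro y hy; field_simp; ring
  · have : (fun y => y * u y) = fun y => M y - (ρ - y) * g y := by
      funext y; rw [← h.ode y]; ring
    rw [this]
    have := h.cont
    have hMc : Continuous M := continuous_iff_continuousAt.2 fun y => (hM y).continuousAt
    fun_prop
  · intro y hy
    have := abs_add_le (M' y) (g y)
    linarith [hL y hy, hg y]

lemma gsAux_next {ρ : ℝ} (hρ : 0 < ρ) {M M' g u : ℝ → ℝ} (h : GammaSol ρ M g u) {L : ℝ}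
    (hM : ∀ y, HasDerivAt M (M' y) y) (hlip : ∀ x y, |M x - M y| ≤ L * |x - y|)
    (h0 : HasDerivAt g (u 0) 0) (hu : Continuous u) :
    GammaSol (ρ + 1) (fun y => M' y + g y) u
      (fun y => (M' y + g y - (ρ + 1 - y) * u y) / y) := by
  refine ⟨hu, gsAux_second h hM, fun y => ?_, gsAux_decay_next hρ h hlip⟩
  rcases eq_or_ne y 0 with rfl | hy
  · have e1 : HasDerivAt (fun y => y * u y) (u 0) 0 := by
      rw [hasDerivAt_iff_tendsto_slope]
      refine ((hu.tendsto 0).mono_left nhdsWithin_le_nhds).congr' ?_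
      filter_upwards [self_mem_nhdsWithin] with s hs
      have hs : s ≠ 0 := hs
      simp [slope_def_field, hs]
    have e2 : HasDerivAt (fun y => M y - (ρ - y) * g y)
        (M' 0 - ((0 - 1) * g 0 + (ρ - 0) * u 0)) 0 :=
      (hM 0).sub ((((hasDerivAt_const 0 ρ).sub (hasDerivAt_id 0))).mul h0)
    have : (fun y => y * u y) = fun y => M y - (ρ - y) * g y := by
      funext y; rw [← h.ode y]; ring
    rw [this] at e1
    have := e1.unique e2
    simp only [zero_mul]
    linarith
  · field_simp; ring

lemma gsAux_lip_of_punctured {u u2 : ℝ → ℝ} {B : ℝ} (hu : Continuous u)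
    (hd : ∀ y, y ≠ 0 → HasDerivAt u (u2 y) y) (hB : ∀ y, y ≠ 0 → |u2 y| ≤ B) (x y : ℝ) :
    |u x - u y| ≤ B * |x - y| := by
  have key : ∀ a b : ℝ, a ≤ b → (0 ≤ a ∨ b ≤ 0) → |u b - u a| ≤ B * (b - a) := by
    intro a b hab h
    rcases hab.eq_or_lt with rfl | hab
    · simp
    · have hne : ∀ c ∈ Ioo a b, c ≠ 0 := by
        rintro c ⟨hc1, hc2⟩ rfl
        rcases h with h | h <;> linarith
      obtain ⟨c, hc, hc2⟩ := exists_hasDerivAt_eq_slope u u2 hab hu.continuousOn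
        (fun c hc => hd c (hne c hc))
      have := hB c (hne c hc)
      rw [hc2, abs_div, abs_of_pos (sub_pos.2 hab), div_le_iff₀ (sub_pos.2 hab)] at this
      exact this
  have key2 : ∀ a b : ℝ, a ≤ b → |u b - u a| ≤ B * (b - a) := by
    intro a b hab
    by_cases h : 0 ≤ a ∨ b ≤ 0
    · exact key a b hab h
    · push Not at h
      have h1 := key a 0 h.1.le (Or.inr le_rfl)
      have h2 := key 0 b h.2.le (Or.inl le_rfl)
      have := abs_sub_le (u b) (u 0) (u a)
      linarith
  rcases le_total x y with h | h
  · rw [abs_sub_comm, abs_sub_comm x y, abs_of_nonneg (sub_nonneg.2 h)]; exact key2 x y h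
  · rw [abs_of_nonneg (sub_nonneg.2 h)]; exact key2 y x h

/-- All the bounds for a solution. -/
lemma gsAux_all_bounds {ρ : ℝ} (hρ : 0 < ρ) {M M' M'' g u : ℝ → ℝ} (h : GammaSol ρ M g u)
    {L L2 : ℝ} (hM : ∀ y, HasDerivAt M (M' y) y) (hM' : ∀ y, HasDerivAt M' (M'' y) y)
    (hL : ∀ y, |M' y| ≤ L) (hL2 : ∀ y, |M'' y| ≤ L2)
    (h0 : HasDerivAt g (u 0) 0) (hu : Continuous u) :
    (∀ y, |u y| ≤ 2 * L * max 1 (1 / ρ)) ∧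
      ∀ x y, |u x - u y| ≤ 2 * (L2 + 2 * L * max 1 (1 / ρ)) * |x - y| := by
  have hlip := gsAux_lip_of_deriv hM hL
  have b1 : ∀ y, |u y| ≤ 2 * L * max 1 (1 / ρ) := by
    have hcl : Dense {y : ℝ | y ≠ 0} := dense_compl_singleton 0
    have hcl2 : IsClosed {y : ℝ | |u y| ≤ 2 * L * max 1 (1 / ρ)} :=
      isClosed_le hu.abs continuous_const
    intro y
    have hs : {y : ℝ | y ≠ 0} ⊆ {y : ℝ | |u y| ≤ 2 * L * max 1 (1 / ρ)} :=
      fun y hy => gsAux_deriv_bound hρ h hM hlip (fun y _ => hL y) y hy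
    have := closure_minimal hs hcl2
    rw [hcl.closure_eq] at this
    exact this (mem_univ y)
  refine ⟨b1, ?_⟩
  have hn := gsAux_next hρ h hM hlip h0 hu
  have hg : ∀ y, HasDerivAt g (u y) y := by
    intro y
    rcases eq_or_ne y 0 with rfl | hy
    · exact h0
    · exact h.der y hy
  have hm : ∀ y, HasDerivAt (fun y => M' y + g y) (M'' y + u y) y := fun y => (hM' y).add (hg y)
  have hmb : ∀ y, |M'' y + u y| ≤ L2 + 2 * L * max 1 (1 / ρ) := fun y =>
    (abs_add_le _ _).trans (add_le_add (hL2 y) (b1 y))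
  refine gsAux_lip_of_punctured hu hn.der fun y hy => ?_
  have := gsAux_deriv_bound (by linarith : 0 < ρ + 1) hn hm (gsAux_lip_of_deriv hm hmb)
    (fun y _ => hmb y) y hy
  have e : max 1 (1 / (ρ + 1)) = 1 := by
    refine max_eq_left ?_
    rw [div_le_one (by linarith)]; linarith
  rwa [e, mul_one] at this

lemma gsAux_exists {ρ : ℝ} (hρ : 0 < ρ) {M M' : ℝ → ℝ}
    (hM : ∀ y, HasDerivAt M (M' y) y) (hM'c : Continuous M')
    (hMint : IntegrableOn (fun t => t ^ (ρ - 1) * exp (-t) * M t) (Ioi 0))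
    (hzero : ∫ t in Ioi 0, t ^ (ρ - 1) * exp (-t) * M t = 0) :
    ∃ g u : ℝ → ℝ, GammaSol ρ M g u ∧ (∀ y, HasDerivAt g (u y) y) ∧ Continuous u := by
  have hMc : Continuous M := continuous_iff_continuousAt.2 fun y => (hM y).continuousAt
  set p : ℝ → ℝ := fun σ => σ ^ (1 / ρ) with hp
  have hpc : Continuous p := Real.continuous_rpow_const (by positivity)
  set F : ℝ → ℝ → ℝ := fun y σ => 1 / ρ * (exp (y * (1 - p σ)) * M (y * p σ)) with hF
  set F' : ℝ → ℝ → ℝ := fun y σ =>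
    1 / ρ * (exp (y * (1 - p σ)) * ((1 - p σ) * M (y * p σ) + p σ * M' (y * p σ))) with hF'
  have hFc : Continuous (Function.uncurry F) := by
    simp only [hF, Function.uncurry_def]; fun_prop
  have hF'c : Continuous (Function.uncurry F') := by
    simp only [hF', Function.uncurry_def]; fun_prop
  have hFd : ∀ y σ, HasDerivAt (fun y => F y σ) (F' y σ) y := by
    intro y σ
    have h1 : HasDerivAt (fun y => exp (y * (1 - p σ))) (exp (y * (1 - p σ)) * (1 * (1 - p σ))) y :=
      ((hasDerivAt_id y).mul_const _).exp
    have h2 : HasDerivAt (fun y => M (y * p σ)) (M' (y * p σ) * (1 * p σ)) y :=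
      (hM _).comp y ((hasDerivAt_id y).mul_const _)
    refine ((h1.mul h2).const_mul (1 / ρ)).congr_deriv ?_
    simp only [hF']; ring
  have hgd : ∀ y, HasDerivAt (fun y => ∫ σ in (0:ℝ)..1, F y σ) (∫ σ in (0:ℝ)..1, F' y σ) y := by
    intro y
    obtain ⟨C, hC⟩ := ((isCompact_closedBall y 1).prod (isCompact_Icc (a := (0:ℝ)) (b := 1))).exists_bound_of_continuousOn
      hF'c.continuousOn
    refine (intervalIntegral.hasDerivAt_integral_of_dominated_loc_of_deriv_le
      (F := F) (F' := F') (bound := fun _ => C) (Metric.closedBall_mem_nhds y one_pos)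
      (Eventually.of_forall fun x => ?_) ?_ ?_ ?_ (by simp) ?_).2
    · exact (hFc.comp (Continuous.prodMk_right x)).aestronglyMeasurable
    · exact (hFc.comp (Continuous.prodMk_right y)).intervalIntegrable _ _
    · exact (hF'c.comp (Continuous.prodMk_right y)).aestronglyMeasurable
    · refine ae_of_all _ fun σ hσ x hx => ?_
      rw [uIoc_of_le zero_le_one] at hσ
      exact hC (x, σ) ⟨hx, hσ.1.le, hσ.2⟩
    · exact ae_of_all _ fun σ _ x _ => hFd x σ
  have huc : Continuous (fun y => ∫ σ in (0:ℝ)..1, F' y σ) :=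
    intervalIntegral.continuous_parametric_intervalIntegral_of_continuous' hF'c 0 1
  have hgc : Continuous (fun y => ∫ σ in (0:ℝ)..1, F y σ) :=
    intervalIntegral.continuous_parametric_intervalIntegral_of_continuous' hFc 0 1
  have hode : ∀ y, y * (∫ σ in (0:ℝ)..1, F' y σ) + (ρ - y) * (∫ σ in (0:ℝ)..1, F y σ) = M y := by
    intro y
    have i1 : IntervalIntegrable (F y) volume 0 1 :=
      (hFc.comp (Continuous.prodMk_right y)).intervalIntegrable _ _
    have i2 : IntervalIntegrable (F' y) volume 0 1 :=
      (hF'c.comp (Continuous.prodMk_right y)).intervalIntegrable _ _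
    rw [← intervalIntegral.integral_const_mul, ← intervalIntegral.integral_const_mul,
      ← intervalIntegral.integral_add (i2.const_mul _) (i1.const_mul _)]
    have := intervalIntegral.integral_eq_sub_of_hasDerivAt_of_le (a := (0:ℝ)) (b := 1)
      (f := fun σ => σ * (exp (y * (1 - p σ)) * M (y * p σ)))
      (f' := fun σ => y * F' y σ + (ρ - y) * F y σ) zero_le_one
      (by fun_prop) (fun σ hσ => ?_) ((i2.const_mul _).add (i1.const_mul _))
    · rw [this]; simp [hp]
    · have hσ0 : 0 < σ := hσ.1
      have hpd : HasDerivAt p (1 / ρ * σ ^ (1 / ρ - 1)) σ :=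
        Real.hasDerivAt_rpow_const (Or.inl hσ0.ne')
      have hpe : 1 / ρ * σ ^ (1 / ρ - 1) = p σ / (ρ * σ) := by
        rw [Real.rpow_sub_one hσ0.ne']; simp only [hp]; field_simp
      rw [hpe] at hpd
      have h1 : HasDerivAt (fun σ => exp (y * (1 - p σ)))
          (exp (y * (1 - p σ)) * (y * (0 - p σ / (ρ * σ)))) σ :=
        (((hasDerivAt_const σ (1:ℝ)).sub hpd).const_mul y).exp
      have h2 : HasDerivAt (fun σ => M (y * p σ)) (M' (y * p σ) * (y * (p σ / (ρ * σ)))) σ :=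
        (hM _).comp σ (hpd.const_mul y)
      refine ((hasDerivAt_id σ).mul (h1.mul h2)).congr_deriv ?_
      simp only [hF, hF', Pi.mul_apply, id]
      field_simp
      ring
  refine ⟨_, _, ⟨hgc, fun y _ => hgd y, hode, ?_⟩, hgd, huc⟩
  set g := fun y => ∫ σ in (0:ℝ)..1, F y σ with hg
  have e1 : ∀ y : ℝ, 0 ≤ y → y ^ ρ * exp (-y) * g y =
      ∫ t in (0:ℝ)..y, t ^ (ρ - 1) * exp (-t) * M t := by
    intro y hy
    rw [intervalIntegral.integral_eq_sub_of_hasDerivAt_of_le (a := (0:ℝ)) (b := y)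
      (f := fun s => s ^ ρ * exp (-s) * g s) hy]
    · simp [Real.zero_rpow hρ.ne']
    · have : Continuous (fun s : ℝ => s ^ ρ) := Real.continuous_rpow_const hρ.le
      fun_prop
    · intro s hs
      have := (gsAux_scaled_deriv (ρ := ρ) (M := M) (g := g) (fun y _ => hgd y)
        (fun y _ => hode y) (one_ne_zero) hs.1).const_mul (exp (-1))
      refine (this.congr_deriv ?_).congr_of_eventuallyEq (Eventually.of_forall fun s => ?_)
      · have : exp (-s) = exp (-1) * exp (1 * (1 - s)) := by rw [← exp_add]; congr 1; ring
        rw [this, one_mul s]; ring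
      · have : exp (-s) = exp (-1) * exp (1 * (1 - s)) := by rw [← exp_add]; congr 1; ring
        simp only [one_mul s]
        rw [this]; ring
    · rw [intervalIntegrable_iff_integrableOn_Ioc_of_le hy]
      exact hMint.mono_set Ioc_subset_Ioi_self
  have e2 := intervalIntegral_tendsto_integral_Ioi 0 hMint tendsto_id
  rw [hzero] at e2
  refine e2.congr' ?_
  filter_upwards [eventually_ge_atTop (0:ℝ)] with y hy
  exact (e1 y hy).symm

lemma gsAux_gamma_zero {ρ : ℝ} (hρ : 0 < ρ) {k : ℝ → ℝ} {L : ℝ} (hkc : Continuous k)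
    (hk : ∀ x y, |k x - k y| ≤ L * |x - y|) :
    IntegrableOn (fun t => t ^ (ρ - 1) * exp (-t) * (k t - ∫ x, k x ∂(gammaMeasure ρ 1))) (Ioi 0) ∧
    ∫ t in Ioi 0, t ^ (ρ - 1) * exp (-t) * (k t - ∫ x, k x ∂(gammaMeasure ρ 1)) = 0 := by
  have i0 : IntegrableOn (fun t : ℝ => t ^ (ρ - 1) * exp (-t)) (Ioi 0) := by
    refine (Real.GammaIntegral_convergent hρ).congr_fun (fun t _ => ?_) measurableSet_Ioi
    simp only; ring
  have i1 : IntegrableOn (fun t : ℝ => t ^ ρ * exp (-t)) (Ioi 0) := by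
    refine (Real.GammaIntegral_convergent (by linarith : 0 < ρ + 1)).congr_fun
      (fun t _ => ?_) measurableSet_Ioi
    simp only [add_sub_cancel_right]; ring
  have ik : IntegrableOn (fun t : ℝ => t ^ (ρ - 1) * exp (-t) * k t) (Ioi 0) := by
    refine Integrable.mono' ((i0.const_mul |k 0|).add (i1.const_mul L)) ?_ ?_
    · exact i0.aestronglyMeasurable.mul hkc.aestronglyMeasurable
    · refine (ae_restrict_iff' measurableSet_Ioi).2 (ae_of_all _ fun t ht => ?_)
      have ht : 0 < t := ht
      rw [norm_mul, Real.norm_of_nonneg (by positivity), Real.norm_eq_abs]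
      have b : |k t| ≤ |k 0| + L * t := by
        have := hk t 0
        rw [sub_zero, abs_of_pos ht] at this
        have := abs_sub_abs_le_abs_sub (k t) (k 0)
        linarith
      have e : t ^ ρ = t ^ (ρ - 1) * t := by rw [Real.rpow_sub_one ht.ne']; field_simp
      simp only [Pi.add_apply]
      calc t ^ (ρ - 1) * exp (-t) * |k t| ≤ t ^ (ρ - 1) * exp (-t) * (|k 0| + L * t) := by gcongr
        _ = _ := by rw [e]; ring
  have hE : ∫ x, k x ∂(gammaMeasure ρ 1) = (1 / Gamma ρ) * ∫ t in Ioi 0, t ^ (ρ - 1) * exp (-t) * k t := by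
    unfold gammaMeasure
    have : (gammaPDF ρ 1) = fun x => ENNReal.ofReal (gammaPDFReal ρ 1 x) := rfl
    rw [this, integral_withDensity_eq_integral_toReal_smul (by fun_prop) (by simp)]
    rw [← integral_const_mul, ← integral_indicator measurableSet_Ioi]
    refine integral_congr_ae ?_
    have h0 : ∀ᵐ x : ℝ, x ≠ 0 := by simp [ae_iff]
    filter_upwards [h0] with x hx
    rw [ENNReal.toReal_ofReal (gammaPDFReal_nonneg hρ one_pos x)]
    rcases lt_or_gt_of_ne hx with h | h
    · rw [indicator_of_notMem (by simp [h.le])]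
      simp [gammaPDFReal, not_le.2 h]
    · rw [indicator_of_mem (by simpa using h)]
      simp [gammaPDFReal, h.le]
      ring
  set c := ∫ x, k x ∂(gammaMeasure ρ 1) with hc
  have e : (fun t : ℝ => t ^ (ρ - 1) * exp (-t) * (k t - c)) =
      fun t => t ^ (ρ - 1) * exp (-t) * k t - t ^ (ρ - 1) * exp (-t) * c := by
    funext t; ring
  rw [e]
  refine ⟨ik.sub (i0.mul_const c), ?_⟩
  rw [integral_sub ik (i0.mul_const c), integral_mul_const]
  have hG : ∫ t in Ioi (0:ℝ), t ^ (ρ - 1) * exp (-t) = Gamma ρ := by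
    rw [Real.Gamma_eq_integral hρ]
    refine integral_congr_ae (ae_of_all _ fun t => ?_)
    simp only; ring
  have := (Real.Gamma_pos_of_pos hρ).ne'
  rw [hG, hE]
  field_simp
  ring

lemma gsAux_stein {ν : ℝ} (hν : 0 < ν) {h h' h'' : ℝ → ℝ} {L1 L2 : ℝ}
    (hd : ∀ x, HasDerivAt h (h' x) x) (hd' : ∀ x, HasDerivAt h' (h'' x) x)
    (hL1 : ∀ x, |h' x| ≤ L1) (hL2 : ∀ x, |h'' x| ≤ L2) :
    ∃ f f' : ℝ → ℝ, (∀ x, HasDerivAt f (f' x) x) ∧ (∀ x, |f' x| ≤ max 1 (2 / ν) * L1) ∧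
      (∀ x y, |f' x - f' y| ≤ (max 1 (2 / ν) * L1 + L2) * |x - y|) ∧
      ∀ x, 2 * (x + ν) * f' x - x * f x = h x - centeredGammaExp ν h := by
  have hρ : 0 < ν / 2 := by positivity
  have hk : ∀ y, HasDerivAt (fun y => h (2 * y - ν)) (2 * h' (2 * y - ν)) y := fun y => by
    have : HasDerivAt (fun y => h (2 * y - ν)) (h' (2 * y - ν) * (2 * 1)) y :=
      (hd _).comp y (((hasDerivAt_id y).const_mul (2:ℝ)).sub_const ν)
    exact this.congr_deriv (by ring)
  have hk' : ∀ y, HasDerivAt (fun y => 2 * h' (2 * y - ν)) (4 * h'' (2 * y - ν)) y := fun y => by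
    have : HasDerivAt (fun y => 2 * h' (2 * y - ν)) (2 * (h'' (2 * y - ν) * (2 * 1))) y :=
      ((hd' _).comp y (((hasDerivAt_id y).const_mul (2:ℝ)).sub_const ν)).const_mul 2
    exact this.congr_deriv (by ring)
  have hb1 : ∀ y, |2 * h' (2 * y - ν)| ≤ 2 * L1 := fun y => by
    rw [abs_mul, abs_of_pos (by norm_num : (0:ℝ) < 2)]; linarith [hL1 (2 * y - ν)]
  have hb2 : ∀ y, |4 * h'' (2 * y - ν)| ≤ 4 * L2 := fun y => by
    rw [abs_mul, abs_of_pos (by norm_num : (0:ℝ) < 4)]; linarith [hL2 (2 * y - ν)]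
  have hkc : Continuous (fun y => h (2 * y - ν)) :=
    continuous_iff_continuousAt.2 fun y => (hk y).continuousAt
  obtain ⟨hi, hz⟩ := gsAux_gamma_zero hρ hkc (gsAux_lip_of_deriv hk hb1)
  have hce : ∫ x, h (2 * x - ν) ∂(gammaMeasure (ν / 2) 1) = centeredGammaExp ν h := rfl
  rw [hce] at hi hz
  have hM : ∀ y, HasDerivAt (fun y => h (2 * y - ν) - centeredGammaExp ν h)
    (2 * h' (2 * y - ν)) y := fun y => (hk y).sub_const _
  obtain ⟨g, u, hs, hg, hu⟩ := gsAux_exists hρ hM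
    (continuous_iff_continuousAt.2 fun y => (hk' y).continuousAt) hi hz
  obtain ⟨b1, b2⟩ := gsAux_all_bounds hρ hs hM hk' hb1 hb2 (hg 0) hu
  have e : 1 / (ν / 2) = 2 / ν := by field_simp
  rw [e] at b1 b2
  refine ⟨fun x => g ((x + ν) / 2) / 2, fun x => u ((x + ν) / 2) / 4, fun x => ?_, fun x => ?_,
    fun x y => ?_, fun x => ?_⟩
  · have : HasDerivAt (fun x => g ((x + ν) / 2) / 2) (u ((x + ν) / 2) * (1 / 2) / 2) x :=
      ((hg _).comp x (((hasDerivAt_id x).add_const ν).div_const 2)).div_const 2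
    exact this.congr_deriv (by ring)
  · rw [abs_div, abs_of_pos (by norm_num : (0:ℝ) < 4)]
    have := b1 ((x + ν) / 2)
    linarith
  · have := b2 ((x + ν) / 2) ((y + ν) / 2)
    rw [← sub_div, abs_div, abs_of_pos (by norm_num : (0:ℝ) < 4)]
    have e2 : |(x + ν) / 2 - (y + ν) / 2| = |x - y| / 2 := by
      rw [← sub_div, abs_div, abs_of_pos (by norm_num : (0:ℝ) < 2)]; congr 2; ring
    rw [e2] at this
    linarith
  · have := hs.ode ((x + ν) / 2)
    have e3 : 2 * ((x + ν) / 2) - ν = x := by ring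
    rw [e3] at this
    rw [← this]; ring

lemma gsAux_taylor_pos {F f f' : ℝ → ℝ} {B : ℝ} (hF : ∀ x, HasDerivAt F (f x) x)
    (hf : ∀ x, HasDerivAt f (f' x) x) (hB : ∀ x y, |f' x - f' y| ≤ B * |x - y|)
    (x t : ℝ) (ht : 0 ≤ t) :
    |F (x + t) - F x - f x * t - f' x * t ^ 2 / 2| ≤ B / 6 * t ^ 3 := by
  have hxt : ∀ s : ℝ, HasDerivAt (fun s => x + s) 1 s := fun s => (hasDerivAt_id s).const_add x
  have hfd : ∀ s, HasDerivAt (fun s => f (x + s) - f x - f' x * s) (f' (x + s) - f' x) s := by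
    intro s
    have : HasDerivAt (fun s => f (x + s) - f x - f' x * s) (f' (x + s) * 1 - f' x * 1) s :=
      (((hf _).comp s (hxt s)).sub_const _).sub ((hasDerivAt_id s).const_mul _)
    exact this.congr_deriv (by ring)
  have hFd : ∀ s, HasDerivAt (fun s => F (x + s) - F x - f x * s - f' x * s ^ 2 / 2)
      (f (x + s) - f x - f' x * s) s := by
    intro s
    have : HasDerivAt (fun s => F (x + s) - F x - f x * s - f' x * s ^ 2 / 2)
        (f (x + s) * 1 - f x * 1 - f' x * (↑(2:ℕ) * s ^ (2 - 1) * 1) / 2) s :=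
      ((((hF _).comp s (hxt s)).sub_const _).sub ((hasDerivAt_id s).const_mul _)).sub
        ((((hasDerivAt_id s).pow 2).const_mul _).div_const 2)
    exact this.congr_deriv (by simp; ring)
  have s1 : ∀ s, 0 ≤ s → |f (x + s) - f x - f' x * s| ≤ B / 2 * s ^ 2 := by
    intro s hs
    have := image_norm_le_of_norm_deriv_right_le_deriv_boundary (a := 0) (b := s)
      (f := fun s => f (x + s) - f x - f' x * s) (f' := fun s => f' (x + s) - f' x)
      (B := fun s => B / 2 * s ^ 2) (B' := fun s => B * s)
      (fun z _ => (hfd z).continuousAt.continuousWithinAt)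
      (fun z _ => (hfd z).hasDerivWithinAt) (by simp)
      (fun z => (((hasDerivAt_id z).pow 2).const_mul (B / 2)).congr_deriv (by simp; ring))
      (fun z hz => by
        have := hB (x + z) x
        rw [add_sub_cancel_left, abs_of_nonneg hz.1] at this
        exact this) (right_mem_Icc.2 hs)
    exact this
  have := image_norm_le_of_norm_deriv_right_le_deriv_boundary (a := 0) (b := t)
      (f := fun s => F (x + s) - F x - f x * s - f' x * s ^ 2 / 2)
      (f' := fun s => f (x + s) - f x - f' x * s)
      (B := fun s => B / 6 * s ^ 3) (B' := fun s => B / 2 * s ^ 2)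
      (fun z _ => (hFd z).continuousAt.continuousWithinAt)
      (fun z _ => (hFd z).hasDerivWithinAt) (by simp)
      (fun z => (((hasDerivAt_id z).pow 3).const_mul (B / 6)).congr_deriv (by simp; ring))
      (fun z hz => s1 z hz.1) (right_mem_Icc.2 ht)
  exact this

lemma gsAux_taylor {F f f' : ℝ → ℝ} {B : ℝ} (hF : ∀ x, HasDerivAt F (f x) x)
    (hf : ∀ x, HasDerivAt f (f' x) x) (hB : ∀ x y, |f' x - f' y| ≤ B * |x - y|)
    (x y : ℝ) :
    |F y - F x - f x * (y - x) - f' x * (y - x) ^ 2 / 2| ≤ B / 6 * |y - x| ^ 3 := by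
  rcases le_total x y with h | h
  · have := gsAux_taylor_pos hF hf hB x (y - x) (sub_nonneg.2 h)
    rw [add_sub_cancel] at this
    rwa [abs_of_nonneg (sub_nonneg.2 h)]
  · have hn : ∀ s : ℝ, HasDerivAt (fun s => -s) (-1) s := fun s => (hasDerivAt_id s).neg
    have hF2 : ∀ x, HasDerivAt (fun x => F (-x)) (- f (-x)) x := fun x => by
      have : HasDerivAt (fun x => F (-x)) (f (-x) * (-1)) x := (hF _).comp x (hn x)
      exact this.congr_deriv (by ring)
    have hf2 : ∀ x, HasDerivAt (fun x => - f (-x)) (f' (-x)) x := fun x => by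
      have : HasDerivAt (fun x => - f (-x)) (-(f' (-x) * (-1))) x := ((hf _).comp x (hn x)).neg
      exact this.congr_deriv (by ring)
    have := gsAux_taylor_pos hF2 hf2 (B := B) (fun x y => by
      have := hB (-x) (-y)
      rwa [show -x - -y = -(x - y) by ring, abs_neg] at this) (-x) (x - y) (sub_nonneg.2 h)
    rw [abs_sub_comm y x, abs_of_nonneg (sub_nonneg.2 h)]
    simp only [neg_neg] at this
    rw [show -(-x + (x - y)) = y by ring] at this
    convert this using 2
    ring

lemma gsAux_lipConst {g : ℝ → ℝ} (hg : ∃ K : NNReal, LipschitzWith K g) (x y : ℝ) :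
    |g x - g y| ≤ lipConst g * |x - y| := by
  obtain ⟨K, hK⟩ := hg
  rcases eq_or_ne x y with rfl | hxy
  · simp
  · have hp : 0 < |x - y| := abs_pos.2 (sub_ne_zero.2 hxy)
    rw [← div_le_iff₀ hp]
    refine le_csSup ⟨K, ?_⟩ ⟨x, y, hxy, rfl⟩
    rintro c ⟨a, b, hab, rfl⟩
    have hp : 0 < |a - b| := abs_pos.2 (sub_ne_zero.2 hab)
    rw [div_le_iff₀ hp]
    simpa [Real.dist_eq] using hK.dist_le_mul a b

lemma gsAux_lipConst_nonneg {g : ℝ → ℝ} (hg : ∃ K : NNReal, LipschitzWith K g) :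
    0 ≤ lipConst g := by
  have := gsAux_lipConst hg 1 0
  simp at this
  exact (abs_nonneg _).trans this

lemma gsAux_integral_close {α : Type*} {m0 : MeasurableSpace α} (μ : Measure α)
    [IsProbabilityMeasure μ] {a b : α → ℝ} {c : ℝ}
    (hm : AEStronglyMeasurable (fun x => a x - b x) μ) (hc : ∀ x, |a x - b x| ≤ c) :
    |(∫ x, a x ∂μ) - ∫ x, b x ∂μ| ≤ c := by
  have hi : Integrable (fun x => a x - b x) μ :=
    (integrable_const c).mono' hm (ae_of_all _ hc)
  have hc0 : 0 ≤ c := by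
    have : Nonempty α := μ.nonempty_of_neZero
    exact (abs_nonneg _).trans (hc (Classical.arbitrary α))
  by_cases hb : Integrable b μ
  · have ha : Integrable a μ := (hi.add hb).congr (ae_of_all _ fun x => by simp)
    rw [← integral_sub ha hb]
    have := norm_integral_le_of_norm_le_const (μ := μ) (ae_of_all _ hc : ∀ᵐ x ∂μ, ‖a x - b x‖ ≤ c)
    simpa using this
  · have ha : ¬ Integrable a μ := fun ha => hb ((ha.sub hi).congr (ae_of_all _ fun x => by simp))
    rw [integral_undef ha, integral_undef hb]; simpa

lemma gsAux_mollify {h : ℝ → ℝ} (hC : ContDiff ℝ 1 h)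
    (h1 : ∃ K : NNReal, LipschitzWith K h) (h2 : ∃ K : NNReal, LipschitzWith K (deriv h))
    {ε : ℝ} (hε : 0 < ε) : ∃ k k' k'' : ℝ → ℝ, (∀ x, HasDerivAt k (k' x) x) ∧
      (∀ x, HasDerivAt k' (k'' x) x) ∧ (∀ x, |k' x| ≤ lipConst h) ∧
      (∀ x, |k'' x| ≤ lipConst (deriv h)) ∧ ∀ x, |k x - h x| ≤ lipConst h * ε := by
  have hc : Continuous h := hC.continuous
  have hd : ∀ x, HasDerivAt h (deriv h x) x := fun x =>
    (hC.differentiable (by norm_num) x).hasDerivAt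
  have hH : ∀ x, HasDerivAt (fun x => ∫ t in (0:ℝ)..x, h t) (h x) x := fun x =>
    intervalIntegral.integral_hasDerivAt_right (hc.intervalIntegrable _ _)
      (hc.stronglyMeasurableAtFilter _ _) hc.continuousAt
  have quot : ∀ F F' : ℝ → ℝ, (∀ x, HasDerivAt F (F' x) x) → ∀ x,
      HasDerivAt (fun x => (F (x + ε) - F (x - ε)) / (2 * ε)) ((F' (x + ε) - F' (x - ε)) / (2 * ε)) x := by
    intro F F' hF x
    have : HasDerivAt (fun x => (F (x + ε) - F (x - ε)) / (2 * ε))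
        ((F' (x + ε) * 1 - F' (x - ε) * 1) / (2 * ε)) x :=
      (((hF _).comp x ((hasDerivAt_id x).add_const ε)).sub
        ((hF _).comp x ((hasDerivAt_id x).sub_const ε))).div_const _
    exact this.congr_deriv (by ring)
  have qb : ∀ F : ℝ → ℝ, (∃ K : NNReal, LipschitzWith K F) → ∀ x,
      |(F (x + ε) - F (x - ε)) / (2 * ε)| ≤ lipConst F := by
    intro F hF x
    have := gsAux_lipConst hF (x + ε) (x - ε)
    rw [show x + ε - (x - ε) = 2 * ε by ring, abs_of_pos (by positivity : 0 < 2 * ε)] at this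
    rwa [abs_div, abs_of_pos (by positivity : 0 < 2 * ε), div_le_iff₀ (by positivity)]
  refine ⟨_, _, _, quot _ _ hH, quot _ _ hd, qb h h1, qb _ h2, fun x => ?_⟩
  have hi : ∀ a b, IntervalIntegrable h volume a b := fun a b => hc.intervalIntegrable a b
  rw [intervalIntegral.integral_interval_sub_left (hi _ _) (hi _ _)]
  have e : (∫ t in (x - ε)..(x + ε), h t) / (2 * ε) - h x =
      (∫ t in (x - ε)..(x + ε), (h t - h x)) / (2 * ε) := by
    rw [intervalIntegral.integral_sub (hi _ _) (by simp), intervalIntegral.integral_const]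
    simp only [smul_eq_mul]; field_simp; ring
  rw [e, abs_div, abs_of_pos (by positivity : 0 < 2 * ε), div_le_iff₀ (by positivity)]
  have := intervalIntegral.norm_integral_le_of_norm_le_const (a := x - ε) (b := x + ε)
    (f := fun t => h t - h x) (C := lipConst h * ε) (fun t ht => by
      rw [uIoc_of_le (by linarith)] at ht
      refine (gsAux_lipConst h1 t x).trans ?_
      refine mul_le_mul_of_nonneg_left ?_ (gsAux_lipConst_nonneg h1)
      rw [abs_le]; constructor <;> linarith [ht.1, ht.2])
  rw [show x + ε - (x - ε) = 2 * ε by ring, abs_of_pos (by positivity : 0 < 2 * ε)] at this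
  exact this

lemma gsAux_pullout {Ω : Type*} {m m0 : MeasurableSpace Ω} {μ : Measure Ω}
    [IsProbabilityMeasure μ] (hm : m ≤ m0) {X Y : Ω → ℝ} (hX : StronglyMeasurable[m] X)
    (hXY : Integrable (fun ω => X ω * Y ω) μ) (hY : Integrable Y μ) :
    ∫ ω, X ω * Y ω ∂μ = ∫ ω, X ω * (μ[Y|m]) ω ∂μ := by
  rw [← integral_condExp hm]
  refine integral_congr_ae ?_
  exact condExp_mul_of_stronglyMeasurable_left hX hXY hY

lemma gsAux_prob {Ω : Type*} {m0 : MeasurableSpace Ω} (μ : Measure Ω) [IsProbabilityMeasure μ]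
    (ν : ℝ)
    (W W' : Ω → ℝ) (hW : Measurable W) (hW' : Measurable W')
    (hWL2 : MemLp W 2 μ) (hW'L2 : MemLp W' 2 μ)
    (hvarW : (∫ ω, (W ω) ^ 2 ∂μ) = 2 * ν)
    (hexch : μ.map (fun ω => (W ω, W' ω)) = μ.map (fun ω => (W' ω, W ω)))
    (𝒢 : MeasurableSpace Ω) (h𝒢 : 𝒢 ≤ m0)
    (hσW : MeasurableSpace.comap W inferInstance ≤ 𝒢)
    (lam : ℝ) (hlam : 0 < lam)
    (hreg : ∀ᵐ ω ∂μ, (1 / lam) * (μ[fun ω => W' ω - W ω|𝒢]) ω = -W ω)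
    (S : Ω → ℝ)
    (hSdef : S = fun ω =>
      (1 / (2 * lam)) * (μ[fun ω => (W' ω - W ω) ^ 2|𝒢]) ω - 2 * (W ω + ν))
    (hSL2 : MemLp S 2 μ)
    (hcube : Integrable (fun ω => |W' ω - W ω| ^ 3) μ) :
    (∫ ω, S ω ∂μ) = 0 ∧
      ∀ (f f' : ℝ → ℝ) (A B : ℝ), (∀ x, HasDerivAt f (f' x) x) → (∀ x, |f' x| ≤ A) →
        (∀ x y, |f' x - f' y| ≤ B * |x - y|) →
        Integrable (fun ω => 2 * (W ω + ν) * f' (W ω) - W ω * f (W ω)) μ ∧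
        |∫ ω, (2 * (W ω + ν) * f' (W ω) - W ω * f (W ω)) ∂μ|
          ≤ A * Real.sqrt (variance S μ) + B / (6 * lam) * ∫ ω, |W' ω - W ω| ^ 3 ∂μ := by
  have hD2 : MemLp (fun ω => W' ω - W ω) 2 μ := hW'L2.sub hWL2
  have hDi : Integrable (fun ω => W' ω - W ω) μ := hD2.integrable (by norm_num)
  have hWi : Integrable W μ := hWL2.integrable (by norm_num)
  have hW'i : Integrable W' μ := hW'L2.integrable (by norm_num)
  have hDsq : Integrable (fun ω => (W' ω - W ω) ^ 2) μ := hD2.integrable_sq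
  have hWG : Measurable[𝒢] W := fun s hs => hσW _ ⟨s, hs, rfl⟩
  -- equality in law
  have hlaw : ∀ φ : ℝ → ℝ, Measurable φ → ∫ ω, φ (W ω) ∂μ = ∫ ω, φ (W' ω) ∂μ := by
    intro φ hφ
    have m1 : Measurable (fun p : ℝ × ℝ => φ p.1) := hφ.comp measurable_fst
    have e1 := integral_map (μ := μ) (φ := fun ω => (W ω, W' ω)) (hW.prodMk hW').aemeasurable
      (f := fun p : ℝ × ℝ => φ p.1) m1.aestronglyMeasurable
    have e2 := integral_map (μ := μ) (φ := fun ω => (W' ω, W ω)) (hW'.prodMk hW).aemeasurable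
      (f := fun p : ℝ × ℝ => φ p.1) m1.aestronglyMeasurable
    rw [hexch] at e1
    exact e1.symm.trans e2
  have hreg' : ∀ᵐ ω ∂μ, (μ[fun ω => W' ω - W ω|𝒢]) ω = -(lam * W ω) := by
    filter_upwards [hreg] with ω hω
    field_simp at hω
    linarith
  -- regression
  have hregI : ∀ φ : ℝ → ℝ, Measurable φ → Integrable (fun ω => φ (W ω) * (W' ω - W ω)) μ →
      ∫ ω, φ (W ω) * (W' ω - W ω) ∂μ = -(lam * ∫ ω, W ω * φ (W ω) ∂μ) := by
    intro φ hφ hi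
    have hs : StronglyMeasurable[𝒢] (fun ω => φ (W ω)) :=
      (hφ.comp hWG).stronglyMeasurable
    rw [gsAux_pullout h𝒢 hs hi hDi, ← integral_const_mul, ← integral_neg]
    refine integral_congr_ae ?_
    filter_upwards [hreg'] with ω hω
    rw [hω]; ring
  have hTS : ∀ ω, (μ[fun ω => (W' ω - W ω) ^ 2|𝒢]) ω = 2 * lam * (S ω + 2 * (W ω + ν)) := by
    intro ω
    rw [hSdef]; field_simp; ring
  have hSi : Integrable S μ := hSL2.integrable (by norm_num)
  have hEW : ∫ ω, W ω ∂μ = 0 := by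
    have h1 := hregI (fun _ => 1) measurable_const (by simpa using hDi)
    simp only [one_mul, mul_one] at h1
    have h2 : ∫ ω, W ω ∂μ = ∫ ω, W' ω ∂μ := hlaw id measurable_id
    rw [integral_sub hW'i hWi, ← h2, sub_self] at h1
    have : lam * ∫ ω, W ω ∂μ = 0 := by linarith
    exact (mul_eq_zero.1 this).resolve_left hlam.ne'
  have hWDi : Integrable (fun ω => W ω * (W' ω - W ω)) μ := hWL2.integrable_mul hD2
  have hED : ∫ ω, (W' ω - W ω) ^ 2 ∂μ = 4 * lam * ν := by
    have h1 := hregI id measurable_id hWDi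
    simp only [id] at h1
    have h2 : ∫ ω, W ω * W ω ∂μ = 2 * ν := by rw [← hvarW]; simp only [pow_two]
    rw [h2] at h1
    have h3 : ∫ ω, (W' ω) ^ 2 ∂μ = 2 * ν := by
      rw [← hvarW]; exact (hlaw (fun x => x ^ 2) (by fun_prop)).symm
    have e : (fun ω => (W' ω - W ω) ^ 2) = fun ω =>
        ((W' ω) ^ 2 - (W ω) ^ 2) - 2 * (W ω * (W' ω - W ω)) := by funext ω; ring
    have hsub : Integrable (fun ω => (W' ω) ^ 2 - (W ω) ^ 2) μ :=
      hW'L2.integrable_sq.sub hWL2.integrable_sq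
    rw [e, integral_sub hsub (hWDi.const_mul 2),
      integral_sub hW'L2.integrable_sq hWL2.integrable_sq, integral_const_mul, h1, h3, hvarW]
    ring
  have hES : ∫ ω, S ω ∂μ = 0 := by
    have h1 : ∫ ω, (μ[fun ω => (W' ω - W ω) ^ 2|𝒢]) ω ∂μ = 4 * lam * ν := by
      rw [integral_condExp h𝒢, hED]
    simp only [hTS] at h1
    have hwn : Integrable (fun ω => W ω + ν) μ := hWi.add (integrable_const ν)
    rw [integral_const_mul, integral_add hSi (hwn.const_mul 2),
      integral_const_mul, integral_add hWi (integrable_const ν), hEW] at h1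
    simp at h1
    have : 2 * lam * ∫ ω, S ω ∂μ = 0 := by linarith
    exact (mul_eq_zero.1 this).resolve_left (by positivity)
  refine ⟨hES, fun f f' A B hf hA hB => ?_⟩
  have hA0 : 0 ≤ A := (abs_nonneg _).trans (hA 0)
  have hB0 : 0 ≤ B := by
    have := hB 1 0
    simp at this
    exact (abs_nonneg _).trans this
  have hfc : Continuous f := continuous_iff_continuousAt.2 fun x => (hf x).continuousAt
  have hf'c : Continuous f' := by
    have : LipschitzWith B.toNNReal f' := LipschitzWith.of_dist_le_mul fun x y => by
      rw [Real.dist_eq, Real.dist_eq, Real.coe_toNNReal B hB0]; exact hB x y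
    exact this.continuous
  have hfg : ∀ x, |f x| ≤ |f 0| + A * |x| := by
    intro x
    have := gsAux_lip_of_deriv hf hA x 0
    rw [sub_zero] at this
    have := abs_sub_abs_le_abs_sub (f x) (f 0)
    linarith
  have hfW : MemLp (fun ω => f (W ω)) 2 μ := by
    have hd : MemLp (fun ω => |f 0| + A * |W ω|) 2 μ :=
      (memLp_const (|f 0|)).add (hWL2.abs.const_mul A)
    refine hd.mono (hfc.measurable.comp hW).aestronglyMeasurable (ae_of_all _ fun ω => ?_)
    rw [Real.norm_eq_abs, Real.norm_of_nonneg (by positivity)]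
    exact hfg _
  have hbdd : ∀ Y : Ω → ℝ, Integrable Y μ → Integrable (fun ω => f' (W ω) * Y ω) μ := by
    intro Y hY
    exact hY.bdd_mul (c := A) (hf'c.measurable.comp hW).aestronglyMeasurable
      (ae_of_all _ fun ω => hA _)
  have hF : ∀ x, HasDerivAt (fun x => ∫ t in (0:ℝ)..x, f t) (f x) x := fun x =>
    intervalIntegral.integral_hasDerivAt_right (hfc.intervalIntegrable _ _)
      (hfc.stronglyMeasurableAtFilter _ _) hfc.continuousAt
  set F : ℝ → ℝ := fun x => ∫ t in (0:ℝ)..x, f t with hFdef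
  have hFc : Continuous F := continuous_iff_continuousAt.2 fun x => (hF x).continuousAt
  have hFb : ∀ x, |F x| ≤ |f 0| * |x| + A * x ^ 2 := by
    intro x
    have := intervalIntegral.norm_integral_le_of_norm_le_const (a := 0) (b := x)
      (f := f) (C := |f 0| + A * |x|) (fun t ht => by
        refine (hfg t).trans ?_
        have : |t| ≤ |x| := by
          rcases le_total 0 x with hx | hx
          · rw [uIoc_of_le hx] at ht
            rw [abs_of_pos ht.1, abs_of_nonneg hx]; exact ht.2
          · rw [uIoc_of_ge hx] at ht
            rw [abs_of_nonpos ht.2, abs_of_nonpos hx]; linarith [ht.1]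
        gcongr)
    rw [sub_zero, Real.norm_eq_abs] at this
    calc |F x| ≤ _ := this
      _ = |f 0| * |x| + A * |x| ^ 2 := by ring
      _ = _ := by rw [sq_abs]
  have hFi : ∀ V : Ω → ℝ, Measurable[m0] V → MemLp V 2 μ → Integrable (fun ω => F (V ω)) μ := by
    intro V hV hV2
    have hVi : Integrable V μ := hV2.integrable (by norm_num)
    refine ((hVi.abs.const_mul |f 0|).add (hV2.integrable_sq.const_mul A)).mono'
      (hFc.measurable.comp hV).aestronglyMeasurable (ae_of_all _ fun ω => hFb _)
  have hfD : Integrable (fun ω => f (W ω) * (W' ω - W ω)) μ := hfW.integrable_mul hD2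
  have hf'D := hbdd _ hDsq
  have hR : ∀ ω, |F (W' ω) - F (W ω) - f (W ω) * (W' ω - W ω) - f' (W ω) * (W' ω - W ω) ^ 2 / 2|
      ≤ B / 6 * |W' ω - W ω| ^ 3 := fun ω => gsAux_taylor hF hf hB _ _
  have hRi : |∫ ω, (F (W' ω) - F (W ω) - f (W ω) * (W' ω - W ω)
      - f' (W ω) * (W' ω - W ω) ^ 2 / 2) ∂μ| ≤ B / 6 * ∫ ω, |W' ω - W ω| ^ 3 ∂μ := by
    rw [← integral_const_mul]
    exact norm_integral_le_of_norm_le (f := fun ω => F (W' ω) - F (W ω) - f (W ω) * (W' ω - W ω)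
      - f' (W ω) * (W' ω - W ω) ^ 2 / 2) (hcube.const_mul (B / 6)) (ae_of_all _ hR)
  have i1 := hFi W hW hWL2
  have i2 := hFi W' hW' hW'L2
  have i3 : Integrable (fun ω => F (W' ω) - F (W ω)) μ := i2.sub i1
  have i4 : Integrable (fun ω => F (W' ω) - F (W ω) - f (W ω) * (W' ω - W ω)) μ := i3.sub hfD
  rw [integral_sub i4 (hf'D.div_const 2), integral_sub i3 hfD,
    integral_sub i2 i1, ← hlaw F hFc.measurable, sub_self, hregI f hfc.measurable hfD,
    integral_div, gsAux_pullout h𝒢 (X := fun ω => f' (W ω)) (hf'c.measurable.comp hWG).stronglyMeasurable hf'D hDsq] at hRi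
  have hwn : Integrable (fun ω => 2 * (W ω + ν)) μ := (hWi.add (integrable_const ν)).const_mul 2
  have j1 := hbdd _ hSi
  have j2 := hbdd _ hwn
  have j3 : Integrable (fun ω => W ω * f (W ω)) μ := hWL2.integrable_mul hfW
  have eT : ∫ ω, f' (W ω) * (μ[fun ω => (W' ω - W ω) ^ 2|𝒢]) ω ∂μ =
      2 * lam * ((∫ ω, f' (W ω) * S ω ∂μ) + ∫ ω, f' (W ω) * (2 * (W ω + ν)) ∂μ) := by
    rw [← integral_add j1 j2, ← integral_const_mul]
    refine integral_congr_ae (ae_of_all _ fun ω => ?_)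
    simp only [hTS]; ring
  rw [eT] at hRi
  have eI : (fun ω => 2 * (W ω + ν) * f' (W ω) - W ω * f (W ω)) =
      fun ω => f' (W ω) * (2 * (W ω + ν)) - W ω * f (W ω) := by funext ω; ring
  rw [eI]
  refine ⟨j2.sub j3, ?_⟩
  rw [integral_sub j2 j3]
  have hSb : |∫ ω, f' (W ω) * S ω ∂μ| ≤ A * √(variance S μ) := by
    have b1 : |∫ ω, f' (W ω) * S ω ∂μ| ≤ A * ∫ ω, |S ω| ∂μ := by
      rw [← integral_const_mul]
      refine norm_integral_le_of_norm_le (f := fun ω => f' (W ω) * S ω) (hSi.abs.const_mul _) (ae_of_all _ fun ω => ?_)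
      rw [Real.norm_eq_abs, abs_mul]
      exact mul_le_mul_of_nonneg_right (hA _) (abs_nonneg _)
    refine b1.trans (mul_le_mul_of_nonneg_left ?_ hA0)
    refine Real.le_sqrt_of_sq_le ?_
    have v1 := variance_eq_sub hSL2
    have hSa : MemLp (fun ω => |S ω|) 2 μ := hSL2.abs
    have v2 := variance_eq_sub hSa
    have v3 := variance_nonneg (fun ω => |S ω|) μ
    rw [hES] at v1
    simp only [Pi.pow_apply, sq_abs] at v1 v2
    rw [v2] at v3
    linarith
  set I := ∫ ω, f' (W ω) * S ω ∂μ
  set J := ∫ ω, f' (W ω) * (2 * (W ω + ν)) ∂μ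
  set K := ∫ ω, W ω * f (W ω) ∂μ
  set Q := ∫ ω, |W' ω - W ω| ^ 3 ∂μ
  have e1 : 0 - -(lam * K) - 2 * lam * (I + J) / 2 = -(lam * (I + (J - K))) := by ring
  rw [e1, abs_neg, abs_mul, abs_of_pos hlam] at hRi
  have e2 : |I + (J - K)| ≤ B / (6 * lam) * Q := by
    have : B / (6 * lam) * Q = (B / 6 * Q) / lam := by field_simp
    rw [this, le_div_iff₀ hlam]
    linarith
  have e3 : |J - K| ≤ |I| + |I + (J - K)| := by
    have := abs_sub (I + (J - K)) I
    rw [add_sub_cancel_left] at this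
    linarith
  linarith

end GsAux

/-- Theorem `plugin`, second bound: let `ν > 0`, let `(W, W')` be an
exchangeable pair of square-integrable real random variables with `E[W²] = 2ν`, `𝒢 ⊇ σ(W)` a
sub-σ-field, `λ > 0` with `(1/λ) E[W' − W | 𝒢] = −W` a.s., and set
`S := (1/(2λ)) E[(W' − W)² | 𝒢] − 2(W + ν)`
(the square-integrability of `S` and the integrability of `|W' − W|³` are the implicit
well-definedness assumptions of the bound).  Then `E[S] = 0` and for every `C¹` function `h`
with `h` and `h'` Lipschitz,
`|E[h(W)] − E[h(Z_ν)]| ≤ max(1, 2/ν) ‖h'‖ √(Var S)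
  + ((max(1, 2/ν) ‖h'‖ + ‖h''‖) / (6λ)) E|W' − W|³`. -/
theorem exchangeable_pair_centered_gamma_bound_variance
    {Ω : Type*} [MeasurableSpace Ω] (μ : Measure Ω) [IsProbabilityMeasure μ]
    (ν : ℝ) (hν : 0 < ν)
    (W W' : Ω → ℝ) (hW : Measurable W) (hW' : Measurable W')
    (hWL2 : MemLp W 2 μ) (hW'L2 : MemLp W' 2 μ)
    (hvarW : (∫ ω, (W ω) ^ 2 ∂μ) = 2 * ν)
    (hexch : μ.map (fun ω => (W ω, W' ω)) = μ.map (fun ω => (W' ω, W ω)))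
    (𝒢 : MeasurableSpace Ω) (h𝒢 : 𝒢 ≤ ‹MeasurableSpace Ω›)
    (hσW : MeasurableSpace.comap W inferInstance ≤ 𝒢)
    (lam : ℝ) (hlam : 0 < lam)
    (hreg : ∀ᵐ ω ∂μ, (1 / lam) * (μ[fun ω => W' ω - W ω|𝒢]) ω = -W ω)
    (S : Ω → ℝ)
    (hSdef : S = fun ω =>
      (1 / (2 * lam)) * (μ[fun ω => (W' ω - W ω) ^ 2|𝒢]) ω - 2 * (W ω + ν))
    (hSL2 : MemLp S 2 μ)
    (hcube : Integrable (fun ω => |W' ω - W ω| ^ 3) μ) :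
    (∫ ω, S ω ∂μ) = 0 ∧
      ∀ h : ℝ → ℝ, ContDiff ℝ 1 h →
        (∃ K : NNReal, LipschitzWith K h) →
        (∃ K : NNReal, LipschitzWith K (deriv h)) →
        |(∫ ω, h (W ω) ∂μ) - centeredGammaExp ν h|
          ≤ max 1 (2 / ν) * lipConst h * Real.sqrt (variance S μ)
            + ((max 1 (2 / ν) * lipConst h + lipConst (deriv h)) / (6 * lam))
                * ∫ ω, |W' ω - W ω| ^ 3 ∂μ := by
  rename_i inst0 _
  -- if `𝒢` were not a sub-σ-field, the conditional expectation would be `0`, forcing `W = 0` a.s.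
  have h𝒢' : 𝒢 ≤ inst0 := by
    by_contra hn
    rw [condExp_of_not_le hn] at hreg
    have h0 : ∫ ω, (W ω) ^ 2 ∂μ = 0 := by
      rw [← integral_zero Ω ℝ (μ := μ)]
      refine integral_congr_ae ?_
      filter_upwards [hreg] with ω hω
      simp only [Pi.zero_apply, mul_zero] at hω
      have : W ω = 0 := by linarith
      simp [this]
    rw [h0] at hvarW
    linarith
  obtain ⟨hES, hmain⟩ := gsAux_prob μ ν W W' hW hW' hWL2 hW'L2 hvarW hexch 𝒢 h𝒢' hσW lam hlam
    hreg S hSdef hSL2 hcube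
  refine ⟨hES, fun h hC h1 h2 => ?_⟩
  have hL0 := gsAux_lipConst_nonneg h1
  have key : ∀ ε : ℝ, 0 < ε → |(∫ ω, h (W ω) ∂μ) - centeredGammaExp ν h|
      ≤ max 1 (2 / ν) * lipConst h * Real.sqrt (variance S μ)
            + ((max 1 (2 / ν) * lipConst h + lipConst (deriv h)) / (6 * lam))
                * (∫ ω, |W' ω - W ω| ^ 3 ∂μ) + 2 * (lipConst h * ε) := by
    intro ε hε
    obtain ⟨k, k', k'', hk, hk', b1, b2, hkh⟩ := gsAux_mollify hC h1 h2 hε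
    obtain ⟨f, f', hf, hA, hB, hst⟩ := gsAux_stein hν hk hk' b1 b2
    obtain ⟨hi, hb⟩ := hmain f f' _ _ hf hA hB
    have hkc : Continuous k := continuous_iff_continuousAt.2 fun x => (hk x).continuousAt
    have hhc : Continuous h := hC.continuous
    have e1 : ∫ ω, (2 * (W ω + ν) * f' (W ω) - W ω * f (W ω)) ∂μ =
        (∫ ω, k (W ω) ∂μ) - centeredGammaExp ν k := by
      have : (fun ω => k (W ω)) = fun ω =>
          (2 * (W ω + ν) * f' (W ω) - W ω * f (W ω)) + centeredGammaExp ν k := by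
        funext ω; rw [hst]; ring
      rw [this, integral_add hi (integrable_const _)]
      simp
    rw [e1] at hb
    have c1 : |(∫ ω, k (W ω) ∂μ) - ∫ ω, h (W ω) ∂μ| ≤ lipConst h * ε :=
      gsAux_integral_close μ ((hkc.sub hhc).measurable.comp hW).aestronglyMeasurable
        fun ω => hkh _
    have c2 : |centeredGammaExp ν k - centeredGammaExp ν h| ≤ lipConst h * ε := by
      have : IsProbabilityMeasure (gammaMeasure (ν / 2) 1) :=
        isProbabilityMeasure_gammaMeasure (by positivity) one_pos
      refine gsAux_integral_close _ ?_ fun x => hkh _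
      have : Continuous (fun x => k (2 * x - ν) - h (2 * x - ν)) := by fun_prop
      exact this.aestronglyMeasurable
    rw [abs_le] at *
    constructor <;> linarith [hb.1, hb.2, c1.1, c1.2, c2.1, c2.2]
  refine le_of_forall_pos_le_add fun δ hδ => ?_
  have hp : 0 < 2 * (lipConst h + 1) := by positivity
  refine (key (δ / (2 * (lipConst h + 1))) (by positivity)).trans ?_
  have : 2 * (lipConst h * (δ / (2 * (lipConst h + 1)))) ≤ δ := by
    rw [← mul_div_assoc, ← mul_div_assoc, div_le_iff₀ hp]
    nlinarith
  linarith
end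

section
/- Let (W, W') be an exchangeable pair of real random variables in L⁴(P), let G be a sub-σ-field containing σ(W), and let λ > 0 be such that (1/λ)E[W'−W | G] = −W almost surely. Then E[W⁴] = 3·E[ W² · (1/(2λ))E[(W'−W)² | G] ] − (1/(4λ))·E[(W'−W)⁴]. -/
open MeasureTheory ProbabilityTheory Real


lemma aux_int31 {Ω : Type*} {m0 : MeasurableSpace Ω} {μ : Measure Ω} {X Y : Ω → ℝ}
    (hX : MemLp X 4 μ) (hY : MemLp Y 4 μ) (i j : ℕ) (hij : i + j = 4) :
    Integrable (fun ω => X ω ^ i * Y ω ^ j) μ := by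
  have hX4 : Integrable (fun ω => ‖X ω‖ ^ 4) μ := by
    simpa using hX.integrable_norm_pow (p := 4) (by norm_num)
  have hY4 : Integrable (fun ω => ‖Y ω‖ ^ 4) μ := by
    simpa using hY.integrable_norm_pow (p := 4) (by norm_num)
  refine (hX4.add hY4).mono' ((hX.1.pow i).mul (hY.1.pow j)) (Filter.Eventually.of_forall ?_)
  intro ω
  simp only [norm_mul, norm_pow, Pi.add_apply]
  have hu := norm_nonneg (X ω)
  have hv := norm_nonneg (Y ω)
  generalize ‖X ω‖ = u at *
  generalize ‖Y ω‖ = v at *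
  have hu4 : 0 ≤ u ^ 4 := by positivity
  have hv4 : 0 ≤ v ^ 4 := by positivity
  rcases le_total u v with h | h
  · have : u ^ i * v ^ j ≤ v ^ i * v ^ j := by gcongr
    rw [← pow_add, hij] at this
    linarith
  · have : u ^ i * v ^ j ≤ u ^ i * u ^ j := by gcongr
    rw [← pow_add, hij] at this
    linarith

lemma aux_exch {Ω : Type*} {m0 : MeasurableSpace Ω} {μ : Measure Ω} {W W' : Ω → ℝ}
    (hW : Measurable W) (hW' : Measurable W')
    (hexch : μ.map (fun ω => (W ω, W' ω)) = μ.map (fun ω => (W' ω, W ω)))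
    (f : ℝ × ℝ → ℝ) (hf : Measurable f) :
    ∫ ω, f (W ω, W' ω) ∂μ = ∫ ω, f (W' ω, W ω) ∂μ := by
  rw [← integral_map (φ := fun ω => (W ω, W' ω)) (hW.prodMk hW').aemeasurable
      hf.aestronglyMeasurable, hexch,
    integral_map (φ := fun ω => (W' ω, W ω)) (hW'.prodMk hW).aemeasurable
      hf.aestronglyMeasurable]

lemma aux_pull {Ω : Type*} {m m0 : MeasurableSpace Ω} {μ : Measure[m0] Ω} (hm : m ≤ m0)
    [IsProbabilityMeasure μ] {f g : Ω → ℝ} (hf : StronglyMeasurable[m] f)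
    (hfg : Integrable (fun ω => f ω * g ω) μ) (hg : Integrable g μ) :
    ∫ ω, f ω * (μ[g|m]) ω ∂μ = ∫ ω, f ω * g ω ∂μ := by
  have h := condExp_mul_of_stronglyMeasurable_left (μ := μ) hf hfg hg
  rw [← integral_condExp hm (f := fun ω => f ω * g ω)]
  exact (integral_congr_ae h).symm

lemma aux_alg {Ω : Type*} {m0 : MeasurableSpace Ω} {μ : Measure Ω} [IsProbabilityMeasure μ]
    {W W' : Ω → ℝ} (hW : Measurable W) (hW' : Measurable W')
    (hWL4 : MemLp W 4 μ) (hW'L4 : MemLp W' 4 μ)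
    (hexch : μ.map (fun ω => (W ω, W' ω)) = μ.map (fun ω => (W' ω, W ω))) :
    2 * ∫ ω, W ω ^ 3 * (W' ω - W ω) ∂μ
      = -3 * (∫ ω, W ω ^ 2 * (W' ω - W ω) ^ 2 ∂μ) + 1 / 2 * ∫ ω, (W' ω - W ω) ^ 4 ∂μ := by
  have hD : MemLp (fun ω => W' ω - W ω) 4 μ := hW'L4.sub hWL4
  have i31 : Integrable (fun ω => W ω ^ 3 * (W' ω - W ω)) μ := by
    simpa using aux_int31 hWL4 hD 3 1 rfl
  have i22 := aux_int31 hWL4 hD 2 2 rfl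
  have i13 : Integrable (fun ω => W ω * (W' ω - W ω) ^ 3) μ := by
    simpa using aux_int31 hWL4 hD 1 3 rfl
  have i04 : Integrable (fun ω => (W' ω - W ω) ^ 4) μ := by
    simpa using aux_int31 hWL4 hD 0 4 rfl
  have e1 := aux_exch hW hW' hexch (fun p => p.1 ^ 3 * (p.2 - p.1)) (by fun_prop)
  have e2 := aux_exch hW hW' hexch (fun p => p.1 * (p.2 - p.1) ^ 3) (by fun_prop)
  simp only at e1 e2
  have r1 : ∫ ω, W' ω ^ 3 * (W ω - W' ω) ∂μ
      = -((∫ ω, W ω ^ 3 * (W' ω - W ω) ∂μ) + 3 * (∫ ω, W ω ^ 2 * (W' ω - W ω) ^ 2 ∂μ)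
        + 3 * (∫ ω, W ω * (W' ω - W ω) ^ 3 ∂μ) + ∫ ω, (W' ω - W ω) ^ 4 ∂μ) := by
    rw [← integral_const_mul, ← integral_const_mul, ← integral_add i31 (i22.const_mul 3),
      add_assoc, ← integral_add (i13.const_mul 3) i04,
      ← integral_add (f := fun a => W a ^ 3 * (W' a - W a) + 3 * (W a ^ 2 * (W' a - W a) ^ 2))
        (g := fun a => 3 * (W a * (W' a - W a) ^ 3) + (W' a - W a) ^ 4)
        (i31.add (i22.const_mul 3)) ((i13.const_mul 3).add i04), ← integral_neg]
    congr 1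
    ext ω
    ring
  have r2 : ∫ ω, W' ω * (W ω - W' ω) ^ 3 ∂μ
      = -((∫ ω, W ω * (W' ω - W ω) ^ 3 ∂μ) + ∫ ω, (W' ω - W ω) ^ 4 ∂μ) := by
    rw [← integral_add i13 i04, ← integral_neg]
    congr 1
    ext ω
    ring
  linarith

/-- Lemma `exlemma2`, fourth-moment identity: let `(W, W')` be an
exchangeable pair of real random variables in `L⁴(P)`, `𝒢 ⊇ σ(W)` a sub-σ-field, and `λ > 0`
with `(1/λ) E[W' − W | 𝒢] = −W` a.s.  Then
`E[W⁴] = 3 E[W² · (1/(2λ)) E[(W'−W)² | 𝒢]] − (1/(4λ)) E[(W'−W)⁴]`. -/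
theorem exchangeable_pair_fourth_moment
    {Ω : Type*} [MeasurableSpace Ω] (μ : Measure Ω) [IsProbabilityMeasure μ]
    (W W' : Ω → ℝ) (hW : Measurable W) (hW' : Measurable W')
    (hWL4 : MemLp W 4 μ) (hW'L4 : MemLp W' 4 μ)
    (hexch : μ.map (fun ω => (W ω, W' ω)) = μ.map (fun ω => (W' ω, W ω)))
    (𝒢 : MeasurableSpace Ω) (h𝒢 : 𝒢 ≤ ‹MeasurableSpace Ω›)
    (hσW : MeasurableSpace.comap W inferInstance ≤ 𝒢)
    (lam : ℝ) (hlam : 0 < lam)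
    (hreg : ∀ᵐ ω ∂μ, (1 / lam) * (μ[fun ω => W' ω - W ω|𝒢]) ω = -W ω) :
    (∫ ω, (W ω) ^ 4 ∂μ)
      = 3 * (∫ ω, (W ω) ^ 2 *
            ((1 / (2 * lam)) * (μ[fun ω => (W' ω - W ω) ^ 2|𝒢]) ω) ∂μ)
        - (1 / (4 * lam)) * ∫ ω, (W' ω - W ω) ^ 4 ∂μ := by
  rename_i m0 _
  -- In the frozen statement `h𝒢` elaborates to `𝒢 ≤ 𝒢`, so split on whether `𝒢` is
  -- really a sub-σ-field; otherwise the conditional expectations are `0` and `W = 0` a.s.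
  have hD : MemLp (fun ω => W' ω - W ω) 4 μ := hW'L4.sub hWL4
  have hWm : StronglyMeasurable[𝒢] W :=
    ((comap_measurable W).mono hσW le_rfl).stronglyMeasurable
  have iD : Integrable (fun ω => W' ω - W ω) μ := hD.integrable (by norm_num)
  have iD2 : Integrable (fun ω => (W' ω - W ω) ^ 2) μ :=
    (hD.mono_exponent (p := 2) (by norm_num)).integrable_sq
  have key := aux_alg hW hW' hWL4 hW'L4 hexch
  by_cases hle : 𝒢 ≤ m0
  swap
  · have hW0 : ∀ᵐ ω ∂μ, W ω = 0 := by
      filter_upwards [hreg] with ω h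
      rw [condExp_of_not_le hle] at h
      simpa using h
    have z1 : ∫ ω, W ω ^ 3 * (W' ω - W ω) ∂μ = 0 :=
      integral_eq_zero_of_ae (by filter_upwards [hW0] with ω h; simp [h])
    have z2 : ∫ ω, W ω ^ 2 * (W' ω - W ω) ^ 2 ∂μ = 0 :=
      integral_eq_zero_of_ae (by filter_upwards [hW0] with ω h; simp [h])
    have z3 : ∫ ω, W ω ^ 4 ∂μ = 0 :=
      integral_eq_zero_of_ae (by filter_upwards [hW0] with ω h; simp [h])
    have z4 : ∫ ω, (W' ω - W ω) ^ 4 ∂μ = 0 := by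
      rw [z1, z2] at key
      linarith
    rw [z3, z4, condExp_of_not_le hle]
    simp
  have p1 := aux_pull (μ := μ) hle (hWm.pow 3) (g := fun ω => W' ω - W ω)
    (by simpa using aux_int31 hWL4 hD 3 1 rfl) iD
  have p2 := aux_pull (μ := μ) hle (hWm.pow 2) (g := fun ω => (W' ω - W ω) ^ 2)
    (aux_int31 hWL4 hD 2 2 rfl) iD2
  simp only [Pi.pow_apply] at p1 p2
  have q1 : ∫ ω, W ω ^ 3 * (μ[fun ω => W' ω - W ω|𝒢]) ω ∂μ = -lam * ∫ ω, W ω ^ 4 ∂μ := by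
    rw [← integral_const_mul]
    refine integral_congr_ae ?_
    filter_upwards [hreg] with ω h
    have h2 : (μ[fun ω => W' ω - W ω|𝒢]) ω = -lam * W ω := by
      field_simp at h
      linarith
    rw [h2]
    ring
  have q2 : ∫ ω, (W ω) ^ 2 * ((1 / (2 * lam)) * (μ[fun ω => (W' ω - W ω) ^ 2|𝒢]) ω) ∂μ
      = (1 / (2 * lam)) * ∫ ω, W ω ^ 2 * (W' ω - W ω) ^ 2 ∂μ := by
    rw [← p2, ← integral_const_mul]
    congr 1
    ext ω
    ring
  rw [q2]
  rw [← p1, q1] at key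
  field_simp
  linarith
end

section
/- Let (W, W') be an exchangeable pair of real random variables in L⁴(P), let G be a sub-σ-field containing σ(W), and let λ > 0 be such that (1/λ)E[W'−W | G] = −W almost surely. Then E[W³] = 2·E[ W · (1/(2λ))E[(W'−W)² | G] ]. -/
open MeasureTheory ProbabilityTheory Real

theorem integrable_abs_cube {Ω : Type*} {m0 : MeasurableSpace Ω} (μ : Measure Ω)
    [IsProbabilityMeasure μ] {X : Ω → ℝ} (hX : MemLp X 4 μ) :
    Integrable (fun ω => |X ω| ^ 3) μ := by
  have h34 : (3 : ENNReal) ≤ 4 := by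
    have : ((3 : ℕ) : ENNReal) ≤ ((4 : ℕ) : ENNReal) := Nat.cast_le.mpr (by norm_num)
    exact_mod_cast this
  have h : MemLp X ((3 : ℕ) : ENNReal) μ := hX.mono_exponent (by exact_mod_cast h34)
  exact h.integrable_norm_pow (by norm_num)

set_option maxHeartbeats 1000000 in
/-- Lemma `exlemma2`, third-moment identity: let `(W, W')` be an
exchangeable pair of real random variables in `L⁴(P)`, `𝒢 ⊇ σ(W)` a sub-σ-field, and `λ > 0`
with `(1/λ) E[W' − W | 𝒢] = −W` a.s.  Then
`E[W³] = 2 E[W · (1/(2λ)) E[(W'−W)² | 𝒢]]`. -/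
theorem exchangeable_pair_third_moment
    {Ω : Type*} [MeasurableSpace Ω] (μ : Measure Ω) [IsProbabilityMeasure μ]
    (W W' : Ω → ℝ) (hW : Measurable W) (hW' : Measurable W')
    (hWL4 : MemLp W 4 μ) (hW'L4 : MemLp W' 4 μ)
    (hexch : μ.map (fun ω => (W ω, W' ω)) = μ.map (fun ω => (W' ω, W ω)))
    (𝒢 : MeasurableSpace Ω) (h𝒢 : 𝒢 ≤ ‹MeasurableSpace Ω›)
    (hσW : MeasurableSpace.comap W inferInstance ≤ 𝒢)
    (lam : ℝ) (hlam : 0 < lam)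
    (hreg : ∀ᵐ ω ∂μ, (1 / lam) * (μ[fun ω => W' ω - W ω|𝒢]) ω = -W ω) :
    (∫ ω, (W ω) ^ 3 ∂μ)
      = 2 * ∫ ω, W ω *
          ((1 / (2 * lam)) * (μ[fun ω => (W' ω - W ω) ^ 2|𝒢]) ω) ∂μ := by
  rename_i m0 _
  by_cases hm : 𝒢 ≤ m0
  swap
  · have h0 : ∀ᵐ ω ∂μ, W ω = 0 := by
      filter_upwards [hreg] with ω hω
      rw [condExp_of_not_le hm] at hω
      simpa using hω.symm
    rw [condExp_of_not_le hm]
    have : ∫ ω, (W ω) ^ 3 ∂μ = ∫ ω, (0 : ℝ) ∂μ := by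
      apply integral_congr_ae
      filter_upwards [h0] with ω hω
      simp [hω]
    rw [this]
    simp
  have hW3 : Integrable (fun ω => |W ω| ^ 3) μ := integrable_abs_cube μ hWL4
  have hW'3 : Integrable (fun ω => |W' ω| ^ 3) μ := integrable_abs_cube μ hW'L4
  have key : ∀ a b : ℝ, 0 ≤ a → 0 ≤ b → a ^ 2 * b ≤ a ^ 3 + b ^ 3 := by
    intro a b ha hb
    rcases le_total a b with h | h
    · have : a ^ 2 * b ≤ b ^ 2 * b := by gcongr
      nlinarith [pow_nonneg ha 3]
    · have : a ^ 2 * b ≤ a ^ 2 * a := by gcongr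
      nlinarith [pow_nonneg hb 3]
  have i3 : Integrable (fun ω => W ω ^ 3) μ :=
    hW3.mono' (by fun_prop) (by filter_upwards with ω; simp)
  have i21 : Integrable (fun ω => W ω ^ 2 * W' ω) μ :=
    (hW3.add hW'3).mono' (by fun_prop) (by
      filter_upwards with ω
      simpa using key _ _ (abs_nonneg (W ω)) (abs_nonneg (W' ω)))
  have i12 : Integrable (fun ω => W' ω ^ 2 * W ω) μ :=
    (hW'3.add hW3).mono' (by fun_prop) (by
      filter_upwards with ω
      simpa using key _ _ (abs_nonneg (W' ω)) (abs_nonneg (W ω)))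
  have hex : ∫ ω, W ω ^ 2 * W' ω ∂μ = ∫ ω, W' ω ^ 2 * W ω ∂μ := by
    have hf : Measurable (fun p : ℝ × ℝ => p.1 ^ 2 * p.2) := by fun_prop
    have h1 := integral_map (μ := μ) (hW.prodMk hW').aemeasurable
      (f := fun p : ℝ × ℝ => p.1 ^ 2 * p.2) hf.aestronglyMeasurable
    have h2 := integral_map (μ := μ) (hW'.prodMk hW).aemeasurable
      (f := fun p : ℝ × ℝ => p.1 ^ 2 * p.2) hf.aestronglyMeasurable
    rw [hexch] at h1
    exact h1.symm.trans h2
  have hWG : Measurable[𝒢] W := measurable_iff_comap_le.mpr hσW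
  have hWs : StronglyMeasurable[𝒢] W := hWG.stronglyMeasurable
  have iW : Integrable W μ := hWL4.integrable (by norm_num)
  have iW' : Integrable W' μ := hW'L4.integrable (by norm_num)
  have L2 : MemLp (fun ω => W' ω - W ω) 2 μ :=
    (hW'L4.sub hWL4).mono_exponent (by norm_num)
  have iD : Integrable (fun ω => W' ω - W ω) μ := iW'.sub iW
  have iD2 : Integrable (fun ω => (W' ω - W ω) ^ 2) μ := L2.integrable_sq
  -- first identity
  have iA : Integrable (fun ω => W ω ^ 2 * (W' ω - W ω)) μ :=
    (i21.sub i3).congr (by filter_upwards with ω; simp only [Pi.sub_apply]; ring)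
  have e1 : ∫ ω, W ω ^ 2 * (W' ω - W ω) ∂μ = -lam * ∫ ω, W ω ^ 3 ∂μ := by
    have hp : μ[fun ω => W ω ^ 2 * (W' ω - W ω)|𝒢]
        =ᵐ[μ] fun ω => W ω ^ 2 * (μ[fun ω => W' ω - W ω|𝒢]) ω :=
      condExp_mul_of_stronglyMeasurable_left (hWs.pow 2) iA iD
    rw [← integral_condExp hm, ← integral_const_mul]
    apply integral_congr_ae
    filter_upwards [hp, hreg] with ω h1 h2
    rw [h1]
    have : (μ[fun ω => W' ω - W ω|𝒢]) ω = -lam * W ω := by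
      field_simp at h2
      linarith
    rw [this]; ring
  have iB : Integrable (fun ω => W ω * (W' ω - W ω) ^ 2) μ :=
    ((i12.sub (i21.const_mul 2)).add i3).congr (by
      filter_upwards with ω; simp only [Pi.sub_apply, Pi.add_apply]; ring)
  have e2 : ∫ ω, W ω * (μ[fun ω => (W' ω - W ω) ^ 2|𝒢]) ω ∂μ
      = ∫ ω, W ω * (W' ω - W ω) ^ 2 ∂μ := by
    have hp : μ[fun ω => W ω * (W' ω - W ω) ^ 2|𝒢]
        =ᵐ[μ] fun ω => W ω * (μ[fun ω => (W' ω - W ω) ^ 2|𝒢]) ω :=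
      condExp_mul_of_stronglyMeasurable_left hWs iB iD2
    rw [← integral_condExp hm (f := fun ω => W ω * (W' ω - W ω) ^ 2)]
    exact (integral_congr_ae hp).symm
  have e3 : ∫ ω, W ω * (W' ω - W ω) ^ 2 ∂μ
      = ∫ ω, W' ω ^ 2 * W ω ∂μ - 2 * ∫ ω, W ω ^ 2 * W' ω ∂μ + ∫ ω, W ω ^ 3 ∂μ := by
    rw [← integral_const_mul, ← integral_sub i12 (i21.const_mul 2),
      ← integral_add (f := fun ω => W' ω ^ 2 * W ω - 2 * (W ω ^ 2 * W' ω))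
        (i12.sub (i21.const_mul 2)) i3]
    congr 1; ext ω; ring
  have e4 : ∫ ω, W ω ^ 2 * (W' ω - W ω) ∂μ
      = ∫ ω, W ω ^ 2 * W' ω ∂μ - ∫ ω, W ω ^ 3 ∂μ := by
    rw [← integral_sub i21 i3]
    congr 1; ext ω; ring
  have e5 : ∫ ω, W ω * ((1 / (2 * lam)) * (μ[fun ω => (W' ω - W ω) ^ 2|𝒢]) ω) ∂μ
      = (1 / (2 * lam)) * ∫ ω, W ω * (μ[fun ω => (W' ω - W ω) ^ 2|𝒢]) ω ∂μ := by
    rw [← integral_const_mul]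
    congr 1; ext ω; ring
  have e6 : ∫ ω, W ω * (W' ω - W ω) ^ 2 ∂μ = lam * ∫ ω, W ω ^ 3 ∂μ := by linarith
  rw [e5, e2, e6]
  field_simp
end
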